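/- Fix an integer r ≥ 3. Let A_1, A_2, …, A_{C(n,r)} be a uniformly random ordering of all r-subsets of [n], let H_t = {A_1,…,A_t}, and let T = min{ t : A_1 ∪ ⋯ ∪ A_t = [n] } be the hitting time at which all vertices are covered. Then P(H_T contains a perfect matching) → 1 as n → ∞ through multiples of r. -/

import Mathlib

open Finset

/-- The set of perfect matchings of the `r`-graph `H` on vertex set `V`. -/
def pmSet (V : Finset ℕ) (H : Finset (Finset ℕ)) : Finset (Finset (Finset ℕ)) :=
  H.powerset.filter (fun M => (∀ A ∈ M, ∀ B ∈ M, A ≠ B → A ∩ B = ∅) ∧ M.biUnion id = V)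

/-- The number of perfect matchings of `H`. -/
def pmCount (V : Finset ℕ) (H : Finset (Finset ℕ)) : ℕ := (pmSet V H).card

/-- All `r`-element subsets of `[n]`. -/
def Kn (n r : ℕ) : Finset (Finset ℕ) := Finset.powersetCard r (Finset.range n)

/-- Given an ordering `σ` of all `r`-subsets of `[n]` (a bijection from
`Fin (C(n,r))` to `Kn n r`), `Ht n r t σ` is the `r`-graph `{A_1,…,A_t}`
consisting of the first `t` sets in the ordering. -/
def Ht (n r t : ℕ) (σ : Fin (Kn n r).card ≃ {A // A ∈ Kn n r}) : Finset (Finset ℕ) :=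
  (Finset.univ.filter (fun i : Fin (Kn n r).card => (i : ℕ) < t)).image
    (fun i => ((σ i) : Finset ℕ))

/-- The hitting time `T = min{t : A_1 ∪ ⋯ ∪ A_t = [n]}`. -/
noncomputable def hitTime (n r : ℕ) (σ : Fin (Kn n r).card ≃ {A // A ∈ Kn n r}) : ℕ :=
  sInf {t : ℕ | (Ht n r t σ).biUnion id = Finset.range n}

section spread
open scoped Classical

noncomputable def bexp {α : Type*} (E : Finset α) (p : ℝ) (f : Finset α → ℝ) : ℝ :=
  ∑ W ∈ E.powerset, p ^ #W * (1 - p) ^ (#E - #W) * f W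

lemma bexp_const {α : Type*} (E : Finset α) (p c : ℝ) : bexp E p (fun _ => c) = c := by
  unfold bexp
  rw [← Finset.sum_mul, Finset.sum_pow_mul_eq_add_pow]
  simp

lemma bexp_mono {α : Type*} (E : Finset α) {p : ℝ} (h0 : 0 ≤ p) (h1 : p ≤ 1)
    {f g : Finset α → ℝ} (h : ∀ W, W ⊆ E → f W ≤ g W) : bexp E p f ≤ bexp E p g := by
  unfold bexp
  apply Finset.sum_le_sum
  intro W hW
  have : 0 ≤ 1 - p := by linarith
  exact mul_le_mul_of_nonneg_left (h W (by simpa using hW)) (by positivity)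

lemma bexp_add {α : Type*} (E : Finset α) (p : ℝ) (f g : Finset α → ℝ) :
    bexp E p (fun W => f W + g W) = bexp E p f + bexp E p g := by
  unfold bexp
  rw [← Finset.sum_add_distrib]
  exact Finset.sum_congr rfl fun _ _ => by ring

lemma bexp_insert {α : Type*} (E : Finset α) (a : α) (ha : a ∉ E) (p : ℝ)
    (f : Finset α → ℝ) :
    bexp (insert a E) p f = p * bexp E p (fun W => f (insert a W)) + (1 - p) * bexp E p f := by
  unfold bexp
  rw [Finset.sum_powerset_insert ha, Finset.mul_sum, Finset.mul_sum, add_comm]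
  congr 1
  · apply Finset.sum_congr rfl
    intro W hW
    have hW' : W ⊆ E := by simpa using hW
    have : a ∉ W := fun h => ha (hW' h)
    rw [card_insert_of_notMem this, card_insert_of_notMem ha]
    rw [show #E + 1 - (#W + 1) = #E - #W by omega]
    ring
  · apply Finset.sum_congr rfl
    intro W hW
    have hW' : W ⊆ E := by simpa using hW
    have := card_le_card hW'
    rw [card_insert_of_notMem ha]
    rw [show #E + 1 - (#W) = (#E - #W) + 1 by omega]
    ring

lemma bexp_union {α : Type*} (E : Finset α) (p p' : ℝ) (f : Finset α → ℝ) :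
    bexp E p (fun W => bexp E p' (fun W' => f (W ∪ W'))) =
      bexp E (1 - (1 - p) * (1 - p')) f := by
  induction E using Finset.induction_on generalizing f with
  | empty => simp [bexp]
  | insert a E ha ih =>
    rw [bexp_insert _ _ ha, bexp_insert _ _ ha]
    have e1 : ∀ W : Finset α, bexp (insert a E) p' (fun W' => f (W ∪ W')) =
        p' * bexp E p' (fun W' => f (insert a (W ∪ W'))) + (1 - p') * bexp E p' (fun W' => f (W ∪ W')) := by
      intro W
      rw [bexp_insert _ _ ha]; simp only [union_insert]
    have e2 : ∀ W : Finset α, bexp (insert a E) p' (fun W' => f (insert a W ∪ W')) =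
        bexp E p' (fun W' => f (insert a (W ∪ W'))) := by
      intro W
      rw [bexp_insert _ _ ha]; simp only [union_insert, insert_union, insert_idem]; ring
    simp only [e2]; simp only [e1]
    have lin : ∀ (f g : Finset α → ℝ) (a b : ℝ), bexp E p (fun W => a * f W + b * g W) =
        a * bexp E p f + b * bexp E p g := by
      intro f g a b
      unfold bexp
      rw [Finset.mul_sum, Finset.mul_sum, ← Finset.sum_add_distrib]
      exact Finset.sum_congr rfl fun _ _ => by ring
    rw [lin, ih f, ih (fun W => f (insert a W))]
    ring

/-- one round of fragmentation -/
lemma spread_round {α ι : Type*} (E : Finset α) (Ω : Finset ι) (μ : ι → ℝ)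
    (hμ : ∀ i ∈ Ω, 0 ≤ μ i) (F : ι → Finset α) (hF : ∀ i ∈ Ω, F i ⊆ E) (M : ℕ)
    (hM : ∀ i ∈ Ω, #(F i) ≤ 2 * M) (q p x : ℝ) (hq : 0 ≤ q) (hp : 0 < p) (hp1 : p ≤ 1)
    (hx : q = p * x) (hx1 : x ≤ 1)
    (hs : ∀ T : Finset α, ∑ i ∈ Ω.filter (fun i => T ⊆ F i), μ i ≤ q ^ #T) :
    ∃ χ : Finset α → ι → Finset α,
      (∀ W, ∀ i ∈ Ω, χ W i ⊆ F i ∧ ∃ i' ∈ Ω, F i' ⊆ W ∪ χ W i) ∧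
      bexp E p (fun W => ∑ i ∈ Ω.filter (fun i => M ≤ #(χ W i)), μ i) ≤ (4 * x) ^ M := by
  have hx0 : 0 ≤ x := by
    by_contra h; push Not at h; nlinarith
  have ex : ∀ W : Finset α, ∀ i : ι, ∃ i' : ι, i ∈ Ω → (i' ∈ Ω ∧ F i' ⊆ W ∪ F i ∧
      ∀ j ∈ Ω, F j ⊆ W ∪ F i → #(F i' \ W) ≤ #(F j \ W)) := by
    intro W i
    by_cases hi : i ∈ Ω
    · obtain ⟨i', h1, h2⟩ := Finset.exists_min_image (Ω.filter (fun j => F j ⊆ W ∪ F i))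
        (fun j => #(F j \ W)) ⟨i, by simp [hi]⟩
      simp only [mem_filter] at h1 h2
      exact ⟨i', fun _ => ⟨h1.1, h1.2, fun j hj hj' => h2 j ⟨hj, hj'⟩⟩⟩
    · exact ⟨i, fun h => absurd h hi⟩
  choose m hm using ex
  have canon : ∃ cn : Finset α → Finset α, ∀ Z, (∃ i ∈ Ω, F i ⊆ Z) →
      ∃ i ∈ Ω, F i ⊆ Z ∧ cn Z = F i := by
    refine ⟨fun Z => if h : ∃ i ∈ Ω, F i ⊆ Z then F h.choose else ∅, ?_⟩
    intro Z h
    simp only [h, dite_true]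
    exact ⟨h.choose, h.choose_spec.1, h.choose_spec.2, rfl⟩
  obtain ⟨cn, hcn⟩ := canon
  refine ⟨fun W i => F (m W i) \ W, ?_, ?_⟩
  · intro W i hi
    obtain ⟨h1, h2, h3⟩ := hm W i hi
    refine ⟨?_, m W i, h1, ?_⟩
    · intro a ha
      rw [mem_sdiff] at ha
      have := h2 ha.1
      rw [mem_union] at this
      tauto
    · intro a ha
      simp only [mem_union, mem_sdiff]; tauto
  -- the pairs
  set w : Finset α → ℝ := fun W => p ^ #W * (1 - p) ^ (#E - #W) with hw
  have hw0 : ∀ W, 0 ≤ w W := by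
    intro W
    have : 0 ≤ 1 - p := by linarith
    simp only [hw]; positivity
  let TT : Finset α → Finset (Finset α) := fun W =>
    (Ω.image (fun i => F (m W i) \ W)).filter (fun T => M ≤ #T)
  have step1 : ∀ W, ∑ i ∈ Ω.filter (fun i => M ≤ #(F (m W i) \ W)), μ i ≤ ∑ T ∈ TT W, q ^ #T := by
    intro W
    have : ∀ i ∈ Ω.filter (fun i => M ≤ #(F (m W i) \ W)), F (m W i) \ W ∈ TT W := by
      intro i hi
      simp only [mem_filter] at hi
      simp only [TT, mem_filter, mem_image]
      exact ⟨⟨i, hi.1, rfl⟩, hi.2⟩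
    rw [← Finset.sum_fiberwise_of_maps_to this]
    apply Finset.sum_le_sum
    intro T hT
    refine le_trans ?_ (hs T)
    apply Finset.sum_le_sum_of_subset_of_nonneg
    · intro i hi
      simp only [mem_filter] at hi ⊢
      refine ⟨hi.1.1, ?_⟩
      obtain ⟨h1, h2, h3⟩ := hm W i hi.1.1
      rw [← hi.2]
      intro a ha
      rw [mem_sdiff] at ha
      have := h2 ha.1
      rw [mem_union] at this
      tauto
    · intro i hi _
      exact hμ i (by simp only [mem_filter] at hi; exact hi.1)
  let pairs : Finset (Σ _ : Finset α, Finset α) := E.powerset.sigma TT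
  let pairs2 : Finset (Σ _ : Finset α, Finset α) :=
    E.powerset.sigma (fun Z => (if #(cn Z) ≤ 2 * M then (cn Z).powerset else ∅).filter (fun T => M ≤ #T))
  have key : ∀ y ∈ pairs, (⟨y.1 ∪ y.2, y.2⟩ : Σ _ : Finset α, Finset α) ∈ pairs2 ∧ Disjoint y.1 y.2 ∧
      y.1 ⊆ E ∧ y.2 ⊆ E := by
    rintro ⟨W, T⟩ hy
    simp only [pairs, mem_sigma, mem_powerset, TT, mem_filter, mem_image] at hy
    obtain ⟨hWE, ⟨i, hi, rfl⟩, hMT⟩ := hy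
    obtain ⟨h1, h2, h3⟩ := hm W i hi
    have hTE : F (m W i) \ W ⊆ E := fun a ha => hF _ h1 (mem_sdiff.1 ha).1
    obtain ⟨j, hj, hjZ, hcj⟩ := hcn (W ∪ F (m W i) \ W) ⟨m W i, h1, by
      intro a ha; simp only [mem_union, mem_sdiff]; tauto⟩
    refine ⟨?_, disjoint_sdiff, hWE, hTE⟩
    simp only [pairs2, mem_sigma, mem_powerset, mem_filter]
    refine ⟨union_subset hWE hTE, ?_, hMT⟩
    rw [if_pos (by rw [hcj]; exact hM j hj), mem_powerset, hcj]
    have hsub : F j \ W ⊆ F (m W i) \ W := by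
      intro a ha
      rw [mem_sdiff] at ha
      have := hjZ ha.1
      rw [mem_union] at this
      tauto
    have hjj : F j ⊆ W ∪ F i := by
      intro a ha
      have := hjZ ha
      simp only [mem_union, mem_sdiff] at this ⊢
      rcases this with h | h
      · exact Or.inl h
      · have := h2 h.1
        rw [mem_union] at this
        exact this
    have heq := Finset.eq_of_subset_of_card_le hsub (h3 j hj hjj)
    rw [← heq]
    exact sdiff_subset
  have step2 : bexp E p (fun W => ∑ i ∈ Ω.filter (fun i => M ≤ #(F (m W i) \ W)), μ i) ≤
      ∑ y ∈ pairs, x ^ #y.2 * w (y.1 ∪ y.2) := by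
    calc _ ≤ ∑ W ∈ E.powerset, w W * ∑ T ∈ TT W, q ^ #T := by
          unfold bexp
          apply Finset.sum_le_sum
          intro W _
          exact mul_le_mul_of_nonneg_left (step1 W) (hw0 W)
      _ = ∑ y ∈ pairs, w y.1 * q ^ #y.2 := by
          simp only [pairs]
          rw [Finset.sum_sigma]
          simp only [Finset.mul_sum]
      _ ≤ _ := by
          apply Finset.sum_le_sum
          rintro ⟨W, T⟩ hy
          obtain ⟨-, hd, hWE, hTE⟩ := key _ hy
          dsimp only at hd hWE hTE ⊢
          simp only [hw]
          rw [card_union_of_disjoint hd, hx]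
          have hc : #W + #T ≤ #E := by
            rw [← card_union_of_disjoint hd]; exact card_le_card (union_subset hWE hTE)
          rw [show #E - #W = (#E - (#W + #T)) + #T by omega, pow_add, mul_pow, pow_add]
          have h1p : 0 ≤ 1 - p := by linarith
          have : (1 - p) ^ #T ≤ 1 := pow_le_one₀ h1p (by linarith)
          have h2 : 0 ≤ p ^ #W * (1 - p) ^ (#E - (#W + #T)) * (p ^ #T * x ^ #T) := by positivity
          nlinarith
  refine step2.trans ?_
  have step3 : ∑ y ∈ pairs, x ^ #y.2 * w (y.1 ∪ y.2) ≤ ∑ y ∈ pairs2, x ^ #y.2 * w y.1 := by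
    rw [← Finset.sum_image (f := fun y : Σ _ : Finset α, Finset α => x ^ #y.2 * w y.1)
      (g := fun y : Σ _ : Finset α, Finset α => (⟨y.1 ∪ y.2, y.2⟩ : Σ _ : Finset α, Finset α))]
    · apply Finset.sum_le_sum_of_subset_of_nonneg
      · intro y hy
        rw [mem_image] at hy
        obtain ⟨y', hy', rfl⟩ := hy
        exact (key _ hy').1
      · intro y _ _
        exact mul_nonneg (by positivity) (hw0 _)
    · rintro ⟨W, T⟩ hy ⟨W', T'⟩ hy' h
      simp only [Sigma.mk.injEq, heq_eq_eq] at h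
      obtain ⟨h1, rfl⟩ := h
      have d1 := (key _ hy).2.1
      have d2 := (key _ hy').2.1
      dsimp only at d1 d2
      have : W = W' := by
        rw [← Finset.union_sdiff_cancel_right d1, h1, Finset.union_sdiff_cancel_right d2]
      rw [this]
  refine step3.trans ?_
  simp only [pairs2]
  rw [Finset.sum_sigma]
  calc _ ≤ ∑ Z ∈ E.powerset, w Z * (4 * x) ^ M := by
        apply Finset.sum_le_sum
        intro Z _
        dsimp only
        rw [← Finset.sum_mul, mul_comm]
        apply mul_le_mul_of_nonneg_left _ (hw0 Z)
        calc _ ≤ ∑ T ∈ (if #(cn Z) ≤ 2 * M then (cn Z).powerset else ∅).filter (fun T => M ≤ #T), x ^ M := by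
              apply Finset.sum_le_sum
              intro T hT
              rw [mem_filter] at hT
              exact pow_le_pow_of_le_one hx0 hx1 hT.2
          _ = #((if #(cn Z) ≤ 2 * M then (cn Z).powerset else ∅).filter (fun T => M ≤ #T)) * x ^ M := by
              rw [sum_const, nsmul_eq_mul]
          _ ≤ (4:ℝ) ^ M * x ^ M := by
              apply mul_le_mul_of_nonneg_right _ (by positivity)
              have : #((if #(cn Z) ≤ 2 * M then (cn Z).powerset else ∅).filter (fun T => M ≤ #T)) ≤ 4 ^ M := by
                refine (card_filter_le _ _).trans ?_
                split_ifs with h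
                · rw [card_powerset, show 4 = 2 ^ 2 by norm_num, ← pow_mul]
                  exact Nat.pow_le_pow_right (by norm_num) h
                · simp
              exact_mod_cast this
          _ = _ := by rw [mul_pow]
    _ = (4 * x) ^ M := by
        rw [← Finset.sum_mul]
        have := bexp_const E p 1
        unfold bexp at this
        simp only [mul_one] at this
        rw [this, one_mul]

theorem spread_main {α ι : Type*} (E : Finset α) (q p x : ℝ) (hq : 0 ≤ q) (hp : 0 < p)
    (hp1 : p ≤ 1) (hx : q = p * x) (hx1 : x ≤ 1) (μ : ι → ℝ) (J : ℕ) :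
    ∀ (Ω : Finset ι) (_ : ∀ i ∈ Ω, 0 ≤ μ i) (F : ι → Finset α) (_ : ∀ i ∈ Ω, F i ⊆ E)
    (_ : ∀ i ∈ Ω, #(F i) < 2 ^ J)
    (_ : ∀ T : Finset α, ∑ i ∈ Ω.filter (fun i => T ⊆ F i), μ i ≤ q ^ #T),
    bexp E (1 - (1 - p) ^ J) (fun W => if ∃ i ∈ Ω, F i ⊆ W then 0 else 1) ≤
      1 - ∑ i ∈ Ω, μ i + ∑ j ∈ range J, (4 * x) ^ (2 ^ j) := by
  induction J with
  | zero =>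
    intro Ω hμ F hF hJ hs
    have h1 : ∑ i ∈ Ω, μ i ≤ 1 := by simpa using hs ∅
    by_cases h : Ω.Nonempty
    · obtain ⟨i, hi⟩ := h
      have : F i = ∅ := by have := hJ i hi; simpa using this
      have h2 : ∀ W : Finset α, (∃ i ∈ Ω, F i ⊆ W) := fun W => ⟨i, hi, by simp [this]⟩
      simp only [h2, if_true]
      rw [bexp_const]; simp; linarith
    · rw [not_nonempty_iff_eq_empty] at h
      subst h
      simp [bexp_const]
  | succ J ih =>
    intro Ω hμ F hF hJ hs
    obtain ⟨χ, hχ, hb⟩ := spread_round E Ω μ hμ F hF (2 ^ J)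
      (fun i hi => by have := hJ i hi; rw [pow_succ] at this; omega) q p x hq hp hp1 hx hx1 hs
    have hJ0 : 0 ≤ 1 - (1 - p) ^ J := by
      have : (1 - p) ^ J ≤ 1 := pow_le_one₀ (by linarith) (by linarith)
      linarith
    have hJ1 : 1 - (1 - p) ^ J ≤ 1 := by
      have : 0 ≤ (1 - p) ^ J := pow_nonneg (by linarith) _
      linarith
    have e : 1 - (1 - p) ^ (J + 1) = 1 - (1 - p) * (1 - (1 - (1 - p) ^ J)) := by ring
    rw [e, ← bexp_union]
    have step : ∀ W, W ⊆ E → bexp E (1 - (1 - p) ^ J) (fun W' => if ∃ i ∈ Ω, F i ⊆ W ∪ W' then (0:ℝ) else 1)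
        ≤ (1 - ∑ i ∈ Ω, μ i + ∑ j ∈ range J, (4 * x) ^ (2 ^ j)) +
          ∑ i ∈ Ω.filter (fun i => 2 ^ J ≤ #(χ W i)), μ i := by
      intro W _
      have := ih (Ω.filter (fun i => ¬ 2 ^ J ≤ #(χ W i))) (fun i hi => hμ i (mem_filter.1 hi).1) (χ W)
        (fun i hi => ((hχ W i (mem_filter.1 hi).1).1).trans (hF i (mem_filter.1 hi).1))
        (fun i hi => by have := (mem_filter.1 hi).2; omega)
        (fun T => by
          refine le_trans ?_ (hs T)
          apply Finset.sum_le_sum_of_subset_of_nonneg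
          · intro i hi
            simp only [mem_filter] at hi ⊢
            exact ⟨hi.1.1, hi.2.trans (hχ W i hi.1.1).1⟩
          · intro i hi _
            exact hμ i (by simp only [mem_filter] at hi; exact hi.1))
      have hsplit := Finset.sum_filter_add_sum_filter_not Ω (fun i => 2 ^ J ≤ #(χ W i)) μ
      refine le_trans (bexp_mono E hJ0 hJ1 (g := fun W' => if ∃ i ∈ Ω.filter (fun i => ¬ 2 ^ J ≤ #(χ W i)), χ W i ⊆ W' then (0:ℝ) else 1) ?_) (this.trans (by linarith))
      intro W' _
      by_cases h : ∃ i ∈ Ω.filter (fun i => ¬ 2 ^ J ≤ #(χ W i)), χ W i ⊆ W'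
      · have h' : ∃ i ∈ Ω, F i ⊆ W ∪ W' := by
          obtain ⟨i, hi, hi'⟩ := h
          obtain ⟨-, i', hi'', h3⟩ := hχ W i (mem_filter.1 hi).1
          exact ⟨i', hi'', h3.trans (union_subset_union_right hi')⟩
        simp only [h, h', if_true, le_refl]
      · simp only [h, if_false]
        split_ifs <;> norm_num
    refine (bexp_mono E hp.le hp1 step).trans ?_
    rw [bexp_add, bexp_const, sum_range_succ]
    linarith

end spread

section partB
open scoped Classical

lemma desc_lower (k s : ℕ) (hs : s ≤ k) (hk : 0 < k) :
    ((k - s).factorial : ℝ) / (k.factorial : ℝ) ≤ (Real.exp 1 / k) ^ s := by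
  have h1 : (k:ℝ) ^ s * (s.factorial : ℝ) ≤ (s:ℝ) ^ s * (k.descFactorial s : ℝ) := by
    have e1 : (s.factorial : ℝ) = ∏ i ∈ range s, ((s - i : ℕ) : ℝ) := by
      rw [← Nat.descFactorial_self, Nat.descFactorial_eq_prod_range]; push_cast; rfl
    have e2 : (k.descFactorial s : ℝ) = ∏ i ∈ range s, ((k - i : ℕ) : ℝ) := by
      rw [Nat.descFactorial_eq_prod_range]; push_cast; rfl
    rw [e1, e2, ← Finset.card_range s]
    rw [← Finset.prod_const, ← Finset.prod_const]
    simp only [Finset.card_range]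
    rw [← Finset.prod_mul_distrib, ← Finset.prod_mul_distrib]
    apply Finset.prod_le_prod
    · intros; positivity
    · intro i hi
      have hi' := mem_range.mp hi
      rw [Nat.cast_sub (by omega), Nat.cast_sub (by omega)]
      have : (s:ℝ) ≤ k := by exact_mod_cast hs
      have h0 : (0:ℝ) ≤ i := by positivity
      nlinarith
  have h2 : (s:ℝ) ^ s ≤ Real.exp s * s.factorial := by
    have := Real.pow_div_factorial_le_exp (x := (s:ℝ)) (by positivity) s
    rwa [div_le_iff₀ (by positivity)] at this
  have h3 : ((k - s).factorial : ℝ) * k.descFactorial s = k.factorial := by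
    exact_mod_cast Nat.factorial_mul_descFactorial hs
  have hd : (0:ℝ) < k.descFactorial s := by
    have : 0 < k.descFactorial s := Nat.descFactorial_pos.mpr hs
    exact_mod_cast this
  have hkf : (0:ℝ) < (k-s).factorial := by positivity
  have hsf : (0:ℝ) < s.factorial := by positivity
  have hk' : (0:ℝ) < k := by exact_mod_cast hk
  rw [← h3, div_pow, ← Real.exp_nat_mul, mul_one, div_le_div_iff₀ (by positivity) (by positivity)]
  have h4 : (k:ℝ) ^ s ≤ Real.exp s * k.descFactorial s := by
    have : (k:ℝ) ^ s * (s.factorial : ℝ) ≤ (Real.exp s * k.descFactorial s) * s.factorial := by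
      nlinarith
    exact le_of_mul_le_mul_right this hsf
  nlinarith

lemma perm_count (k : ℕ) {S : Type*} (A : Finset S) (a x : S → Fin k) (ha : Set.InjOn a A) :
    #(univ.filter (fun π : Equiv.Perm (Fin k) => ∀ s ∈ A, π (a s) = x s)) ≤ (k - #A).factorial := by
  by_cases hne : (univ.filter (fun π : Equiv.Perm (Fin k) => ∀ s ∈ A, π (a s) = x s)).Nonempty
  · obtain ⟨π0, h0⟩ := hne
    simp only [mem_filter, mem_univ, true_and] at h0
    have e := Equiv.Perm.subtypeEquivSubtypePerm (fun i : Fin k => i ∉ A.image a)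
    have hc : Fintype.card {f : Equiv.Perm (Fin k) // ∀ i, ¬ (i ∉ A.image a) → f i = i} = (k - #A).factorial := by
      rw [← Fintype.card_congr e, Fintype.card_perm]
      congr 1
      rw [Fintype.card_subtype_compl, Fintype.card_fin, Fintype.card_coe, Finset.card_image_of_injOn ha]
    rw [← hc, Fintype.card_subtype]
    apply Finset.card_le_card_of_injOn (fun π => π0⁻¹ * π)
    · intro π hπ
      simp only [coe_filter, mem_univ, true_and, Set.mem_ofPred_eq] at hπ ⊢
      intro i hi
      push Not at hi
      obtain ⟨s, hs, rfl⟩ := mem_image.mp hi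
      simp only [Equiv.Perm.mul_apply]
      rw [hπ s hs, ← h0 s hs]; simp
    · intro π _ π' _ h
      simpa using h
  · rw [Finset.not_nonempty_iff_eq_empty.mp hne]; simp

/-- explicit spread measure on the perfect matchings of `U` -/
lemma pm_measure {V : Type*} (U : Finset V) (m k : ℕ) (hk : 0 < k)
    (hU : #U = (m+1) * k) :
    ∃ T : (Fin m → Equiv.Perm (Fin k)) → Finset (Finset V),
      (∀ π, (∀ A ∈ T π, #A = m+1 ∧ A ⊆ U) ∧ (∀ A ∈ T π, ∀ B ∈ T π, A ≠ B → Disjoint A B) ∧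
        (T π).biUnion id = U) ∧
      ∀ S : Finset (Finset V),
        (#(univ.filter (fun π => S ⊆ T π)) : ℝ) /
          (Fintype.card (Fin m → Equiv.Perm (Fin k)) : ℝ) ≤ ((Real.exp 1 / k) ^ m) ^ #S := by
  have e : Fin (m+1) × Fin k ≃ U := Fintype.equivOfCardEq (by simp [hU])
  let P : (Fin m → Equiv.Perm (Fin k)) → Fin (m+1) → Equiv.Perm (Fin k) := fun π => Fin.cons 1 π
  let ed : (Fin m → Equiv.Perm (Fin k)) → Fin k → Finset V := fun π i =>
    univ.image (fun j => (e (j, P π j i) : V))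
  have hinj : ∀ a b, (e a : V) = e b → a = b := fun a b h => e.injective (Subtype.ext h)
  have hmem : ∀ π i j x, (e (j, x) : V) ∈ ed π i ↔ x = P π j i := by
    intro π i j x
    simp only [ed, mem_image, mem_univ, true_and]
    constructor
    · rintro ⟨j', h⟩
      have := hinj _ _ h
      simp only [Prod.mk.injEq] at this
      obtain ⟨rfl, h'⟩ := this
      exact h'.symm
    · rintro rfl; exact ⟨j, rfl⟩
  have hdis : ∀ π i i', i ≠ i' → Disjoint (ed π i) (ed π i') := by
    intro π i i' hne
    rw [Finset.disjoint_left]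
    intro v hv hv'
    obtain ⟨j, -, rfl⟩ := mem_image.mp hv
    rw [hmem] at hv'
    exact hne ((P π j).injective hv')
  let T : (Fin m → Equiv.Perm (Fin k)) → Finset (Finset V) := fun π => univ.image (ed π)
  refine ⟨T, ?_, ?_⟩
  · intro π
    refine ⟨?_, ?_, ?_⟩
    · intro A hA
      obtain ⟨i, -, rfl⟩ := mem_image.mp hA
      constructor
      · rw [Finset.card_image_of_injective]
        · simp
        · intro j j' h
          exact (Prod.mk.inj (hinj _ _ h)).1
      · intro v hv
        obtain ⟨j, -, rfl⟩ := mem_image.mp hv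
        exact (e _).2
    · intro A hA B hB hAB
      obtain ⟨i, -, rfl⟩ := mem_image.mp hA
      obtain ⟨i', -, rfl⟩ := mem_image.mp hB
      exact hdis π i i' (fun h => hAB (by rw [h]))
    · ext v
      simp only [T, mem_biUnion, mem_image, mem_univ, true_and, id]
      constructor
      · rintro ⟨A, ⟨i, rfl⟩, hv⟩
        obtain ⟨j, -, rfl⟩ := mem_image.mp hv
        exact (e _).2
      · intro hv
        obtain ⟨⟨j, x⟩, hx⟩ := e.surjective ⟨v, hv⟩
        refine ⟨_, ⟨(P π j).symm x, rfl⟩, ?_⟩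
        have : v = e (j, x) := by rw [hx]
        rw [this, hmem]; simp
  · intro S
    by_cases hne : (univ.filter (fun π => S ⊆ T π)).Nonempty
    swap
    · rw [Finset.not_nonempty_iff_eq_empty.mp hne]; simp; positivity
    obtain ⟨π0, h0⟩ := hne
    simp only [mem_filter, mem_univ, true_and] at h0
    have : ∀ s, ∃ i, s ∈ S → s = ed π0 i := by
      intro s
      by_cases hs : s ∈ S
      · obtain ⟨i, -, hi⟩ := mem_image.mp (h0 hs)
        exact ⟨i, fun _ => hi.symm⟩
      · exact ⟨⟨0, hk⟩, fun h => absurd h hs⟩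
    choose a ha using this
    have hainj : Set.InjOn a S := by
      intro s hs t ht h
      rw [ha s hs, ha t ht, h]
    have hsub : univ.filter (fun π => S ⊆ T π) ⊆
        Fintype.piFinset (fun j : Fin m => univ.filter (fun σ : Equiv.Perm (Fin k) =>
          ∀ s ∈ S, σ (a s) = π0 j (a s))) := by
      intro π hπ
      simp only [mem_filter, mem_univ, true_and] at hπ
      rw [Fintype.mem_piFinset]
      intro j
      simp only [mem_filter, mem_univ, true_and]
      intro s hs
      obtain ⟨i, -, hi⟩ := mem_image.mp (hπ hs)
      have h1 : (e (0, a s) : V) ∈ s := by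
        have : (e (0, a s) : V) ∈ ed π0 (a s) := by rw [hmem]; simp [P]
        rwa [← ha s hs] at this
      have h2 : a s = i := by
        have h1' : (e (0, a s) : V) ∈ ed π i := by rw [hi]; exact h1
        rw [hmem] at h1'; simpa [P] using h1'
      have h3 : (e (j.succ, π0 j (a s)) : V) ∈ s := by
        have : (e (j.succ, π0 j (a s)) : V) ∈ ed π0 (a s) := by rw [hmem]; simp [P]
        rwa [← ha s hs] at this
      have h3' : (e (j.succ, π0 j (a s)) : V) ∈ ed π i := by rw [hi]; exact h3
      rw [hmem] at h3'
      rw [h3', h2]; simp [P]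
    have hcard := Finset.card_le_card hsub
    rw [Fintype.card_piFinset] at hcard
    have hSk : #S ≤ k := by
      have := Finset.card_le_card_of_injOn a (t := univ) (by simp) hainj
      simpa using this
    have hb : #(univ.filter (fun π => S ⊆ T π)) ≤ ((k - #S).factorial) ^ m := by
      refine hcard.trans ?_
      calc _ ≤ ∏ _j : Fin m, (k - #S).factorial := Finset.prod_le_prod' (fun j _ => perm_count k S a _ hainj)
        _ = _ := by simp
    have hc : Fintype.card (Fin m → Equiv.Perm (Fin k)) = k.factorial ^ m := by
      simp [Fintype.card_perm]
    rw [hc]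
    push_cast
    calc _ ≤ (((k - #S).factorial : ℝ) ^ m) / (k.factorial : ℝ) ^ m := by
            gcongr; exact_mod_cast hb
      _ = (((k - #S).factorial : ℝ) / (k.factorial : ℝ)) ^ m := by rw [div_pow]
      _ ≤ ((Real.exp 1 / k) ^ #S) ^ m := by gcongr; exact desc_lower k _ hSk hk
      _ = _ := by rw [← pow_mul, ← pow_mul, mul_comm]
end partB

section partC
open scoped Classical

noncomputable def ex {Ω : Type*} [Finite Ω] (f : Ω → ℝ) : ℝ :=
  (∑ w ∈ @univ Ω (Fintype.ofFinite Ω), f w) / (@Fintype.card Ω (Fintype.ofFinite Ω) : ℝ)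
noncomputable def pr {Ω : Type*} [Finite Ω] (P : Ω → Prop) : ℝ :=
  (#((@univ Ω (Fintype.ofFinite Ω)).filter P) : ℝ) / (@Fintype.card Ω (Fintype.ofFinite Ω) : ℝ)

variable {Ω Ω' : Type*} [Fintype Ω] [Fintype Ω']

lemma ex_def (f : Ω → ℝ) : ex f = (∑ w, f w) / Fintype.card Ω := by
  unfold ex
  congr!

lemma pr_def (P : Ω → Prop) [DecidablePred P] :
    pr P = (#(univ.filter P) : ℝ) / Fintype.card Ω := by
  unfold pr
  congr!

lemma pr_eq_ex (P : Ω → Prop) [DecidablePred P] : pr P = ex (fun w => if P w then 1 else 0) := by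
  simp only [pr_def, ex_def]
  rw [Finset.sum_boole]

lemma ex_mono {f g : Ω → ℝ} (h : ∀ w, f w ≤ g w) : ex f ≤ ex g := by
  simp only [ex_def]; gcongr; exact h _

lemma ex_nonneg {f : Ω → ℝ} (h : ∀ w, 0 ≤ f w) : 0 ≤ ex f := by
  simp only [ex_def]; have := Finset.sum_nonneg (fun w (_ : w ∈ (univ : Finset Ω)) => h w); positivity

lemma ex_add (f g : Ω → ℝ) : ex (fun w => f w + g w) = ex f + ex g := by
  simp only [ex_def]; rw [sum_add_distrib, add_div]

lemma ex_mul (c : ℝ) (f : Ω → ℝ) : ex (fun w => c * f w) = c * ex f := by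
  simp only [ex_def]; rw [← mul_sum, mul_div_assoc]

lemma ex_sum {ι : Type*} (s : Finset ι) (f : ι → Ω → ℝ) :
    ex (fun w => ∑ i ∈ s, f i w) = ∑ i ∈ s, ex (f i) := by
  simp only [ex_def]; rw [sum_comm, sum_div]

lemma ex_const [Nonempty Ω] (c : ℝ) : ex (fun _ : Ω => c) = c := by
  simp only [ex_def]; simp

lemma ex_const_le (c : ℝ) (hc : 0 ≤ c) : ex (fun _ : Ω => c) ≤ c := by
  rcases isEmpty_or_nonempty Ω with h | h
  · simpa [ex_def] using hc
  · rw [ex_const]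

lemma pr_nonneg (P : Ω → Prop) : 0 ≤ pr P := by simp only [pr_def]; positivity

lemma pr_mono {P Q : Ω → Prop} (h : ∀ w, P w → Q w) : pr P ≤ pr Q := by
  simp only [pr_def]; gcongr
  rename_i w _; exact h w

lemma pr_le_one (P : Ω → Prop) : pr P ≤ 1 := by
  simp only [pr_def]
  apply div_le_one_of_le₀ _ (by positivity)
  exact_mod_cast card_le_univ _

lemma pr_le_ex {P : Ω → Prop} {f : Ω → ℝ} (h0 : ∀ w, 0 ≤ f w) (h : ∀ w, P w → 1 ≤ f w) :
    pr P ≤ ex f := by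
  rw [pr_eq_ex]; apply ex_mono
  intro w; split_ifs with hw
  · exact h w hw
  · exact h0 w

lemma pr_or_le (P Q : Ω → Prop) : pr (fun w => P w ∨ Q w) ≤ pr P + pr Q := by
  rw [pr_def, pr_def, pr_def]
  rw [← add_div]; gcongr
  have : univ.filter (fun w => P w ∨ Q w) ⊆ univ.filter P ∪ univ.filter Q := by
    intro w; simp
  exact_mod_cast (card_le_card this).trans (card_union_le _ _)

lemma pr_exists_le {ι : Type*} (s : Finset ι) (P : ι → Ω → Prop) :
    pr (fun w => ∃ i ∈ s, P i w) ≤ ∑ i ∈ s, pr (P i) := by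
  calc _ ≤ ex (fun w => ∑ i ∈ s, if P i w then (1:ℝ) else 0) := by
        apply pr_le_ex
        · intro w; exact sum_nonneg fun i _ => by split_ifs <;> norm_num
        · rintro w ⟨i, hi, hP⟩
          calc (1:ℝ) = if P i w then 1 else 0 := by simp [hP]
            _ ≤ _ := single_le_sum (f := fun i => if P i w then (1:ℝ) else 0)
              (fun i _ => by split_ifs <;> norm_num) hi
    _ = _ := by rw [ex_sum]; simp only [pr_eq_ex]

lemma pr_not [Nonempty Ω] (P : Ω → Prop) : pr (fun w => ¬ P w) = 1 - pr P := by
  have h := Finset.card_filter_add_card_filter_not (s := (univ : Finset Ω)) P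
  have hc : (0:ℝ) < Fintype.card Ω := by exact_mod_cast Fintype.card_pos
  rw [pr_def, pr_def]
  rw [eq_sub_iff_add_eq, ← add_div, div_eq_one_iff_eq hc.ne']
  rw [add_comm]; rw [card_univ] at h; exact_mod_cast h

/-- Markov -/
lemma pr_markov (f : Ω → ℝ) (hf : ∀ w, 0 ≤ f w) (a : ℝ) (ha : 0 < a) :
    pr (fun w => a ≤ f w) ≤ ex f / a := by
  rw [div_eq_inv_mul, ← ex_mul]
  apply pr_le_ex
  · intro w; have := hf w; positivity
  · intro w hw; rw [inv_mul_eq_div, one_le_div ha]; exact hw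

lemma ex_prodtype (f : Ω × Ω' → ℝ) : ex f = ex (fun w => ex (fun w' => f (w, w'))) := by
  simp only [ex_def]
  rw [Fintype.sum_prod_type, Fintype.card_prod, ← sum_div]
  push_cast; rw [div_div, mul_comm]

lemma ex_equiv (e : Ω ≃ Ω') (f : Ω' → ℝ) : ex (fun w => f (e w)) = ex f := by
  simp only [ex_def]
  rw [Fintype.card_congr e, Equiv.sum_comp e f]

lemma ex_pi {α β : Type*} [Fintype α] [Fintype β] (f : α → β → ℝ) :
    ex (fun l : α → β => ∏ a, f a (l a)) = ∏ a, ex (f a) := by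
  simp only [ex_def]
  rw [Finset.prod_div_distrib, Finset.prod_univ_sum, Fintype.piFinset_univ]
  simp

lemma ex_fin_lt {B b : ℕ} (hb : b ≤ B) : ex (fun i : Fin B => if (i:ℕ) < b then (1:ℝ) else 0) = b / B := by
  rw [← pr_eq_ex, pr_def]
  have : #(univ.filter (fun i : Fin B => (i:ℕ) < b)) = b := by
    have h := Finset.card_bij (s := univ.filter (fun i : Fin B => (i:ℕ) < b)) (t := range b) (fun i _ => (i:ℕ))
      (by intro i hi; simpa using hi) (by intro i _ j _ h; exact Fin.ext h)
      (by intro j hj; simp at hj; exact ⟨⟨j, by omega⟩, by simpa using hj, rfl⟩)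
    simpa using h
  rw [this]; simp

lemma mgf {α : Type*} [Fintype α] {B b0 b2 : ℕ} (hB : 0 < B) (h0 : b0 ≤ B) (h2 : b2 ≤ B)
    (F X : Finset α) (hd : Disjoint F X) (θ : ℝ) :
    ex (fun l : α → Fin B => (if ∀ A ∈ F, (l A : ℕ) < b2 then 1 else 0) *
      θ ^ #(X.filter (fun A => (l A : ℕ) < b0))) =
      ((b2:ℝ)/B) ^ #F * (1 + (θ - 1) * ((b0:ℝ)/B)) ^ #X := by
  have : NeZero B := ⟨hB.ne'⟩
  let f : α → Fin B → ℝ := fun A i => (if A ∈ F then (if (i:ℕ) < b2 then 1 else 0) else 1) *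
    (if A ∈ X then 1 + (θ - 1) * (if (i:ℕ) < b0 then 1 else 0) else 1)
  have h1 : ∀ l : α → Fin B, (if ∀ A ∈ F, (l A : ℕ) < b2 then 1 else 0) *
      θ ^ #(X.filter (fun A => (l A : ℕ) < b0)) = ∏ A, f A (l A) := by
    intro l
    simp only [f]
    rw [prod_mul_distrib]
    congr 1
    · rw [Finset.prod_ite_mem, univ_inter]
      by_cases h : ∀ A ∈ F, (l A : ℕ) < b2
      · rw [if_pos h]; symm; apply prod_eq_one; intro A hA; rw [if_pos (h A hA)]
      · rw [if_neg h]; push Not at h; obtain ⟨A, hA, hA'⟩ := h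
        symm; apply prod_eq_zero hA; rw [if_neg (by omega)]
    · rw [Finset.prod_ite_mem, univ_inter, ← Finset.prod_const, Finset.prod_filter]
      apply prod_congr rfl; intro A _; split_ifs <;> ring
  simp only [h1]
  rw [ex_pi]
  have h3 : ∀ A, ex (f A) = (if A ∈ F then ((b2:ℝ)/B) else 1) * (if A ∈ X then (1 + (θ - 1) * ((b0:ℝ)/B)) else 1) := by
    intro A
    simp only [f]
    by_cases hF : A ∈ F
    · have hX : A ∉ X := fun h => Finset.disjoint_left.mp hd hF h
      simp only [hF, hX, if_true, if_false, mul_one]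
      exact ex_fin_lt h2
    · by_cases hX : A ∈ X
      · simp only [hF, hX, if_true, if_false, one_mul]
        rw [ex_add, ex_mul, ex_fin_lt h0, ex_const]
      · simp only [hF, hX, if_false, mul_one]
        rw [ex_const]
  simp only [h3]
  rw [prod_mul_distrib, Finset.prod_ite_mem, Finset.prod_ite_mem, univ_inter, univ_inter, prod_const, prod_const]

lemma low_tail {α : Type*} [Fintype α] {B b0 b2 : ℕ} (hB : 0 < B) (h0 : b0 ≤ B) (h2 : b2 ≤ B)
    (F X : Finset α) (hd : Disjoint F X) (θ : ℝ) (hθ : 0 < θ) (hθ1 : θ ≤ 1) (s : ℕ) :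
    pr (fun l : α → Fin B => (∀ A ∈ F, (l A : ℕ) < b2) ∧ #(X.filter (fun A => (l A : ℕ) < b0)) ≤ s) ≤
      ((b2:ℝ)/B) ^ #F * ((θ ^ s)⁻¹ * Real.exp (-((1 - θ) * ((b0:ℝ)/B) * #X))) := by
  have hp : (b0:ℝ)/B ≤ 1 := div_le_one_of_le₀ (by exact_mod_cast h0) (by positivity)
  have hp0 : 0 ≤ (b0:ℝ)/B := by positivity
  calc _ ≤ ex (fun l : α → Fin B => (θ ^ s)⁻¹ * ((if ∀ A ∈ F, (l A : ℕ) < b2 then 1 else 0) *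
      θ ^ #(X.filter (fun A => (l A : ℕ) < b0)))) := by
        apply pr_le_ex
        · intro l; split_ifs <;> positivity
        · rintro l ⟨h1, h2⟩
          rw [if_pos h1, one_mul, inv_mul_eq_div, one_le_div (by positivity)]
          exact pow_le_pow_of_le_one hθ.le hθ1 h2
    _ = (θ ^ s)⁻¹ * (((b2:ℝ)/B) ^ #F * (1 + (θ - 1) * ((b0:ℝ)/B)) ^ #X) := by
        rw [ex_mul, mgf hB h0 h2 F X hd]
    _ ≤ (θ ^ s)⁻¹ * (((b2:ℝ)/B) ^ #F * Real.exp (-((1 - θ) * ((b0:ℝ)/B) * #X))) := by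
        gcongr
        have e : Real.exp (-((1 - θ) * ((b0:ℝ)/B) * #X)) = (Real.exp ((θ - 1) * ((b0:ℝ)/B))) ^ #X := by
          rw [← Real.exp_nat_mul]; congr 1; ring
        rw [e]
        apply pow_le_pow_left₀
        · nlinarith
        · linarith [Real.add_one_le_exp ((θ - 1) * ((b0:ℝ)/B))]
    _ = _ := by ring

lemma up_tail {α : Type*} [Fintype α] {B b0 : ℕ} (hB : 0 < B) (h0 : b0 ≤ B)
    (X : Finset α) (θ : ℝ) (hθ : 1 ≤ θ) (s : ℕ) :
    pr (fun l : α → Fin B => s ≤ #(X.filter (fun A => (l A : ℕ) < b0))) ≤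
      (θ ^ s)⁻¹ * Real.exp (θ * ((b0:ℝ)/B) * #X) := by
  have hp0 : 0 ≤ (b0:ℝ)/B := by positivity
  calc _ ≤ ex (fun l : α → Fin B => (θ ^ s)⁻¹ * ((if ∀ A ∈ (∅ : Finset α), (l A : ℕ) < B then 1 else 0) *
      θ ^ #(X.filter (fun A => (l A : ℕ) < b0)))) := by
        apply pr_le_ex
        · intro l; split_ifs <;> positivity
        · rintro l h2
          rw [if_pos (by simp), one_mul, inv_mul_eq_div, one_le_div (by positivity)]
          exact pow_le_pow_right₀ hθ h2
    _ = (θ ^ s)⁻¹ * (1 + (θ - 1) * ((b0:ℝ)/B)) ^ #X := by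
        rw [ex_mul, mgf hB h0 le_rfl ∅ X (by simp)]; simp
    _ ≤ _ := by
        gcongr
        have e : Real.exp (θ * ((b0:ℝ)/B) * #X) = (Real.exp (θ * ((b0:ℝ)/B))) ^ #X := by
          rw [← Real.exp_nat_mul]; congr 1; ring
        rw [e]
        apply pow_le_pow_left₀
        · nlinarith
        · have := Real.add_one_le_exp (θ * ((b0:ℝ)/B))
          nlinarith

lemma none_prob {α : Type*} [Fintype α] {B b0 : ℕ} (hB : 0 < B) (h0 : b0 ≤ B) (X : Finset α) :
    pr (fun l : α → Fin B => ∀ A ∈ X, ¬ ((l A : ℕ) < b0)) = (1 - (b0:ℝ)/B) ^ #X := by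
  have := mgf hB h0 le_rfl ∅ X (by simp) 0
  simp only [card_empty, pow_zero, one_mul, zero_sub] at this
  rw [pr_eq_ex, show 1 - (b0:ℝ)/B = 1 + -1 * ((b0:ℝ)/B) by ring, ← this]
  congr 1; funext l
  by_cases h : ∀ A ∈ X, ¬ ((l A : ℕ) < b0)
  · rw [if_pos h, filter_eq_empty_iff.mpr (fun A hA => h A hA)]; simp
  · rw [if_neg h, zero_pow]
    · simp
    · rw [Ne, card_eq_zero, filter_eq_empty_iff]; exact h

/-- the law of a random subset -/
lemma ex_bexp {α : Type*} [Fintype α] {B b : ℕ} (hB : 0 < B) (hb : b ≤ B) (E : Finset α)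
    (f : Finset α → ℝ) :
    ex (fun l : α → Fin B => f (E.filter (fun A => (l A : ℕ) < b))) = bexp E ((b:ℝ)/B) f := by
  have hW : ∀ W ∈ E.powerset, pr (fun l : α → Fin B => E.filter (fun A => (l A : ℕ) < b) = W) =
      ((b:ℝ)/B) ^ #W * (1 - (b:ℝ)/B) ^ (#E - #W) := by
    intro W hW
    rw [mem_powerset] at hW
    have := mgf hB hb hb W (E \ W) disjoint_sdiff 0
    rw [card_sdiff_of_subset hW] at this
    rw [pr_eq_ex, show 1 - (b:ℝ)/B = 1 + (0-1) * ((b:ℝ)/B) by ring, ← this]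
    congr 1; funext l
    by_cases h : E.filter (fun A => (l A : ℕ) < b) = W
    · rw [if_pos h, if_pos, filter_eq_empty_iff.mpr]
      · simp
      · intro A hA hl; rw [mem_sdiff] at hA
        exact hA.2 (h ▸ mem_filter.mpr ⟨hA.1, hl⟩)
      · intro A hA; rw [← h] at hA; exact (mem_filter.mp hA).2
    · rw [if_neg h]
      by_cases h1 : ∀ A ∈ W, (l A : ℕ) < b
      · rw [zero_pow, mul_zero]
        rw [Ne, card_eq_zero, filter_eq_empty_iff]
        intro h2; apply h
        ext A; rw [mem_filter]
        constructor
        · rintro ⟨hA, hl⟩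
          by_contra hAW
          exact h2 (mem_sdiff.mpr ⟨hA, hAW⟩) hl
        · intro hA; exact ⟨hW hA, h1 A hA⟩
      · rw [if_neg h1, zero_mul]
  have : ∀ l : α → Fin B, f (E.filter (fun A => (l A : ℕ) < b)) =
      ∑ W ∈ E.powerset, f W * (if E.filter (fun A => (l A : ℕ) < b) = W then 1 else 0) := by
    intro l
    rw [sum_eq_single (E.filter (fun A => (l A : ℕ) < b))]
    · simp
    · intro W _ hne; rw [if_neg (Ne.symm hne), mul_zero]
    · intro h; exact absurd (mem_powerset.mpr (filter_subset _ _)) h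
  simp only [this]
  rw [ex_sum]
  unfold bexp
  apply sum_congr rfl
  intro W hW'
  rw [ex_mul, ← pr_eq_ex, hW W hW']; ring
lemma pr_false {Ω : Type*} [Fintype Ω] : pr (fun _ : Ω => False) = 0 := by
  simp only [pr_def]; simp

end partC

attribute [irreducible] pr ex

section partD
open scoped Classical
variable {V : Type*}

/-- vertex set of a set of edges -/
noncomputable def vs (M : Finset (Finset V)) : Finset V := M.biUnion id

lemma mem_vs {M : Finset (Finset V)} {v : V} : v ∈ vs M ↔ ∃ A ∈ M, v ∈ A := by
  simp [vs]

def IsM (M : Finset (Finset V)) : Prop := ∀ A ∈ M, ∀ B ∈ M, A ≠ B → Disjoint A B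

lemma vs_union (M M' : Finset (Finset V)) : vs (M ∪ M') = vs M ∪ vs M' := by
  ext v; simp only [mem_vs, mem_union]; grind

lemma IsM.union {M M' : Finset (Finset V)} (h : IsM M) (h' : IsM M')
    (hd : Disjoint (vs M) (vs M')) : IsM (M ∪ M') := by
  have key : ∀ A ∈ M, ∀ B ∈ M', Disjoint A B := by
    intro A hA B hB
    exact Finset.disjoint_of_subset_left (fun v hv => mem_vs.mpr ⟨A, hA, hv⟩)
      (Finset.disjoint_of_subset_right (fun v hv => mem_vs.mpr ⟨B, hB, hv⟩) hd)
  intro A hA B hB hne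
  rcases mem_union.mp hA with hA | hA <;> rcases mem_union.mp hB with hB | hB
  · exact h A hA B hB hne
  · exact key A hA B hB
  · exact (key B hB A hA).symm
  · exact h' A hA B hB hne

lemma exists_max_matching (P : Finset (Finset V)) (hP : ∀ A ∈ P, A.Nonempty) :
    ∃ M ⊆ P, IsM M ∧ ∀ A ∈ P, ¬ Disjoint A (vs M) := by
  obtain ⟨M, hM, hmax⟩ := Finset.exists_max_image (P.powerset.filter IsM) card
    ⟨∅, by simp [IsM]⟩
  simp only [mem_filter, mem_powerset] at hM hmax
  refine ⟨M, hM.1, hM.2, ?_⟩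
  intro A hA hdis
  have hAM : A ∉ M := by
    intro h
    obtain ⟨v, hv⟩ := hP A hA
    exact Finset.disjoint_left.mp hdis hv (mem_vs.mpr ⟨A, h, hv⟩)
  have := hmax (insert A M) ⟨insert_subset hA hM.1, by
    rw [insert_eq]
    apply IsM.union _ hM.2
    · simpa [vs] using hdis
    · intro B hB C hC hne
      simp only [mem_singleton] at hB hC
      exact absurd (hB.trans hC.symm) hne⟩
  rw [card_insert_of_notMem hAM] at this
  omega

/-- edges of `G` through `v` with all other vertices in `N` -/
noncomputable def lk (G : Finset (Finset V)) (v : V) (N : Finset V) : Finset (Finset V) :=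
  G.filter (fun A => v ∈ A ∧ A.erase v ⊆ N)

lemma mem_lk {G : Finset (Finset V)} {v : V} {N : Finset V} {A : Finset V} :
    A ∈ lk G v N ↔ A ∈ G ∧ v ∈ A ∧ A.erase v ⊆ N := by simp [lk]

/-- expansion -/
def Expd (G : Finset (Finset V)) (k m l : ℕ) : Prop :=
  ∀ L N : Finset V, L.Nonempty → #L ≤ l → Disjoint L N → #N ≤ m * #L →
    ∃ v ∈ L, #(lk G v N) < k

lemma hall_edges {G : Finset (Finset V)} {r k m l : ℕ} (hr : 2 ≤ r)
    (hG : ∀ A ∈ G, #A = r) (hm : k * (r - 2) + 1 ≤ m) (hE : Expd G k m l)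
    (L Z : Finset V) (hL : #L ≤ l) (hLZ : Disjoint L Z) (hd : ∀ v ∈ L, k ≤ #(lk G v Z)) :
    ∃ M ⊆ G, IsM M ∧ L ⊆ vs M ∧ vs M ⊆ L ∪ Z := by
  have : ∀ v, ∃ B : Finset (Finset V), v ∈ L → B ⊆ lk G v Z ∧ #B = k := by
    intro v
    by_cases hv : v ∈ L
    · obtain ⟨B, hB⟩ := exists_subset_card_eq (hd v hv)
      exact ⟨B, fun _ => hB⟩
    · exact ⟨∅, fun h => absurd h hv⟩
  choose B hB using this
  let N : V → Finset V := fun v => (B v).biUnion (fun A => A.erase v)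
  set d := k * (r-2) + 1 with hdd
  have hall : ∀ S : Finset (L × Fin d), #S ≤ #(S.biUnion (fun x => N x.1.1)) := by
    intro S
    by_contra hlt
    push Not at hlt
    let L' : Finset V := S.image (fun x => (x.1.1 : V))
    have hL' : L' ⊆ L := by
      intro v hv; obtain ⟨x, -, rfl⟩ := mem_image.mp hv; exact x.1.2
    have hSne : S.Nonempty := by
      rw [← card_pos]; omega
    have hScard : #S ≤ #L' * d := by
      have : S ⊆ (L'.subtype (· ∈ L)) ×ˢ univ := by
        intro x hx
        simp only [mem_product, mem_univ, and_true, mem_subtype]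
        exact mem_image.mpr ⟨x, hx, rfl⟩
      calc #S ≤ _ := card_le_card this
        _ = #(L'.subtype (· ∈ L)) * d := by simp
        _ ≤ #L' * d := by
          gcongr
          rw [card_subtype]; exact card_filter_le _ _
    obtain ⟨v, hv, hk⟩ := hE L' (S.biUnion (fun x => N x.1.1)) (hSne.image _)
      ((card_le_card hL').trans hL) (by
        apply Finset.disjoint_of_subset_left hL'
        rw [Finset.disjoint_left]
        intro u hu hu'
        obtain ⟨x, hx, hux⟩ := mem_biUnion.mp hu'
        obtain ⟨A, hA, huA⟩ := mem_biUnion.mp hux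
        have := (mem_lk.mp ((hB x.1.1 x.1.2).1 hA)).2.2 huA
        exact Finset.disjoint_left.mp hLZ hu this) (by
        have : #L' * d ≤ m * #L' := by rw [mul_comm]; gcongr
        omega)
    obtain ⟨x, hx, rfl⟩ := mem_image.mp hv
    have hsub : B x.1.1 ⊆ lk G x.1.1 (S.biUnion (fun x => N x.1.1)) := by
      intro A hA
      have h := mem_lk.mp ((hB x.1.1 x.1.2).1 hA)
      refine mem_lk.mpr ⟨h.1, h.2.1, ?_⟩
      intro u hu
      exact mem_biUnion.mpr ⟨x, hx, mem_biUnion.mpr ⟨A, hA, hu⟩⟩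
    have := card_le_card hsub
    rw [(hB x.1.1 x.1.2).2] at this
    omega
  obtain ⟨f, finj, hf⟩ := (Finset.all_card_le_biUnion_card_iff_exists_injective
    (fun x : L × Fin d => N x.1.1)).mp hall
  have hg : ∀ v : L, ∃ A, A ∈ B v.1 ∧ ∀ u ∈ A.erase v.1, ∃ i, f (v, i) = u := by
    intro v
    by_contra hcon
    push Not at hcon
    let O : Finset V := univ.image (fun i => f (v, i))
    have hO : #O = d := by
      rw [card_image_of_injective]
      · simp
      · intro i j h; exact (Prod.mk.inj (finj h)).2
    have hsub : O ⊆ (B v.1).biUnion (fun A => O ∩ A.erase v.1) := by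
      intro u hu
      obtain ⟨i, -, rfl⟩ := mem_image.mp hu
      obtain ⟨A, hA, huA⟩ := mem_biUnion.mp (hf (v, i))
      exact mem_biUnion.mpr ⟨A, hA, mem_inter.mpr ⟨hu, huA⟩⟩
    have h1 : #O ≤ k * (r-2) := by
      calc #O ≤ _ := card_le_card hsub
        _ ≤ ∑ A ∈ B v.1, #(O ∩ A.erase v.1) := card_biUnion_le
        _ ≤ ∑ A ∈ B v.1, (r-2) := by
          apply sum_le_sum
          intro A hA
          obtain ⟨u, hu, hu'⟩ := hcon A hA
          have h := mem_lk.mp ((hB v.1 v.2).1 hA)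
          have : O ∩ A.erase v.1 ⊆ (A.erase v.1).erase u := by
            intro w hw
            rw [mem_inter] at hw
            refine mem_erase.mpr ⟨?_, hw.2⟩
            rintro rfl
            obtain ⟨i, -, hi⟩ := mem_image.mp hw.1
            exact hu' i hi
          calc _ ≤ _ := card_le_card this
            _ = r - 2 := by rw [card_erase_of_mem hu, card_erase_of_mem h.2.1, hG A h.1]; omega
        _ = k * (r-2) := by rw [sum_const, (hB v.1 v.2).2]; simp
    omega
  choose g hgB hgf using hg
  have hlk : ∀ v : L, g v ∈ lk G v.1 Z := fun v => (hB v.1 v.2).1 (hgB v)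
  refine ⟨univ.image g, ?_, ?_, ?_, ?_⟩
  · intro A hA
    obtain ⟨v, -, rfl⟩ := mem_image.mp hA
    exact (mem_lk.mp (hlk v)).1
  · intro A hA A' hA' hne
    obtain ⟨v, -, rfl⟩ := mem_image.mp hA
    obtain ⟨w, -, rfl⟩ := mem_image.mp hA'
    have hvw : v ≠ w := fun h => hne (by rw [h])
    rw [Finset.disjoint_left]
    intro u hu hu'
    by_cases h1 : u = v.1 <;> by_cases h2 : u = w.1
    · exact hvw (Subtype.ext (h1.symm.trans h2))
    · have := (mem_lk.mp (hlk w)).2.2 (mem_erase.mpr ⟨h2, hu'⟩)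
      exact Finset.disjoint_left.mp hLZ (h1 ▸ v.2) this
    · have := (mem_lk.mp (hlk v)).2.2 (mem_erase.mpr ⟨h1, hu⟩)
      exact Finset.disjoint_left.mp hLZ (h2 ▸ w.2) this
    · obtain ⟨i, hi⟩ := hgf v u (mem_erase.mpr ⟨h1, hu⟩)
      obtain ⟨j, hj⟩ := hgf w u (mem_erase.mpr ⟨h2, hu'⟩)
      exact hvw (Prod.mk.inj (finj (hi.trans hj.symm))).1
  · intro v hv
    exact mem_vs.mpr ⟨g ⟨v, hv⟩, mem_image_of_mem _ (mem_univ _), (mem_lk.mp (hlk ⟨v, hv⟩)).2.1⟩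
  · intro u hu
    obtain ⟨A, hA, hu⟩ := mem_vs.mp hu
    obtain ⟨v, -, rfl⟩ := mem_image.mp hA
    by_cases h1 : u = v.1
    · exact mem_union_left _ (h1 ▸ v.2)
    · exact mem_union_right _ ((mem_lk.mp (hlk v)).2.2 (mem_erase.mpr ⟨h1, hu⟩))

/-- a star (edges through `v`) spans few vertices -/
lemma star_card (F : Finset (Finset V)) (r : ℕ) (v : V) (hF : ∀ A ∈ F, #A = r ∧ v ∈ A) :
    #(vs F) ≤ #F * (r-1) + 1 := by
  have : vs F ⊆ insert v (F.biUnion (fun A => A.erase v)) := by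
    intro u hu
    obtain ⟨A, hA, hu⟩ := mem_vs.mp hu
    by_cases h : u = v
    · simp [h]
    · exact mem_insert_of_mem (mem_biUnion.mpr ⟨A, hA, mem_erase.mpr ⟨h, hu⟩⟩)
  calc #(vs F) ≤ _ := card_le_card this
    _ ≤ #(F.biUnion (fun A => A.erase v)) + 1 := card_insert_le _ _
    _ ≤ (∑ A ∈ F, #(A.erase v)) + 1 := by gcongr; exact card_biUnion_le
    _ = (∑ A ∈ F, (r-1)) + 1 := by
      congr 1
      exact sum_congr rfl fun A hA => by rw [card_erase_of_mem (hF A hA).2, (hF A hA).1]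
    _ = _ := by simp

/-- adding an edge meeting the vertex set keeps the excess -/
lemma vs_insert_card (F : Finset (Finset V)) (r : ℕ) (A : Finset V) (hA : #A = r)
    (hn : ¬ Disjoint A (vs F)) : #(vs (insert A F)) ≤ #(vs F) + (r-1) := by
  obtain ⟨u, hu, hu'⟩ := Finset.not_disjoint_iff.mp hn
  have : vs (insert A F) ⊆ vs F ∪ A.erase u := by
    intro w hw
    obtain ⟨C, hC, hwC⟩ := mem_vs.mp hw
    rcases mem_insert.mp hC with rfl | hC
    · by_cases h : w = u
      · subst h; exact mem_union_left _ hu'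
      · exact mem_union_right _ (mem_erase.mpr ⟨h, hwC⟩)
    · exact mem_union_left _ (mem_vs.mpr ⟨C, hC, hwC⟩)
  calc _ ≤ _ := card_le_card this
    _ ≤ _ := card_union_le _ _
    _ = _ := by rw [card_erase_of_mem hu, hA]
end partD

section partD2
open scoped Classical
variable {V : Type*}

lemma codeg_lt {G : Finset (Finset V)} {r k l : ℕ} (hr : 3 ≤ r)
    (hG : ∀ A ∈ G, #A = r) (hE : Expd G k (k*(r-2)+r) l) (hl : 1 ≤ l) (v : V) (W : Finset V)
    (hvW : v ∉ W) (hW : #W ≤ r) :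
    #(G.filter (fun A => v ∈ A ∧ ¬ Disjoint A W)) < k := by
  by_contra hcon
  push Not at hcon
  obtain ⟨B, hB, hBk⟩ := exists_subset_card_eq hcon
  obtain ⟨v', hv', hlt⟩ := hE {v} (B.biUnion (fun A => A.erase v) ∪ W) (by simp) (by simpa using hl)
    (by simp [hvW]) (by
      have h1 : B.biUnion (fun A => A.erase v) ∪ W ⊆ B.biUnion (fun A => (A.erase v) \ W) ∪ W := by
        intro u hu
        by_cases huW : u ∈ W
        · exact mem_union_right _ huW
        · rcases mem_union.mp hu with hu | hu
          · obtain ⟨A, hA, huA⟩ := mem_biUnion.mp hu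
            exact mem_union_left _ (mem_biUnion.mpr ⟨A, hA, mem_sdiff.mpr ⟨huA, huW⟩⟩)
          · exact absurd hu huW
      have h2 : #(B.biUnion (fun A => (A.erase v) \ W)) ≤ k * (r-2) := by
        calc _ ≤ ∑ A ∈ B, #((A.erase v) \ W) := card_biUnion_le
          _ ≤ ∑ A ∈ B, (r-2) := by
            apply sum_le_sum
            intro A hA
            have h := mem_filter.mp (hB hA)
            obtain ⟨u, hu, huW⟩ := Finset.not_disjoint_iff.mp h.2.2
            have huv : u ≠ v := fun h => hvW (h ▸ huW)
            have : (A.erase v) \ W ⊆ (A.erase v).erase u := by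
              intro w hw
              rw [mem_sdiff] at hw
              exact mem_erase.mpr ⟨fun h => hw.2 (h ▸ huW), hw.1⟩
            calc _ ≤ _ := card_le_card this
              _ = r - 2 := by
                rw [card_erase_of_mem (mem_erase.mpr ⟨huv, hu⟩), card_erase_of_mem h.2.1, hG A h.1]; omega
          _ = _ := by rw [sum_const, hBk]; simp
      calc _ ≤ _ := card_le_card h1
        _ ≤ _ := card_union_le _ _
        _ ≤ _ := by simp; omega)
  rw [mem_singleton] at hv'; subst hv'
  have : B ⊆ lk G v' (B.biUnion (fun A => A.erase v') ∪ W) := by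
    intro A hA
    have h := mem_filter.mp (hB hA)
    exact mem_lk.mpr ⟨h.1, h.2.1, fun u hu => mem_union_left _ (mem_biUnion.mpr ⟨A, hA, hu⟩)⟩
  have := card_le_card this
  omega

set_option maxHeartbeats 1000000 in
theorem construct [Fintype V] {G0 G2 : Finset (Finset V)} {r k j0 l xb sb yb : ℕ} (hr : 3 ≤ r)
    (hk : 1 ≤ k) (hG2 : ∀ A ∈ G2, #A = r) (hsub : G0 ⊆ G2) (V0 R1 R2 : Finset V)
    (h01 : Disjoint V0 R1) (h02 : Disjoint V0 R2) (h12 : Disjoint R1 R2)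
    (Sm Bad : Finset V)
    (hSm : ∀ v, v ∉ Sm → k * (j0 + 2) ≤ #(lk G0 v V0)) (hBad : Bad ⊆ V0)
    (hBad' : ∀ v ∈ V0, v ∉ Bad → k * (j0 + 2) ≤ #(lk G0 v R2))
    (e : V → Finset V) (he : ∀ v ∈ Sm, e v ∈ G2 ∧ v ∈ e v)
    (hE : Expd G0 k (k*(r-2)+r) l) (hl : 1 ≤ l)
    (hS : ∀ F ⊆ G2, #F ≤ 4 → #(vs F) ≤ #F * (r-1) + 1 → #(vs F ∩ Sm) ≤ 1)
    (hB2 : ∀ F ⊆ G0, #F = j0 → #(vs F) ≤ #F * (r-1) + 1 → #(vs F ∩ Bad) < j0)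
    (hBadc : #Bad ≤ l) (hSmc : #Sm ≤ sb)
    (hBulk : ∀ X ⊆ V0, xb ≤ #X → ∃ A ∈ G0, A ⊆ X)
    (hLev : ∀ L ⊆ V0, l ≤ #L → ∀ Y ⊆ R1, #Y ≤ yb → ∃ A ∈ G0, #(A ∩ L) = 1 ∧ A \ L ⊆ R1 \ Y)
    (hyb : r * sb + r * xb ≤ yb) :
    ∃ M, IsM M ∧ M ⊆ G0 ∪ Sm.image e ∧ V0 ∪ Sm ⊆ vs M ∧ #R1 ≤ #(univ \ vs M) + yb := by
  have hG0 : ∀ A ∈ G0, #A = r := fun A hA => hG2 A (hsub hA)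
  have hS' : ∀ F ⊆ G2, #F ≤ 4 → #(vs F) ≤ #F * (r-1) + 1 → ∀ s ∈ Sm, ∀ t ∈ Sm,
      s ∈ vs F → t ∈ vs F → s = t := by
    intro F hF h4 hv s hs t ht hsF htF
    exact Finset.card_le_one.mp (hS F hF h4 hv) s (mem_inter.mpr ⟨hsF, hs⟩) t (mem_inter.mpr ⟨htF, ht⟩)
  -- step 1
  have hdis : ∀ s ∈ Sm, ∀ t ∈ Sm, ¬ Disjoint (e s) (e t) → s = t := by
    intro s hs t ht hn
    obtain ⟨u, hu, hu'⟩ := Finset.not_disjoint_iff.mp hn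
    refine hS' {e s, e t} ?_ (card_le_two.trans (by norm_num)) ?_ s hs t ht ?_ ?_
    · intro A hA
      simp only [mem_insert, mem_singleton] at hA
      rcases hA with rfl | rfl
      · exact (he s hs).1
      · exact (he t ht).1
    · apply star_card _ r u
      intro A hA
      simp only [mem_insert, mem_singleton] at hA
      rcases hA with rfl | rfl
      · exact ⟨hG2 _ (he s hs).1, hu⟩
      · exact ⟨hG2 _ (he t ht).1, hu'⟩
    · exact mem_vs.mpr ⟨e s, by simp, (he s hs).2⟩
    · exact mem_vs.mpr ⟨e t, by simp, (he t ht).2⟩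
  set M1 := Sm.image e with hM1
  have hM1m : IsM M1 := by
    intro A hA B hB hne
    obtain ⟨s, hs, rfl⟩ := mem_image.mp hA
    obtain ⟨t, ht, rfl⟩ := mem_image.mp hB
    by_contra hn
    exact hne (by rw [hdis s hs t ht hn])
  set X1 := vs M1 with hX1
  have hX1m : ∀ u, u ∈ X1 ↔ ∃ s ∈ Sm, u ∈ e s := by
    intro u; simp [hX1, mem_vs, hM1]
  have hSmX : Sm ⊆ X1 := fun v hv => (hX1m v).mpr ⟨v, hv, (he v hv).2⟩
  have hX1c : #X1 ≤ r * sb := by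
    calc #X1 ≤ ∑ A ∈ M1, #A := card_biUnion_le
      _ = ∑ A ∈ M1, r := by
        apply sum_congr rfl
        intro A hA
        obtain ⟨s, hs, rfl⟩ := mem_image.mp hA
        exact hG2 _ (he s hs).1
      _ = #M1 * r := by simp
      _ ≤ sb * r := by gcongr; exact card_image_le.trans hSmc
      _ = _ := mul_comm _ _
  have hhit : ∀ v, v ∉ X1 → #(G0.filter (fun A => v ∈ A ∧ ¬ Disjoint A X1)) < k := by
    intro v hv
    by_cases hne : (G0.filter (fun A => v ∈ A ∧ ¬ Disjoint A X1)).Nonempty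
    swap
    · rw [not_nonempty_iff_eq_empty.mp hne]; simp; omega
    obtain ⟨A0, hA0⟩ := hne
    rw [mem_filter] at hA0
    obtain ⟨u, huA, hu⟩ := Finset.not_disjoint_iff.mp hA0.2.2
    obtain ⟨s, hs, hus⟩ := (hX1m u).mp hu
    have hves : v ∉ e s := fun h => hv ((hX1m v).mpr ⟨s, hs, h⟩)
    refine lt_of_le_of_lt (card_le_card ?_) (codeg_lt hr hG0 hE hl v (e s) hves (le_of_eq (hG2 _ (he s hs).1)))
    intro A hA
    rw [mem_filter] at hA ⊢
    refine ⟨hA.1, hA.2.1, ?_⟩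
    obtain ⟨w, hwA, hw⟩ := Finset.not_disjoint_iff.mp hA.2.2
    obtain ⟨t, ht, hwt⟩ := (hX1m w).mp hw
    have hvet : v ∉ e t := fun h => hv ((hX1m v).mpr ⟨t, ht, h⟩)
    suffices s = t by subst this; exact Finset.not_disjoint_iff.mpr ⟨w, hwA, hwt⟩
    by_contra hst
    have hest : e s ≠ e t := by
      intro h
      refine hst (hdis s hs t ht ?_)
      rw [← h]
      exact Finset.not_disjoint_iff.mpr ⟨s, (he s hs).2, (he s hs).2⟩
    have n1 : e t ∉ ({A0, A} : Finset (Finset V)) := by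
      simp only [mem_insert, mem_singleton, not_or]
      exact ⟨fun h => hvet (h ▸ hA0.2.1), fun h => hvet (h ▸ hA.2.1)⟩
    have n2 : e s ∉ insert (e t) ({A0, A} : Finset (Finset V)) := by
      simp only [mem_insert, mem_singleton, not_or]
      exact ⟨hest, fun h => hves (h ▸ hA0.2.1), fun h => hves (h ▸ hA.2.1)⟩
    have c2 : #({A0, A} : Finset (Finset V)) ≤ 2 := card_le_two
    have c0 : #(vs {A0, A}) ≤ #({A0, A} : Finset (Finset V)) * (r-1) + 1 := by
      apply star_card _ r v
      intro C hC
      simp only [mem_insert, mem_singleton] at hC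
      rcases hC with rfl | rfl
      · exact ⟨hG0 _ hA0.1, hA0.2.1⟩
      · exact ⟨hG0 _ hA.1, hA.2.1⟩
    have c3 := vs_insert_card {A0, A} r (e t) (hG2 _ (he t ht).1)
      (Finset.not_disjoint_iff.mpr ⟨w, hwt, mem_vs.mpr ⟨A, by simp, hwA⟩⟩)
    have c4 := vs_insert_card (insert (e t) {A0, A}) r (e s) (hG2 _ (he s hs).1)
      (Finset.not_disjoint_iff.mpr ⟨u, hus, mem_vs.mpr ⟨A0, by simp, huA⟩⟩)
    have d1 : #(insert (e t) ({A0, A} : Finset (Finset V))) = #({A0, A} : Finset (Finset V)) + 1 :=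
      card_insert_of_notMem n1
    have d2 : #(insert (e s) (insert (e t) ({A0, A} : Finset (Finset V)))) = #({A0, A} : Finset (Finset V)) + 2 := by
      rw [card_insert_of_notMem n2, d1]
    refine hst (hS' (insert (e s) (insert (e t) {A0, A})) ?_ (by omega) ?_ s hs t ht ?_ ?_)
    · intro C hC
      simp only [mem_insert, mem_singleton] at hC
      rcases hC with rfl | rfl | rfl | rfl
      · exact (he s hs).1
      · exact (he t ht).1
      · exact hsub hA0.1
      · exact hsub hA.1
    · rw [d2, add_mul]; omega
    · exact mem_vs.mpr ⟨e s, by simp, (he s hs).2⟩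
    · exact mem_vs.mpr ⟨e t, by simp, (he t ht).2⟩
  -- step 2
  have hbad : ∀ v ∈ Bad, #((lk G0 v V0).filter (fun A => ¬ Disjoint (A.erase v) Bad)) ≤ j0 * k := by
    intro v hv
    by_contra hcon
    push Not at hcon
    set Q := (lk G0 v V0).filter (fun A => ¬ Disjoint (A.erase v) Bad) with hQ
    have : ∀ A, ∃ u, A ∈ Q → u ∈ A.erase v ∧ u ∈ Bad := by
      intro A
      by_cases hA : A ∈ Q
      · obtain ⟨u, h⟩ := Finset.not_disjoint_iff.mp (mem_filter.mp hA).2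
        exact ⟨u, fun _ => h⟩
      · exact ⟨v, fun h => absurd h hA⟩
    choose u hu using this
    have him : j0 ≤ #(Q.image u) := by
      by_contra hlt
      push Not at hlt
      have h1 : #Q ≤ k * #(Q.image u) := by
        apply Finset.card_le_mul_card_image
        intro w hw
        obtain ⟨A, hA, rfl⟩ := mem_image.mp hw
        have hne : v ∉ ({u A} : Finset V) := by
          simp only [mem_singleton]; exact fun h => (mem_erase.mp (hu A hA).1).1 h.symm
        refine le_of_lt (lt_of_le_of_lt (card_le_card ?_) (codeg_lt hr hG0 hE hl v {u A} hne (by simp; omega)))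
        intro C hC
        rw [mem_filter] at hC ⊢
        have hC' := mem_lk.mp (mem_filter.mp hC.1).1
        refine ⟨hC'.1, hC'.2.1, Finset.not_disjoint_iff.mpr ⟨u A, ?_, by simp⟩⟩
        rw [← hC.2]; exact mem_of_mem_erase (hu C hC.1).1
      have h2 : k * #(Q.image u) ≤ j0 * k := by rw [mul_comm]; gcongr
      omega
    obtain ⟨I, hI, hIc⟩ := exists_subset_card_eq him
    have : ∀ w, ∃ A, w ∈ I → A ∈ Q ∧ u A = w := by
      intro w
      by_cases hw : w ∈ I
      · obtain ⟨A, hA, hAw⟩ := mem_image.mp (hI hw)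
        exact ⟨A, fun _ => ⟨hA, hAw⟩⟩
      · exact ⟨∅, fun h => absurd h hw⟩
    choose a ha using this
    have hFc : #(I.image a) = j0 := by
      rw [card_image_of_injOn, hIc]
      intro w hw w' hw' h
      rw [← (ha w hw).2, ← (ha w' hw').2, h]
    have hFlk : ∀ C ∈ I.image a, C ∈ lk G0 v V0 := by
      intro C hC
      obtain ⟨w, hw, rfl⟩ := mem_image.mp hC
      exact (mem_filter.mp (ha w hw).1).1
    have := hB2 (I.image a) (fun C hC => (mem_lk.mp (hFlk C hC)).1) hFc
      (star_card _ r v (fun C hC => ⟨hG0 _ (mem_lk.mp (hFlk C hC)).1, (mem_lk.mp (hFlk C hC)).2.1⟩))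
    have hI2 : I ⊆ vs (I.image a) ∩ Bad := by
      intro w hw
      have h := ha w hw
      have h' := hu _ h.1
      rw [h.2] at h'
      exact mem_inter.mpr ⟨mem_vs.mpr ⟨a w, mem_image_of_mem _ hw, mem_of_mem_erase h'.1⟩, h'.2⟩
    have := card_le_card hI2
    omega
  obtain ⟨M2, hM2G, hM2m, hM2c, hM2s⟩ := hall_edges (by omega) hG0 (m := k*(r-2)+r) (by omega) hE (Bad \ X1)
    ((V0 \ X1) \ Bad) ((card_le_card sdiff_subset).trans hBadc) (by
      rw [Finset.disjoint_left]; intro v hv hv'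
      exact (mem_sdiff.mp hv').2 (mem_sdiff.mp hv).1) (by
      intro v hv
      rw [mem_sdiff] at hv
      have h1 := hSm v (fun h => hv.2 (hSmX h))
      have h2 := hhit v hv.2
      have h3 := hbad v hv.1
      have hs : lk G0 v V0 ⊆ (lk G0 v ((V0 \ X1) \ Bad) ∪ G0.filter (fun A => v ∈ A ∧ ¬ Disjoint A X1)) ∪
          (lk G0 v V0).filter (fun A => ¬ Disjoint (A.erase v) Bad) := by
        intro A hA
        have hA' := mem_lk.mp hA
        by_cases c1 : Disjoint A X1
        · by_cases c2 : Disjoint (A.erase v) Bad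
          · refine mem_union_left _ (mem_union_left _ (mem_lk.mpr ⟨hA'.1, hA'.2.1, ?_⟩))
            intro w hw
            refine mem_sdiff.mpr ⟨mem_sdiff.mpr ⟨hA'.2.2 hw, ?_⟩, Finset.disjoint_left.mp c2 hw⟩
            exact Finset.disjoint_left.mp c1 (mem_of_mem_erase hw)
          · exact mem_union_right _ (mem_filter.mpr ⟨hA, c2⟩)
        · exact mem_union_left _ (mem_union_right _ (mem_filter.mpr ⟨hA'.1, hA'.2.1, c1⟩))
      have := (card_le_card hs).trans (card_union_le _ _)
      have h5 := card_union_le (lk G0 v ((V0 \ X1) \ Bad)) (G0.filter (fun A => v ∈ A ∧ ¬ Disjoint A X1))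
      have : k * (j0+2) = j0 * k + 2 * k := by ring
      omega)
  have hX2V : vs M2 ⊆ V0 \ X1 := by
    intro v hv
    rcases mem_union.mp (hM2s hv) with h | h
    · rw [mem_sdiff] at h ⊢; exact ⟨hBad h.1, h.2⟩
    · exact (mem_sdiff.mp h).1
  -- step 3
  obtain ⟨M3, hM3P, hM3m, hM3x⟩ := exists_max_matching (G0.filter (fun A => A ⊆ (V0 \ X1) \ vs M2)) (by
    intro A hA
    rw [← card_pos, hG0 A (mem_filter.mp hA).1]; omega)
  have hX3V : vs M3 ⊆ (V0 \ X1) \ vs M2 := by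
    intro v hv
    obtain ⟨A, hA, hv⟩ := mem_vs.mp hv
    exact (mem_filter.mp (hM3P hA)).2 hv
  set L0 := ((V0 \ X1) \ vs M2) \ vs M3 with hL0
  have hL0V : L0 ⊆ V0 := fun v hv => by simp only [hL0, mem_sdiff] at hv; tauto
  have hL0c : #L0 < xb := by
    by_contra hcon
    push Not at hcon
    obtain ⟨A, hA, hAL⟩ := hBulk L0 hL0V hcon
    refine hM3x A (mem_filter.mpr ⟨hA, hAL.trans sdiff_subset⟩) ?_
    rw [Finset.disjoint_left]
    intro v hv; exact (mem_sdiff.mp (hAL hv)).2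
  -- step 4
  obtain ⟨M4, hM4P, hM4m, hM4x⟩ := exists_max_matching (G0.filter (fun A => #(A ∩ L0) = 1 ∧ A \ L0 ⊆ R1 \ X1)) (by
    intro A hA
    rw [← card_pos, hG0 A (mem_filter.mp hA).1]; omega)
  have hX4V : vs M4 ⊆ L0 ∪ (R1 \ X1) := by
    intro v hv
    obtain ⟨A, hA, hv⟩ := mem_vs.mp hv
    by_cases h : v ∈ L0
    · exact mem_union_left _ h
    · exact mem_union_right _ ((mem_filter.mp (hM4P hA)).2.2 (mem_sdiff.mpr ⟨hv, h⟩))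
  have hM4c : #M4 ≤ #L0 := by
    have h := Finset.card_le_card_of_injOn (s := M4) (t := L0.powersetCard 1) (fun A => A ∩ L0) (by
      intro A hA
      have := (mem_filter.mp (hM4P hA)).2.1
      exact mem_powersetCard.mpr ⟨inter_subset_right, this⟩) (by
      intro A hA B hB hAB
      by_contra hne
      have hd := hM4m A hA B hB hne
      obtain ⟨u, hu⟩ := card_eq_one.mp (mem_filter.mp (hM4P hA)).2.1
      have h1 : u ∈ A ∩ L0 := by rw [hu]; simp
      have h2 : u ∈ B ∩ L0 := by
        have : A ∩ L0 = B ∩ L0 := hAB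
        rw [← this]; exact h1
      exact Finset.disjoint_left.mp hd (mem_inter.mp h1).1 (mem_inter.mp h2).1)
    simpa using h
  have hX4c : #(vs M4) ≤ r * xb := by
    calc #(vs M4) ≤ ∑ A ∈ M4, #A := card_biUnion_le
      _ = ∑ A ∈ M4, r := sum_congr rfl fun A hA => hG0 A (mem_filter.mp (hM4P hA)).1
      _ = #M4 * r := by simp
      _ ≤ xb * r := by gcongr; omega
      _ = _ := mul_comm _ _
  set L1 := L0 \ vs M4 with hL1
  have hYc : #(R1 ∩ (X1 ∪ vs M4)) ≤ yb := by
    have h1 := card_le_card (inter_subset_right : R1 ∩ (X1 ∪ vs M4) ⊆ _)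
    have h2 := card_union_le X1 (vs M4)
    omega
  have hL1c : #L1 ≤ l := by
    by_contra hcon
    push Not at hcon
    obtain ⟨A, hA, hA1, hAY⟩ := hLev L1 (sdiff_subset.trans hL0V) hcon.le _ inter_subset_left hYc
    have hAd : Disjoint A (vs M4) := by
      rw [Finset.disjoint_left]
      intro v hv hv4
      by_cases h : v ∈ L1
      · exact (mem_sdiff.mp h).2 hv4
      · have := mem_sdiff.mp (hAY (mem_sdiff.mpr ⟨hv, h⟩))
        exact this.2 (mem_inter.mpr ⟨this.1, mem_union_right _ hv4⟩)
    have hAL : A ∩ L0 = A ∩ L1 := by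
      ext v
      simp only [mem_inter, hL1, mem_sdiff]
      have : v ∈ A → v ∉ vs M4 := fun h => Finset.disjoint_left.mp hAd h
      tauto
    refine hM4x A (mem_filter.mpr ⟨hA, by rw [hAL]; exact hA1, ?_⟩) hAd
    intro v hv
    rw [mem_sdiff] at hv
    have := mem_sdiff.mp (hAY (mem_sdiff.mpr ⟨hv.1, fun h => hv.2 (mem_sdiff.mp h).1⟩))
    exact mem_sdiff.mpr ⟨this.1, fun h => this.2 (mem_inter.mpr ⟨this.1, mem_union_left _ h⟩)⟩
  -- step 5
  have hL1p : ∀ v ∈ L1, v ∈ V0 ∧ v ∉ X1 ∧ v ∉ vs M2 ∧ v ∉ vs M3 ∧ v ∉ vs M4 := by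
    intro v hv
    simp only [hL1, hL0, mem_sdiff] at hv
    tauto
  obtain ⟨M5, hM5G, hM5m, hM5c, hM5s⟩ := hall_edges (by omega) hG0 (m := k*(r-2)+r) (by omega) hE L1
    (R2 \ X1) hL1c (by
      rw [Finset.disjoint_left]; intro v hv hv'
      exact Finset.disjoint_left.mp h02 (hL1p v hv).1 (mem_sdiff.mp hv').1) (by
      intro v hv
      have hp := hL1p v hv
      have h1 := hBad' v hp.1 (fun h => hp.2.2.1 (hM2c (mem_sdiff.mpr ⟨h, hp.2.1⟩)))
      have h2 := hhit v hp.2.1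
      have hs : lk G0 v R2 ⊆ lk G0 v (R2 \ X1) ∪ G0.filter (fun A => v ∈ A ∧ ¬ Disjoint A X1) := by
        intro A hA
        have hA' := mem_lk.mp hA
        by_cases c1 : Disjoint A X1
        · refine mem_union_left _ (mem_lk.mpr ⟨hA'.1, hA'.2.1, ?_⟩)
          intro w hw
          exact mem_sdiff.mpr ⟨hA'.2.2 hw, Finset.disjoint_left.mp c1 (mem_of_mem_erase hw)⟩
        · exact mem_union_right _ (mem_filter.mpr ⟨hA'.1, hA'.2.1, c1⟩)
      have := (card_le_card hs).trans (card_union_le _ _)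
      have : k * (j0+2) = j0 * k + 2 * k := by ring
      omega)
  have hX5 : ∀ v ∈ vs M5, v ∈ L1 ∨ (v ∈ R2 ∧ v ∉ X1) := by
    intro v hv
    rcases mem_union.mp (hM5s hv) with h | h
    · exact Or.inl h
    · exact Or.inr (mem_sdiff.mp h)
  have hX4' : ∀ v ∈ vs M4, (v ∈ L0) ∨ (v ∈ R1 ∧ v ∉ X1) := by
    intro v hv
    rcases mem_union.mp (hX4V hv) with h | h
    · exact Or.inl h
    · exact Or.inr (mem_sdiff.mp h)
  have hL0p : ∀ v, v ∈ L0 ↔ v ∈ V0 ∧ v ∉ X1 ∧ v ∉ vs M2 ∧ v ∉ vs M3 := by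
    intro v; simp only [hL0, mem_sdiff]; tauto
  have hX3p : ∀ v ∈ vs M3, v ∈ V0 ∧ v ∉ X1 ∧ v ∉ vs M2 := by
    intro v hv; have := hX3V hv; simp only [mem_sdiff] at this; tauto
  have hX2p : ∀ v ∈ vs M2, v ∈ V0 ∧ v ∉ X1 := by
    intro v hv; have := hX2V hv; simp only [mem_sdiff] at this; tauto
  have n01 : ∀ v, v ∈ V0 → v ∈ R1 → False := fun v h h' => Finset.disjoint_left.mp h01 h h'
  have n02 : ∀ v, v ∈ V0 → v ∈ R2 → False := fun v h h' => Finset.disjoint_left.mp h02 h h'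
  have n12 : ∀ v, v ∈ R1 → v ∈ R2 → False := fun v h h' => Finset.disjoint_left.mp h12 h h'
  refine ⟨(((M1 ∪ M2) ∪ M3) ∪ M4) ∪ M5, ?_, ?_, ?_, ?_⟩
  · refine IsM.union (IsM.union (IsM.union (IsM.union hM1m hM2m ?_) hM3m ?_) hM4m ?_) hM5m ?_ <;>
      rw [Finset.disjoint_left] <;> intro v hv hv' <;>
      (try simp only [vs_union, mem_union] at hv) <;> (try rw [← hX1] at hv)
    · exact (hX2p v hv').2 hv
    · have := hX3p v hv'; tauto
    · have a1 := hX4' v hv'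
      have a2 := hL0p v
      have a3 := hX3p v
      have a4 := hX2p v
      have a5 := n01 v
      tauto
    · rcases hX5 v hv' with h1 | h1
      · obtain ⟨-, b1, b2, b3, b4⟩ := hL1p v h1
        rcases hv with ((hv | hv) | hv) | hv
        · exact b1 hv
        · exact b2 hv
        · exact b3 hv
        · exact b4 hv
      · rcases hv with ((hv | hv) | hv) | hv
        · exact h1.2 hv
        · exact n02 v (hX2p v hv).1 h1.1
        · exact n02 v (hX3p v hv).1 h1.1
        · rcases hX4' v hv with h | h
          · exact n02 v ((hL0p v).mp h).1 h1.1
          · exact n12 v h.1 h1.1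
  · intro A hA
    simp only [mem_union] at hA ⊢
    rcases hA with (((hA | hA) | hA) | hA) | hA
    · exact Or.inr hA
    · exact Or.inl (hM2G hA)
    · exact Or.inl (mem_filter.mp (hM3P hA)).1
    · exact Or.inl (mem_filter.mp (hM4P hA)).1
    · exact Or.inl (hM5G hA)
  · intro v hv
    simp only [vs_union, mem_union] at hv ⊢
    rw [← hX1]
    rcases hv with hv | hv
    · by_contra hcon
      push Not at hcon
      obtain ⟨⟨⟨⟨c1, c2⟩, c3⟩, c4⟩, c5⟩ := hcon
      exact c5 (hM5c (mem_sdiff.mpr ⟨(hL0p v).mpr ⟨hv, c1, c2, c3⟩, c4⟩))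
    · exact Or.inl (Or.inl (Or.inl (Or.inl (hSmX hv))))
  · have hs : R1 ⊆ (univ \ vs ((((M1 ∪ M2) ∪ M3) ∪ M4) ∪ M5)) ∪ R1 ∩ (X1 ∪ vs M4) := by
      intro v hv
      simp only [vs_union, mem_union, mem_sdiff, mem_univ, true_and, mem_inter]
      rw [← hX1]
      by_contra hcon
      rw [not_or, not_not] at hcon
      obtain ⟨h1, h2⟩ := hcon
      have h3 : ¬ (v ∈ X1 ∨ v ∈ vs M4) := fun h => h2 ⟨hv, h⟩
      rcases h1 with (((h | h) | h) | h) | h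
      · exact h3 (Or.inl h)
      · exact n01 v (hX2p v h).1 hv
      · exact n01 v (hX3p v h).1 hv
      · exact h3 (Or.inr h)
      · rcases hX5 v h with h | h
        · exact n01 v (hL1p v h).1 hv
        · exact n12 v hv h.1
    have h1 := (card_le_card hs).trans (card_union_le _ _)
    omega
end partD2

section partE
open scoped Classical

variable {V : Type*}

noncomputable def vstar (s : ℕ) (v : V) (N : Finset V) : Finset (Finset V) :=
  (N.powersetCard s).image (insert v)

lemma mem_vstar {s : ℕ} {v : V} {N A : Finset V} (hv : v ∉ N) (hA : A ∈ vstar s v N) :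
    #A = s + 1 ∧ v ∈ A ∧ A.erase v ⊆ N ∧ #(A.erase v) = s := by
  obtain ⟨S, hS, rfl⟩ := mem_image.mp hA
  rw [mem_powersetCard] at hS
  have hvS : v ∉ S := fun h => hv (hS.1 h)
  rw [card_insert_of_notMem hvS, erase_insert hvS]
  exact ⟨by omega, mem_insert_self _ _, hS.1, hS.2⟩

lemma vstar_mem {s : ℕ} {v : V} {N A : Finset V} (h1 : #A = s + 1) (h2 : v ∈ A) (h3 : A.erase v ⊆ N) :
    A ∈ vstar s v N :=
  mem_image.mpr ⟨A.erase v, mem_powersetCard.mpr ⟨h3, by rw [card_erase_of_mem h2]; omega⟩, insert_erase h2⟩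

lemma card_star' {s : ℕ} {v : V} {N : Finset V} (hv : v ∉ N) : #(vstar s v N) = (#N).choose s := by
  unfold vstar
  rw [card_image_of_injOn, card_powersetCard]
  intro S hS S' hS' h
  rw [mem_coe, mem_powersetCard] at hS hS'
  have a1 : v ∉ S := fun h => hv (hS.1 h)
  have a2 : v ∉ S' := fun h => hv (hS'.1 h)
  rw [← erase_insert a1, ← erase_insert a2]
  have : insert v S = insert v S' := h
  rw [this]

lemma card_stars {s : ℕ} (T N : Finset V) (hd : Disjoint T N) :
    #(T.biUnion (fun v => vstar s v N)) = #T * (#N).choose s := by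
  rw [card_biUnion]
  · rw [sum_congr rfl (fun v hv => card_star' (Finset.disjoint_left.mp hd hv))]; simp
  · intro v hv w hw hne
    rw [Function.onFun, Finset.disjoint_left]
    intro A hA hA'
    have h1 := mem_vstar (Finset.disjoint_left.mp hd hv) hA
    have h2 := mem_vstar (Finset.disjoint_left.mp hd hw) hA'
    exact Finset.disjoint_left.mp hd hw (h1.2.2.1 (mem_erase.mpr ⟨hne.symm, h2.2.1⟩))

variable [Fintype V]

noncomputable def Gl (r b : ℕ) {B : ℕ} (l : Finset V → Fin B) : Finset (Finset V) :=
  univ.filter (fun A => #A = r ∧ (l A : ℕ) < b)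

lemma mem_Gl {r b B : ℕ} {l : Finset V → Fin B} {A : Finset V} :
    A ∈ Gl r b l ↔ #A = r ∧ (l A : ℕ) < b := by simp [Gl]

lemma count_small (x : ℝ) (hx : 0 < x) (hx1 : x ≤ 1) (y : ℕ) :
    (#(univ.filter (fun N : Finset V => #N ≤ y)) : ℝ) ≤ (x ^ y)⁻¹ * Real.exp (x * Fintype.card V) := by
  have h1 : ∑ N : Finset V, x ^ #N = (1 + x) ^ Fintype.card V := by
    have := Fintype.sum_pow_mul_eq_add_pow V x 1
    simpa [add_comm] using this
  have h2 : (#(univ.filter (fun N : Finset V => #N ≤ y)) : ℝ) * x ^ y ≤ ∑ N : Finset V, x ^ #N := by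
    calc _ = ∑ N ∈ univ.filter (fun N : Finset V => #N ≤ y), x ^ y := by simp
      _ ≤ ∑ N ∈ univ.filter (fun N : Finset V => #N ≤ y), x ^ #N := by
        apply sum_le_sum; intro N hN
        exact pow_le_pow_of_le_one hx.le hx1 (mem_filter.mp hN).2
      _ ≤ _ := sum_le_sum_of_subset_of_nonneg (subset_univ _) (fun _ _ _ => by positivity)
  have h3 : (1 + x) ^ Fintype.card V ≤ Real.exp (x * Fintype.card V) := by
    rw [mul_comm, Real.exp_nat_mul]
    gcongr; linarith [Real.add_one_le_exp x]
  rw [inv_mul_eq_div, le_div_iff₀ (by positivity)]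
  linarith

lemma none_le {α : Type*} [Fintype α] {B b0 : ℕ} (hB : 0 < B) (h0 : b0 ≤ B) (X : Finset α)
    (m : ℕ) (hm : m ≤ #X) :
    pr (fun l : α → Fin B => ∀ A ∈ X, ¬ ((l A : ℕ) < b0)) ≤ Real.exp (-((b0:ℝ)/B * m)) := by
  rw [none_prob hB h0]
  have hp : (b0:ℝ)/B ≤ 1 := div_le_one_of_le₀ (by exact_mod_cast h0) (by positivity)
  have hp0 : 0 ≤ (b0:ℝ)/B := by positivity
  calc _ ≤ (1 - (b0:ℝ)/B) ^ m := pow_le_pow_of_le_one (by linarith) (by linarith) hm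
    _ ≤ (Real.exp (-((b0:ℝ)/B))) ^ m := by
      gcongr
      linarith [Real.add_one_le_exp (-((b0:ℝ)/B))]
    _ = _ := by rw [← Real.exp_nat_mul]; congr 1; ring

lemma low_set {B b0 b2 : ℕ} (hB : 0 < B) (h0 : b0 ≤ B) (h2 : b2 ≤ B) (s K : ℕ) (hs : 1 ≤ s)
    (Z T N' N0 : Finset V) (F : Finset (Finset V)) (hT : T ⊆ Z) (hN : N' ⊆ N0) (hZ : Disjoint Z N')
    (hF : ∀ A ∈ F, A ⊆ Z) (θ : ℝ) (hθ : 0 < θ) (hθ1 : θ ≤ 1) :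
    pr (fun l : Finset V → Fin B => F ⊆ Gl (s+1) b2 l ∧ ∀ v ∈ T, #(lk (Gl (s+1) b0 l) v N0) < K) ≤
      ((b2:ℝ)/B) ^ #F * ((θ ^ (#T * K))⁻¹ *
        Real.exp (-((1 - θ) * ((b0:ℝ)/B) * ((#T : ℝ) * ((#N').choose s : ℝ))))) := by
  have hTN : Disjoint T N' := Finset.disjoint_of_subset_left hT hZ
  have hc := card_stars (s := s) T N' hTN
  have := low_tail (α := Finset V) hB h0 h2 F (T.biUnion (fun v => vstar s v N')) (by
    rw [Finset.disjoint_left]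
    intro A hA hA'
    obtain ⟨v, hv, hA'⟩ := mem_biUnion.mp hA'
    have h := mem_vstar (Finset.disjoint_left.mp hTN hv) hA'
    obtain ⟨u, hu⟩ : (A.erase v).Nonempty := by rw [← card_pos]; omega
    exact Finset.disjoint_left.mp hZ (hF A hA (mem_of_mem_erase hu)) (h.2.2.1 hu)) θ hθ hθ1 (#T * K)
  rw [hc] at this
  push_cast at this
  refine le_trans (pr_mono ?_) this
  rintro l ⟨h1, h3⟩
  refine ⟨fun A hA => (mem_Gl.mp (h1 hA)).2, ?_⟩
  have hsub : (T.biUnion (fun v => vstar s v N')).filter (fun A => (l A : ℕ) < b0) ⊆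
      T.biUnion (fun v => lk (Gl (s+1) b0 l) v N0) := by
    intro A hA
    rw [mem_filter] at hA
    obtain ⟨v, hv, hAv⟩ := mem_biUnion.mp hA.1
    have h := mem_vstar (Finset.disjoint_left.mp hTN hv) hAv
    exact mem_biUnion.mpr ⟨v, hv, mem_lk.mpr ⟨mem_Gl.mpr ⟨h.1, hA.2⟩, h.2.1, h.2.2.1.trans hN⟩⟩
  calc _ ≤ _ := card_le_card hsub
    _ ≤ ∑ v ∈ T, #(lk (Gl (s+1) b0 l) v N0) := card_biUnion_le
    _ ≤ ∑ v ∈ T, K := sum_le_sum fun v hv => (h3 v hv).le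
    _ = _ := by simp

lemma low_single {B b0 : ℕ} (hB : 0 < B) (h0 : b0 ≤ B) (s K a : ℕ) (hs : 1 ≤ s)
    (v : V) (N0 : Finset V) (ha : a + 1 ≤ #N0) (θ : ℝ) (hθ : 0 < θ) (hθ1 : θ ≤ 1) :
    pr (fun l : Finset V → Fin B => #(lk (Gl (s+1) b0 l) v N0) < K) ≤
      (θ ^ K)⁻¹ * Real.exp (-((1 - θ) * ((b0:ℝ)/B) * (a.choose s : ℝ))) := by
  obtain ⟨N', hN', hN'c⟩ := exists_subset_card_eq (s := N0.erase v) (n := a) (by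
    have := pred_card_le_card_erase (s := N0) (a := v); omega)
  have := low_set hB h0 le_rfl s K hs {v} {v} N' N0 ∅ subset_rfl (hN'.trans (erase_subset _ _))
    (by rw [disjoint_singleton_left]; intro h; simpa using hN' h) (by simp) θ hθ hθ1
  simp only [card_empty, pow_zero, one_mul, card_singleton, Nat.cast_one, hN'c] at this
  refine le_trans (pr_mono ?_) this
  intro l h
  simpa using h

lemma cluster_bound {B b0 b2 : ℕ} (hB : 0 < B) (h0 : b0 ≤ B) (h2 : b2 ≤ B) (s K f t z a : ℕ) (hs : 1 ≤ s)
    (N0 : Finset V) (ha : a + z ≤ #N0) (θ : ℝ) (hθ : 0 < θ) (hθ1 : θ ≤ 1) :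
    pr (fun l : Finset V → Fin B => ∃ F ⊆ Gl (s+1) b2 l, #F = f ∧ #(vs F) ≤ z ∧
        t ≤ #(vs F ∩ univ.filter (fun v => #(lk (Gl (s+1) b0 l) v N0) < K))) ≤
      (Fintype.card V : ℝ) ^ z * 2 ^ (2 ^ z) * 2 ^ z * (((b2:ℝ)/B) ^ f * ((θ ^ (t * K))⁻¹ *
        Real.exp (-((1 - θ) * ((b0:ℝ)/B) * ((t : ℝ) * (a.choose s : ℝ)))))) := by
  set c := (((b2:ℝ)/B) ^ f * ((θ ^ (t * K))⁻¹ *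
        Real.exp (-((1 - θ) * ((b0:ℝ)/B) * ((t : ℝ) * (a.choose s : ℝ)))))) with hc
  have hc0 : 0 ≤ c := by positivity
  have hcard : #N0 ≤ Fintype.card V := card_le_univ _
  calc _ ≤ pr (fun l : Finset V → Fin B => ∃ Z ∈ powersetCard z (univ : Finset V),
        ∃ F ∈ (Z.powerset.powerset).filter (fun F => #F = f), ∃ T ∈ powersetCard t Z,
        F ⊆ Gl (s+1) b2 l ∧ ∀ v ∈ T, #(lk (Gl (s+1) b0 l) v N0) < K) := by
        apply pr_mono
        rintro l ⟨F, hF, hFf, hFz, hFt⟩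
        obtain ⟨Z, hZ1, hZ2⟩ := exists_superset_card_eq (s := vs F) (n := z) hFz (by omega)
        obtain ⟨T, hT, hTc⟩ := exists_subset_card_eq hFt
        refine ⟨Z, mem_powersetCard.mpr ⟨subset_univ _, hZ2⟩, F, ?_, T, ?_, hF, ?_⟩
        · rw [mem_filter, mem_powerset]
          refine ⟨?_, hFf⟩
          intro A hA; rw [mem_powerset]
          exact fun u hu => hZ1 (mem_vs.mpr ⟨A, hA, hu⟩)
        · exact mem_powersetCard.mpr ⟨fun u hu => hZ1 (mem_inter.mp (hT hu)).1, hTc⟩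
        · intro v hv; exact (mem_filter.mp (mem_inter.mp (hT hv)).2).2
    _ ≤ ∑ Z ∈ powersetCard z (univ : Finset V), ∑ F ∈ (Z.powerset.powerset).filter (fun F => #F = f),
          ∑ T ∈ powersetCard t Z, c := by
        refine (pr_exists_le _ _).trans (sum_le_sum fun Z hZ => ?_)
        refine (pr_exists_le _ _).trans (sum_le_sum fun F hF => ?_)
        refine (pr_exists_le _ _).trans (sum_le_sum fun T hT => ?_)
        rw [mem_powersetCard] at hZ hT
        rw [mem_filter, mem_powerset] at hF
        obtain ⟨N', hN', hN'c⟩ := exists_subset_card_eq (s := N0 \ Z) (n := a) (by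
          have := le_card_sdiff Z N0; omega)
        have := low_set hB h0 h2 s K hs Z T N' N0 F hT.1 (hN'.trans sdiff_subset)
          (Finset.disjoint_of_subset_right hN' disjoint_sdiff) (fun A hA => mem_powerset.mp (hF.1 hA)) θ hθ hθ1
        rw [hF.2, hT.2, hN'c] at this
        exact this
    _ ≤ ∑ Z ∈ powersetCard z (univ : Finset V), ((2:ℝ) ^ (2 ^ z) * 2 ^ z * c) := by
        apply sum_le_sum
        intro Z hZ
        rw [mem_powersetCard] at hZ
        rw [sum_const, sum_const, nsmul_eq_mul, nsmul_eq_mul, ← mul_assoc]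
        have h1 : #((Z.powerset.powerset).filter (fun F => #F = f)) ≤ 2 ^ (2 ^ z) := by
          refine (card_filter_le _ _).trans ?_
          rw [card_powerset, card_powerset, hZ.2]
        have h3 : #(powersetCard t Z) ≤ 2 ^ z := by
          rw [← hZ.2, ← card_powerset]; exact card_le_card (fun T hT => by
            rw [mem_powersetCard] at hT; exact mem_powerset.mpr hT.1)
        gcongr
        · exact_mod_cast h1
        · exact_mod_cast h3
    _ ≤ _ := by
        rw [sum_const, nsmul_eq_mul, card_powersetCard, card_univ]
        have : ((Fintype.card V).choose z : ℝ) ≤ (Fintype.card V : ℝ) ^ z := by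
          exact_mod_cast Nat.choose_le_pow _ _
        calc _ ≤ (Fintype.card V : ℝ) ^ z * ((2:ℝ) ^ (2 ^ z) * 2 ^ z * c) := by gcongr
          _ = _ := by ring

lemma bulk_bound {B b0 : ℕ} (hB : 0 < B) (h0 : b0 ≤ B) (r xb : ℕ) (V0 : Finset V) :
    pr (fun l : Finset V → Fin B => ¬ ∀ X ⊆ V0, xb ≤ #X → ∃ A ∈ Gl r b0 l, A ⊆ X) ≤
      2 ^ (Fintype.card V) * Real.exp (-((b0:ℝ)/B * (xb.choose r : ℕ))) := by
  calc _ ≤ pr (fun l : Finset V → Fin B => ∃ X ∈ univ.filter (fun X : Finset V => xb ≤ #X),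
        ∀ A ∈ powersetCard r X, ¬ ((l A : ℕ) < b0)) := by
        apply pr_mono
        intro l h
        push Not at h
        obtain ⟨X, -, hX, h⟩ := h
        refine ⟨X, by simpa using hX, ?_⟩
        intro A hA hl
        rw [mem_powersetCard] at hA
        exact h A (mem_Gl.mpr ⟨hA.2, hl⟩) hA.1
    _ ≤ ∑ X ∈ univ.filter (fun X : Finset V => xb ≤ #X), Real.exp (-((b0:ℝ)/B * (xb.choose r : ℕ))) := by
        refine (pr_exists_le _ _).trans (sum_le_sum fun X hX => ?_)
        apply none_le hB h0
        rw [card_powersetCard]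
        exact Nat.choose_le_choose r (mem_filter.mp hX).2
    _ ≤ _ := by
        rw [sum_const, nsmul_eq_mul]
        gcongr
        have : #(univ.filter (fun X : Finset V => xb ≤ #X)) ≤ 2 ^ Fintype.card V := by
          rw [← Fintype.card_finset, ← card_univ]; exact card_filter_le _ _
        exact_mod_cast this

lemma lev_bound {B b0 : ℕ} (hB : 0 < B) (h0 : b0 ≤ B) (s lm yb a : ℕ) (hs : 1 ≤ s) (V0 R1 : Finset V)
    (h01 : Disjoint V0 R1) (ha : a + yb ≤ #R1) (x y : ℝ) (hx : 0 < x) (hx1 : x ≤ 1) (hy : 0 < y) (hy1 : y ≤ 1) :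
    pr (fun l : Finset V → Fin B => ¬ ∀ L ⊆ V0, lm ≤ #L → ∀ Y ⊆ R1, #Y ≤ yb →
        ∃ A ∈ Gl (s+1) b0 l, #(A ∩ L) = 1 ∧ A \ L ⊆ R1 \ Y) ≤
      ((x ^ lm)⁻¹ * Real.exp (x * Fintype.card V)) * ((y ^ yb)⁻¹ * Real.exp (y * Fintype.card V)) *
        Real.exp (-((b0:ℝ)/B * (lm * a.choose s : ℕ))) := by
  set c := Real.exp (-((b0:ℝ)/B * (lm * a.choose s : ℕ))) with hc
  calc _ ≤ pr (fun l : Finset V → Fin B => ∃ L ∈ univ.filter (fun L : Finset V => #L ≤ lm),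
        ∃ Y ∈ univ.filter (fun Y : Finset V => #Y ≤ yb), (#L = lm ∧ L ⊆ V0) ∧
        ∀ A ∈ L.biUnion (fun v => vstar s v (R1 \ Y)), ¬ ((l A : ℕ) < b0)) := by
        apply pr_mono
        intro l h
        push Not at h
        obtain ⟨L, hL0, hL, Y, hY1, hY, h⟩ := h
        obtain ⟨L', hL', hL'c⟩ := exists_subset_card_eq hL
        refine ⟨L', by simp [hL'c], Y, by simpa using hY, ⟨hL'c, hL'.trans hL0⟩, ?_⟩
        intro A hA hl
        obtain ⟨v, hv, hA⟩ := mem_biUnion.mp hA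
        have hvR : v ∉ R1 \ Y := fun h => Finset.disjoint_left.mp h01 (hL0 (hL' hv)) (mem_sdiff.mp h).1
        have hp := mem_vstar hvR hA
        have hAL : A ∩ L = {v} := by
          ext u
          rw [mem_inter, mem_singleton]
          constructor
          · rintro ⟨h1, h2⟩
            by_contra hne
            exact Finset.disjoint_left.mp h01 (hL0 h2) (mem_sdiff.mp (hp.2.2.1 (mem_erase.mpr ⟨hne, h1⟩))).1
          · rintro rfl; exact ⟨hp.2.1, hL' hv⟩
        refine h A (mem_Gl.mpr ⟨hp.1, hl⟩) (by rw [hAL]; simp) ?_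
        intro u hu
        rw [mem_sdiff] at hu
        exact hp.2.2.1 (mem_erase.mpr ⟨fun h => hu.2 (h ▸ hL' hv), hu.1⟩)
    _ ≤ ∑ L ∈ univ.filter (fun L : Finset V => #L ≤ lm),
          ∑ Y ∈ univ.filter (fun Y : Finset V => #Y ≤ yb), c := by
        refine (pr_exists_le _ _).trans (sum_le_sum fun L hL => ?_)
        refine (pr_exists_le _ _).trans (sum_le_sum fun Y hY => ?_)
        rw [mem_filter] at hY
        by_cases hLc : #L = lm ∧ L ⊆ V0
        · refine (pr_mono (fun l h => h.2)).trans (none_le hB h0 _ _ ?_)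
          rw [card_stars L (R1 \ Y) (Finset.disjoint_of_subset_left hLc.2
            (Finset.disjoint_of_subset_right sdiff_subset h01)), hLc.1]
          gcongr
          have := le_card_sdiff Y R1; omega
        · refine (pr_mono (Q := fun _ => False) (fun l h => hLc h.1)).trans ?_
          rw [pr_false]; positivity
    _ = (#(univ.filter (fun L : Finset V => #L ≤ lm)) : ℝ) * (#(univ.filter (fun Y : Finset V => #Y ≤ yb)) : ℝ) * c := by
        simp only [sum_const, nsmul_eq_mul]; ring
    _ ≤ _ := by
        gcongr
        · exact count_small x hx hx1 lm
        · exact count_small y hy hy1 yb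

lemma exp_bound {B b0 : ℕ} (hB : 0 < B) (h0 : b0 ≤ B) (hb0 : 0 < b0) (s k m lm : ℕ) (hm : 1 ≤ m)
    (hlm : lm ≤ Fintype.card V) (hsm : (b0:ℝ)/B * ((m * lm : ℕ) : ℝ) ^ s ≤ 1) :
    pr (fun l : Finset V → Fin B => ¬ Expd (Gl (s+1) b0 l) k m lm) ≤
      ∑ j ∈ Icc 1 lm, (((Fintype.card V : ℝ) / j) ^ (m + 1) * Real.exp 3 *
        ((b0:ℝ)/B * ((m * j : ℕ) : ℝ) ^ s) ^ k) ^ j := by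
  have hp0 : 0 < (b0:ℝ)/B := by positivity
  calc _ ≤ pr (fun l : Finset V → Fin B => ∃ j ∈ Icc 1 lm, ∃ L ∈ univ.filter (fun L : Finset V => #L ≤ j),
        ∃ N ∈ univ.filter (fun N : Finset V => #N ≤ m * j), (#L = j ∧ Disjoint L N) ∧
          k * j ≤ #((L.biUnion (fun v => vstar s v N)).filter (fun A => (l A : ℕ) < b0))) := by
        apply pr_mono
        intro l h
        unfold Expd at h
        push Not at h
        obtain ⟨L, N, hne, hL, hd, hN, h⟩ := h
        refine ⟨#L, mem_Icc.mpr ⟨card_pos.mpr hne, hL⟩, L, by simp, N, by simpa using hN, ⟨rfl, hd⟩, ?_⟩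
        have e : L.biUnion (fun v => lk (Gl (s+1) b0 l) v N) ⊆ (L.biUnion (fun v => vstar s v N)).filter (fun A => (l A : ℕ) < b0) := by
          intro A hA
          obtain ⟨v, hv, hA⟩ := mem_biUnion.mp hA
          have hA := mem_lk.mp hA
          have hG := mem_Gl.mp hA.1
          exact mem_filter.mpr ⟨mem_biUnion.mpr ⟨v, hv, vstar_mem hG.1 hA.2.1 hA.2.2⟩, hG.2⟩
        refine le_trans ?_ (card_le_card e)
        rw [card_biUnion]
        · calc k * #L = ∑ v ∈ L, k := by simp [mul_comm]
            _ ≤ _ := sum_le_sum fun v hv => h v hv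
        · intro v hv w hw hne
          rw [Function.onFun, Finset.disjoint_left]
          intro A hA hA'
          have h1 := mem_lk.mp hA
          have h2 := mem_lk.mp hA'
          exact Finset.disjoint_left.mp hd hw (h1.2.2 (mem_erase.mpr ⟨hne.symm, h2.2.1⟩))
    _ ≤ ∑ j ∈ Icc 1 lm, ∑ L ∈ univ.filter (fun L : Finset V => #L ≤ j),
        ∑ N ∈ univ.filter (fun N : Finset V => #N ≤ m * j),
          (((b0:ℝ)/B * ((m * j : ℕ) : ℝ) ^ s) ^ (k * j) * Real.exp j) := by
        refine (pr_exists_le _ _).trans (sum_le_sum fun j hj => ?_)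
        refine (pr_exists_le _ _).trans (sum_le_sum fun L hL => ?_)
        refine (pr_exists_le _ _).trans (sum_le_sum fun N hN => ?_)
        rw [mem_filter] at hN
        rw [mem_Icc] at hj
        by_cases hLc : #L = j ∧ Disjoint L N
        · refine (pr_mono (fun l h => h.2)).trans ?_
          have hmj : (0:ℝ) < ((m * j : ℕ) : ℝ) := by
            have : 0 < m * j := Nat.mul_pos (by omega) (by omega)
            exact_mod_cast this
          set w := (b0:ℝ)/B * ((m * j : ℕ) : ℝ) ^ s with hw
          have hw0 : 0 < w := by positivity
          have hw1 : w ≤ 1 := by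
            refine le_trans ?_ hsm
            rw [hw]; gcongr; exact hj.2
          refine (up_tail hB h0 _ (w⁻¹) (by rw [one_le_inv₀ hw0]; exact hw1) (k * j)).trans ?_
          rw [inv_pow, inv_inv]
          gcongr
          rw [card_stars L N hLc.2, hLc.1]
          have h1 : ((#N).choose s : ℝ) ≤ ((m * j : ℕ) : ℝ) ^ s := by
            have : (#N).choose s ≤ (m * j) ^ s := (Nat.choose_le_pow _ _).trans (Nat.pow_le_pow_left hN.2 _)
            exact_mod_cast this
          push_cast [Nat.cast_mul] at h1 ⊢
          rw [mul_assoc, inv_mul_le_iff₀ hw0, hw]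
          push_cast
          calc (b0:ℝ)/B * (j * ((#N).choose s : ℝ)) ≤ (b0:ℝ)/B * (j * ((m:ℝ) * j) ^ s) := by gcongr
            _ = _ := by ring
        · refine (pr_mono (Q := fun _ => False) (fun l h => hLc h.1)).trans ?_
          rw [pr_false]; positivity
    _ ≤ _ := by
        apply sum_le_sum
        intro j hj
        rw [mem_Icc] at hj
        have hj0 : (0:ℝ) < j := by exact_mod_cast hj.1
        have hn0 : (0:ℝ) < Fintype.card V := by
          have : 0 < Fintype.card V := by omega
          exact_mod_cast this
        have hjn : (j:ℝ) ≤ Fintype.card V := by exact_mod_cast hj.2.trans hlm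
        set n := (Fintype.card V : ℝ) with hn
        have c1 := count_small (V := V) (j / n) (by positivity) (div_le_one_of_le₀ hjn hn0.le) j
        have c2 := count_small (V := V) (j / n) (by positivity) (div_le_one_of_le₀ hjn hn0.le) (m * j)
        rw [← hn, div_mul_cancel₀ _ hn0.ne', ← inv_pow, inv_div] at c1 c2
        simp only [sum_const, nsmul_eq_mul]
        calc _ ≤ ((n / j) ^ j * Real.exp j) * (((n / j) ^ (m * j) * Real.exp j) *
              (((b0:ℝ)/B * ((m * j : ℕ) : ℝ) ^ s) ^ (k * j) * Real.exp j)) := by gcongr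
          _ = _ := by
            have e3 : Real.exp j ^ 3 = (Real.exp 3) ^ j := by
              rw [← Real.exp_nat_mul, ← Real.exp_nat_mul]; congr 1; push_cast; ring
            rw [mul_pow _ _ j, mul_pow _ (Real.exp 3) j, ← pow_mul, ← pow_mul, ← e3, add_mul, one_mul, pow_add]
            ring
end partE

section partG
open scoped Classical

lemma sum_pr_fiber {Ω β : Type*} [Fintype Ω] [Fintype β] (g : Ω → β) (P : β → Prop) [DecidablePred P] :
    ∑ y ∈ univ.filter P, pr (fun w => g w = y) = pr (fun w => P (g w)) := by
  simp only [pr_def]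
  rw [← sum_div]
  congr 1
  rw [Finset.card_eq_sum_card_fiberwise (s := univ.filter (fun w => P (g w))) (t := univ.filter P) (f := g)
    (by intro w hw; simpa using hw)]
  push_cast
  apply sum_congr rfl
  intro y hy
  congr 2
  ext w
  simp only [mem_filter, mem_univ, true_and] at hy ⊢
  constructor
  · rintro rfl; exact ⟨hy, rfl⟩
  · exact fun h => h.2

variable {V : Type*}

lemma IsM.subset {M M' : Finset (Finset V)} (h : IsM M) (h' : M' ⊆ M) : IsM M' :=
  fun A hA B hB hne => h A (h' hA) B (h' hB) hne

lemma card_vs {M : Finset (Finset V)} {r : ℕ} (h : IsM M) (hr : ∀ A ∈ M, #A = r) : #(vs M) = r * #M := by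
  unfold vs
  rw [card_biUnion (t := id) (fun A hA B hB hne => h A hA B hB hne)]
  rw [sum_congr rfl (fun A hA => show #(id A) = r from hr A hA), sum_const, smul_eq_mul, mul_comm]

variable [Fintype V]

lemma pm_measure' (U : Finset V) (m k : ℕ) (hk : 0 < k) (hU : #U = (m+1) * k) :
    ∃ ν : Finset (Finset V) → ℝ, (∀ T, 0 ≤ ν T) ∧
      (∀ T, ν T ≠ 0 → (∀ A ∈ T, #A = m+1 ∧ A ⊆ U) ∧ IsM T ∧ vs T = U) ∧
      ∑ T, ν T = 1 ∧ ∀ S, ∑ T ∈ univ.filter (fun T => S ⊆ T), ν T ≤ ((Real.exp 1 / k) ^ m) ^ #S := by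
  obtain ⟨T, hT, hS⟩ := pm_measure U m k hk hU
  refine ⟨fun T' => pr (fun π => T π = T'), fun _ => pr_nonneg _, ?_, ?_, ?_⟩
  · intro T' h
    by_cases hex : ∃ π, T π = T'
    · obtain ⟨π, rfl⟩ := hex
      exact hT π
    · exfalso; apply h
      have : (fun π => T π = T') = fun _ => False := by
        funext π; simp only [eq_iff_iff, iff_false]; exact fun hh => hex ⟨π, hh⟩
      change pr (fun π => T π = T') = 0
      rw [this, pr_false]
  · have := sum_pr_fiber T (fun _ => True)
    rw [filter_true] at this
    rw [this, pr_def, filter_true, card_univ, div_self]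
    exact_mod_cast Fintype.card_ne_zero
  · intro S
    refine (sum_pr_fiber T (fun T' => S ⊆ T')).le.trans ?_
    rw [pr_def]
    exact hS S

/-- isolated vertices -/
noncomputable def Iso (r b : ℕ) {B : ℕ} (l : Finset V → Fin B) : Finset V :=
  univ.filter (fun v => ∀ A ∈ Gl r b l, v ∉ A)

noncomputable def Gs (r b : ℕ) {B : ℕ} (l : Finset V → Fin B) : Finset (Finset V) :=
  univ.filter (fun A => #A = r ∧ ((l A : ℕ) < b ∨ ∃ v ∈ A, v ∈ Iso r b l ∧
    ∀ A', #A' = r → v ∈ A' → l A ≤ l A'))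

def Good (r b : ℕ) {B : ℕ} (V0 : Finset V) (a : ℕ) (l : Finset V → Fin B) : Prop :=
  ∃ M, IsM M ∧ M ⊆ Gs r b l ∧ V0 ∪ Iso r b l ⊆ vs M ∧ a ≤ #(univ \ vs M)

def HasPM (G : Finset (Finset V)) : Prop := ∃ M ⊆ G, IsM M ∧ vs M = univ

noncomputable def Ef (r b : ℕ) {B : ℕ} (l : Finset V → Fin B) : Finset (Finset V) :=
  univ.filter (fun A => #A = r ∧ b ≤ (l A : ℕ) ∧ Disjoint A (Iso r b l))

lemma mem_Ef {r b B : ℕ} {l : Finset V → Fin B} {A : Finset V} :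
    A ∈ Ef r b l ↔ #A = r ∧ b ≤ (l A : ℕ) ∧ Disjoint A (Iso r b l) := by simp [Ef]

/-- the mixed labelling -/
noncomputable def mixl (r b : ℕ) {B : ℕ} (l : Finset V → Fin B) (ν : Finset V → Fin (B - b)) :
    Finset V → Fin B :=
  fun A => if A ∈ Ef r b l then ⟨b + ν A, by have := (ν A).2; omega⟩ else l A

noncomputable def mixn (r b : ℕ) {B : ℕ} (l : Finset V → Fin B) (ν : Finset V → Fin (B - b)) :
    Finset V → Fin (B - b) :=
  fun A => if h : A ∈ Ef r b l then ⟨l A - b, by have := (l A).2; have := (mem_Ef.mp h).2.1; omega⟩ else ν A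

lemma Gl_mix {r b B : ℕ} (l : Finset V → Fin B) (ν : Finset V → Fin (B - b)) :
    Gl r b (mixl r b l ν) = Gl r b l := by
  ext A
  rw [mem_Gl, mem_Gl]
  unfold mixl
  by_cases h : A ∈ Ef r b l
  · have := (mem_Ef.mp h).2.1
    simp only [h, if_true]; omega
  · simp only [h, if_false]

lemma Iso_mix {r b B : ℕ} (l : Finset V → Fin B) (ν : Finset V → Fin (B - b)) :
    Iso r b (mixl r b l ν) = Iso r b l := by
  unfold Iso; rw [Gl_mix]

lemma Ef_mix {r b B : ℕ} (l : Finset V → Fin B) (ν : Finset V → Fin (B - b)) :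
    Ef r b (mixl r b l ν) = Ef r b l := by
  ext A
  by_cases h : A ∈ Ef r b l
  · refine ⟨fun _ => h, fun _ => ?_⟩
    have h' := mem_Ef.mp h
    rw [mem_Ef, Iso_mix]
    refine ⟨h'.1, ?_, h'.2.2⟩
    unfold mixl; simp [h]
  · refine ⟨fun h2 => ?_, fun h2 => absurd h2 h⟩
    have h' := mem_Ef.mp h2
    rw [Iso_mix] at h'
    unfold mixl at h'
    simp only [h, if_false] at h'
    exact mem_Ef.mpr h'

lemma mix_mix {r b B : ℕ} (l : Finset V → Fin B) (ν : Finset V → Fin (B - b)) :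
    mixl r b (mixl r b l ν) (mixn r b l ν) = l ∧ mixn r b (mixl r b l ν) (mixn r b l ν) = ν := by
  constructor
  · funext A
    by_cases h : A ∈ Ef r b l
    · have hh : A ∈ Ef r b (mixl r b l ν) := by rw [Ef_mix]; exact h
      have := (mem_Ef.mp h).2.1
      rw [mixl, if_pos hh]
      apply Fin.ext
      simp only [mixn, h, dif_pos]; omega
    · have hh : A ∉ Ef r b (mixl r b l ν) := by rw [Ef_mix]; exact h
      rw [mixl, if_neg hh, mixl, if_neg h]
  · funext A
    by_cases h : A ∈ Ef r b l
    · have hh : A ∈ Ef r b (mixl r b l ν) := by rw [Ef_mix]; exact h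
      rw [mixn, dif_pos hh]
      apply Fin.ext
      simp only [mixl, h, if_true]; omega
    · have hh : A ∉ Ef r b (mixl r b l ν) := by rw [Ef_mix]; exact h
      rw [mixn, dif_neg hh, mixn, dif_neg h]

lemma ex_mix {r b B : ℕ} (hb : b < B) (f : (Finset V → Fin B) → ℝ) :
    ex f = ex (fun l => ex (fun ν : Finset V → Fin (B - b) => f (mixl r b l ν))) := by
  have hne : Nonempty (Fin (B - b)) := ⟨⟨0, by omega⟩⟩
  let e : ((Finset V → Fin B) × (Finset V → Fin (B - b))) ≃ ((Finset V → Fin B) × (Finset V → Fin (B - b))) :=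
    Function.Involutive.toPerm (fun w => (mixl r b w.1 w.2, mixn r b w.1 w.2)) (by
      intro w
      have := mix_mix (r := r) w.1 w.2
      exact Prod.ext this.1 this.2)
  calc ex f = ex (fun l => ex (fun _ : Finset V → Fin (B - b) => f l)) := by
        congr 1; funext l; rw [ex_const]
    _ = ex (fun w : (Finset V → Fin B) × (Finset V → Fin (B - b)) => f w.1) := by rw [ex_prodtype]
    _ = ex (fun w => f (e w).1) := (ex_equiv e (fun w => f w.1)).symm
    _ = _ := by rw [ex_prodtype]; rfl

lemma Gs_mix {r b B : ℕ} (l : Finset V → Fin B) (ν : Finset V → Fin (B - b)) :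
    Gs r b l ⊆ Gs r b (mixl r b l ν) := by
  have key : ∀ A v, v ∈ A → v ∈ Iso r b l → mixl r b l ν A = l A := by
    intro A v hv hI
    unfold mixl
    rw [if_neg]
    intro h
    exact Finset.disjoint_left.mp (mem_Ef.mp h).2.2 hv hI
  intro A hA
  simp only [Gs, mem_filter, mem_univ, true_and] at hA ⊢
  refine ⟨hA.1, ?_⟩
  rcases hA.2 with h | ⟨v, hv, hI, h⟩
  · left
    have : A ∈ Gl r b (mixl r b l ν) := by rw [Gl_mix]; exact mem_Gl.mpr ⟨hA.1, h⟩
    exact (mem_Gl.mp this).2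
  · right
    refine ⟨v, hv, by rw [Iso_mix]; exact hI, ?_⟩
    intro A' hA' hv'
    rw [key A v hv hI, key A' v hv' hI]
    exact h A' hA' hv'

set_option maxHeartbeats 1000000 in
lemma sprinkle_fixed {C : Type*} [Fintype C] [Nonempty C] (V0 : C → Finset V) (δ : ℝ) (hδ0 : 0 ≤ δ)
    (hδ : ∀ Q, pr (fun c => Disjoint Q (V0 c)) ≤ δ ^ #Q) (m kmin : ℕ) (hk : 0 < kmin)
    (hdiv : m + 1 ∣ Fintype.card V) {B b0 b1 : ℕ} (hb : b0 < B) (h01 : b0 ≤ b1) (hb1 : b1 ≤ B)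
    (p x : ℝ) (J : ℕ) (hp : 0 < p) (hp1 : p ≤ 1) (hx1 : x ≤ 1) (hJ : Fintype.card V < 2 ^ J)
    (hP : ((b1 - b0 : ℕ) : ℝ) / ((B - b0 : ℕ) : ℝ) = 1 - (1 - p) ^ J)
    (hx : δ ^ (m+1) * (Real.exp 1 / kmin) ^ m = p * x) (l : Finset V → Fin B) :
    pr (fun ν : Finset V → Fin (B - b0) =>
        ¬ HasPM (Gs (m+1) b0 (mixl (m+1) b0 l ν) ∪ Gl (m+1) b1 (mixl (m+1) b0 l ν))) ≤
      pr (fun c => ¬ Good (m+1) b0 (V0 c) ((m+1) * kmin) l) + ∑ j ∈ range J, (4 * x) ^ (2 ^ j) := by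
  set q0 := (Real.exp 1 / kmin) ^ m with hq0
  have hq0n : 0 ≤ q0 := by positivity
  have hch : ∀ c, ∃ (M : Finset (Finset V)) (ν : Finset (Finset V) → ℝ),
      (∀ T, 0 ≤ ν T) ∧ (∀ S, ∑ T ∈ univ.filter (fun T => S ⊆ T), ν T ≤ q0 ^ #S) ∧
      (Good (m+1) b0 (V0 c) ((m+1) * kmin) l → (IsM M ∧ M ⊆ Gs (m+1) b0 l ∧ V0 c ∪ Iso (m+1) b0 l ⊆ vs M) ∧
        ∑ T, ν T = 1 ∧ ∀ T, ν T ≠ 0 → (∀ A ∈ T, #A = m+1 ∧ A ⊆ univ \ vs M) ∧ IsM T ∧ vs T = univ \ vs M) := by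
    intro c
    by_cases hG : Good (m+1) b0 (V0 c) ((m+1) * kmin) l
    · obtain ⟨M, hM, hMs, hV, ha⟩ := hG
      have hc := card_vs hM (fun A hA => (mem_filter.mp (hMs hA)).2.1)
      have hcU : #(univ \ vs M) = Fintype.card V - (m+1) * #M := by
        rw [card_sdiff_of_subset (subset_univ _), card_univ, hc]
      obtain ⟨k, hkk⟩ : (m+1) ∣ #(univ \ vs M) := by
        rw [hcU]; exact Nat.dvd_sub hdiv (dvd_mul_right _ _)
      have hkk' : kmin ≤ k := by
        rw [hkk] at ha; exact Nat.le_of_mul_le_mul_left ha (by omega)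
      obtain ⟨ν, h1, h2, h3, h4⟩ := pm_measure' (univ \ vs M) m k (by omega) hkk
      refine ⟨M, ν, h1, ?_, fun _ => ⟨⟨hM, hMs, hV⟩, h3, h2⟩⟩
      intro S
      refine (h4 S).trans ?_
      have : (0:ℝ) < kmin := by exact_mod_cast hk
      rw [hq0]; gcongr
    · refine ⟨∅, fun _ => 0, by simp, ?_, fun h => absurd h hG⟩
      intro S; simp only [sum_const_zero]; positivity
  choose M ν hν0 hνs hGood using hch
  set Ω : Finset (C × Finset (Finset V)) := univ.filter
    (fun i => Good (m+1) b0 (V0 i.1) ((m+1) * kmin) l ∧ ν i.1 i.2 ≠ 0) with hΩ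
  have hcC : (0:ℝ) < Fintype.card C := by exact_mod_cast Fintype.card_pos
  let μ : C × Finset (Finset V) → ℝ := fun i => ν i.1 i.2 / Fintype.card C
  let F : C × Finset (Finset V) → Finset (Finset V) := fun i => i.2 \ Gl (m+1) b0 l
  have hΩm : ∀ i ∈ Ω, (IsM (M i.1) ∧ M i.1 ⊆ Gs (m+1) b0 l ∧ V0 i.1 ∪ Iso (m+1) b0 l ⊆ vs (M i.1)) ∧
      (∀ A ∈ i.2, #A = m+1 ∧ A ⊆ univ \ vs (M i.1)) ∧ IsM i.2 ∧ vs i.2 = univ \ vs (M i.1) := by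
    intro i hi
    have hi := (mem_filter.mp hi).2
    have := hGood i.1 hi.1
    exact ⟨this.1, this.2.2 i.2 hi.2⟩
  have hμ0 : ∀ i, 0 ≤ μ i := fun i => div_nonneg (hν0 _ _) hcC.le
  have hspread : ∀ S : Finset (Finset V), ∑ i ∈ Ω.filter (fun i => S ⊆ F i), μ i ≤ (δ ^ (m+1) * q0) ^ #S := by
    intro S
    by_cases hne : (Ω.filter (fun i => S ⊆ F i)).Nonempty
    · obtain ⟨i0, hi0⟩ := hne
      rw [mem_filter] at hi0
      obtain ⟨-, hT1, hT2, hT3⟩ := hΩm i0 hi0.1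
      have hST : S ⊆ i0.2 := hi0.2.trans sdiff_subset
      have hcS := card_vs (hT2.subset hST) (fun A hA => (hT1 A (hST hA)).1)
      calc ∑ i ∈ Ω.filter (fun i => S ⊆ F i), μ i
          ≤ ∑ i ∈ (univ.filter (fun c => Disjoint (vs S) (V0 c))) ×ˢ
            (univ.filter (fun T : Finset (Finset V) => S ⊆ T)), μ i := by
            apply sum_le_sum_of_subset_of_nonneg
            · intro i hi
              rw [mem_filter] at hi
              obtain ⟨⟨hM, hMs, hV⟩, hT1', hT2', hT3'⟩ := hΩm i hi.1
              have hST' : S ⊆ i.2 := hi.2.trans sdiff_subset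
              rw [mem_product]
              refine ⟨mem_filter.mpr ⟨mem_univ _, ?_⟩, mem_filter.mpr ⟨mem_univ _, hST'⟩⟩
              rw [Finset.disjoint_left]
              intro v hv hv0
              obtain ⟨A, hA, hvA⟩ := mem_vs.mp hv
              exact (mem_sdiff.mp ((hT1' A (hST' hA)).2 hvA)).2 (hV (mem_union_left _ hv0))
            · intro i _ _; exact hμ0 i
        _ = ∑ c ∈ univ.filter (fun c => Disjoint (vs S) (V0 c)),
            (∑ T ∈ univ.filter (fun T : Finset (Finset V) => S ⊆ T), ν c T) / Fintype.card C := by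
            rw [sum_product]
            apply sum_congr rfl
            intro c _
            rw [sum_div]
        _ ≤ ∑ c ∈ univ.filter (fun c => Disjoint (vs S) (V0 c)), q0 ^ #S / Fintype.card C := by
            apply sum_le_sum; intro c _
            gcongr; exact hνs c S
        _ = pr (fun c => Disjoint (vs S) (V0 c)) * q0 ^ #S := by
            rw [sum_const, nsmul_eq_mul, pr_def]; ring
        _ ≤ δ ^ #(vs S) * q0 ^ #S := by gcongr; exact hδ _
        _ = _ := by rw [hcS, pow_mul, mul_pow]
    · rw [not_nonempty_iff_eq_empty] at hne
      rw [hne, sum_empty]; positivity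
  have main := spread_main (Ef (m+1) b0 l) (δ ^ (m+1) * q0) p x (by positivity) hp hp1 hx hx1 μ J Ω
    (fun i _ => hμ0 i) F ?_ ?_ ?_
  · have hsum : ∑ i ∈ Ω, μ i = 1 - pr (fun c => ¬ Good (m+1) b0 (V0 c) ((m+1) * kmin) l) := by
      rw [pr_not, sub_sub_cancel, pr_def]
      have e1 : ∑ i ∈ Ω, μ i = ∑ i ∈ (univ.filter (fun c => Good (m+1) b0 (V0 c) ((m+1) * kmin) l)) ×ˢ
          (univ : Finset (Finset (Finset V))), μ i := by
        apply sum_subset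
        · intro i hi
          rw [mem_product]
          exact ⟨mem_filter.mpr ⟨mem_univ _, (mem_filter.mp hi).2.1⟩, mem_univ _⟩
        · intro i hi hi'
          have hi1 := (mem_filter.mp (mem_product.mp hi).1).2
          have : ν i.1 i.2 = 0 := by
            by_contra h
            exact hi' (mem_filter.mpr ⟨mem_univ _, hi1, h⟩)
          simp only [μ, this, zero_div]
      rw [e1, sum_product]
      have e2 : ∀ c ∈ univ.filter (fun c => Good (m+1) b0 (V0 c) ((m+1) * kmin) l),
          ∑ T : Finset (Finset V), μ (c, T) = 1 / Fintype.card C := by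
        intro c hc
        simp only [μ]
        rw [← sum_div, (hGood c (mem_filter.mp hc).2).2.1]
      rw [sum_congr rfl e2, sum_const, nsmul_eq_mul, mul_one_div]
    rw [hsum, sub_sub_cancel, ← hP, ← ex_bexp (by omega) (by omega)] at main
    refine le_trans ?_ main
    apply pr_le_ex
    · intro w; split_ifs <;> norm_num
    · intro w hw
      rw [if_neg]
      rintro ⟨i, hi, hF⟩
      apply hw
      obtain ⟨⟨hM, hMs, hV⟩, hT1, hT2, hT3⟩ := hΩm i hi
      refine ⟨M i.1 ∪ i.2, ?_, ?_, ?_⟩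
      · apply union_subset
        · exact (hMs.trans (Gs_mix l w)).trans subset_union_left
        · intro A hA
          by_cases hAG : A ∈ Gl (m+1) b0 l
          · rw [mem_union]; right
            rw [← Gl_mix l w] at hAG
            have := mem_Gl.mp hAG
            exact mem_Gl.mpr ⟨this.1, by omega⟩
          · have hh := mem_filter.mp (hF (mem_sdiff.mpr ⟨hA, hAG⟩))
            rw [mem_union]; right
            refine mem_Gl.mpr ⟨(hT1 A hA).1, ?_⟩
            have h2 := hh.2
            simp only [mixl, hh.1, if_true]
            omega
      · apply hM.union hT2
        rw [hT3]; exact disjoint_sdiff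
      · rw [vs_union, hT3]; exact union_sdiff_of_subset (subset_univ _)
  · intro i hi A hA
    obtain ⟨⟨hM, hMs, hV⟩, hT1, hT2, hT3⟩ := hΩm i hi
    have hA := mem_sdiff.mp hA
    have hA1 := hT1 A hA.1
    refine mem_Ef.mpr ⟨hA1.1, ?_, ?_⟩
    · by_contra h
      exact hA.2 (mem_Gl.mpr ⟨hA1.1, by omega⟩)
    · rw [Finset.disjoint_left]
      intro v hv hI
      exact (mem_sdiff.mp (hA1.2 hv)).2 (hV (mem_union_right _ hI))
  · intro i hi
    obtain ⟨⟨hM, hMs, hV⟩, hT1, hT2, hT3⟩ := hΩm i hi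
    have h1 := card_vs hT2 (fun A hA => (hT1 A hA).1)
    have h2 : #(vs i.2) ≤ Fintype.card V := card_le_univ _
    have h3 : #(F i) ≤ #i.2 := card_le_card sdiff_subset
    have h4 : #i.2 ≤ (m+1) * #i.2 := Nat.le_mul_of_pos_left _ (by omega)
    omega
  · intro S; convert hspread S

lemma sprinkle {C : Type*} [Fintype C] [Nonempty C] (V0 : C → Finset V) (δ : ℝ) (hδ0 : 0 ≤ δ)
    (hδ : ∀ Q, pr (fun c => Disjoint Q (V0 c)) ≤ δ ^ #Q) (m kmin : ℕ) (hk : 0 < kmin)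
    (hdiv : m + 1 ∣ Fintype.card V) {B b0 b1 : ℕ} (hb : b0 < B) (h01 : b0 ≤ b1) (hb1 : b1 ≤ B)
    (p x : ℝ) (J : ℕ) (hp : 0 < p) (hp1 : p ≤ 1) (hx1 : x ≤ 1) (hJ : Fintype.card V < 2 ^ J)
    (hP : ((b1 - b0 : ℕ) : ℝ) / ((B - b0 : ℕ) : ℝ) = 1 - (1 - p) ^ J)
    (hx : δ ^ (m+1) * (Real.exp 1 / kmin) ^ m = p * x) :
    pr (fun l : Finset V → Fin B => ¬ HasPM (Gs (m+1) b0 l ∪ Gl (m+1) b1 l)) ≤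
      ex (fun c => pr (fun l : Finset V → Fin B => ¬ Good (m+1) b0 (V0 c) ((m+1) * kmin) l)) +
        ∑ j ∈ range J, (4 * x) ^ (2 ^ j) := by
  have hne : Nonempty (Fin B) := ⟨⟨0, by omega⟩⟩
  rw [pr_eq_ex, ex_mix (r := m+1) hb]
  calc _ ≤ ex (fun l : Finset V → Fin B => pr (fun c => ¬ Good (m+1) b0 (V0 c) ((m+1) * kmin) l) +
        ∑ j ∈ range J, (4 * x) ^ (2 ^ j)) := by
        apply ex_mono; intro l
        rw [← pr_eq_ex]
        exact sprinkle_fixed V0 δ hδ0 hδ m kmin hk hdiv hb h01 hb1 p x J hp hp1 hx1 hJ hP hx l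
    _ = _ := by
        rw [ex_add, ex_const]
        congr 1
        simp only [pr_eq_ex]
        rw [← ex_prodtype (fun w : (Finset V → Fin B) × C => if ¬ Good (m+1) b0 (V0 w.2) ((m+1) * kmin) w.1 then (1:ℝ) else 0),
          ← ex_prodtype (fun w : C × (Finset V → Fin B) => if ¬ Good (m+1) b0 (V0 w.1) ((m+1) * kmin) w.2 then (1:ℝ) else 0),
          ← ex_equiv (Equiv.prodComm _ _)]
        rfl

end partG

section partF
open scoped Classical
variable {V : Type*} [Fintype V]

noncomputable def St (r : ℕ) (v : V) : Finset (Finset V) := univ.filter (fun A => #A = r ∧ v ∈ A)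

lemma card_St (s : ℕ) (v : V) : #(St (s+1) v) = (Fintype.card V - 1).choose s := by
  have : St (s+1) v = vstar s v (univ.erase v) := by
    ext A
    simp only [St, mem_filter, mem_univ, true_and]
    constructor
    · rintro ⟨h1, h2⟩
      exact vstar_mem h1 h2 (fun u hu => mem_erase.mpr ⟨(mem_erase.mp hu).1, mem_univ _⟩)
    · intro h
      have := mem_vstar (by simp) h
      exact ⟨this.1, this.2.1⟩
  rw [this, card_star' (by simp), card_erase_of_mem (mem_univ _), card_univ]

lemma card_St_inter (s : ℕ) (v w : V) (h : v ≠ w) :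
    #(St (s+2) v ∩ St (s+2) w) ≤ (Fintype.card V - 2).choose s := by
  have hc : #((univ.erase v).erase w) = Fintype.card V - 2 := by
    rw [card_erase_of_mem (by simp [h.symm]), card_erase_of_mem (mem_univ _), card_univ]; omega
  rw [← hc, ← card_powersetCard]
  apply card_le_card_of_injOn (fun A => (A.erase v).erase w)
  · intro A hA
    simp only [St, coe_inter, coe_filter, mem_univ, true_and, Set.mem_inter_iff, Set.mem_ofPred_eq] at hA
    rw [mem_coe, mem_powersetCard]
    refine ⟨erase_subset_erase _ (erase_subset_erase _ (subset_univ _)), ?_⟩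
    rw [card_erase_of_mem (mem_erase.mpr ⟨h.symm, hA.2.2⟩), card_erase_of_mem hA.1.2, hA.1.1]; omega
  · intro A hA A' hA' he
    simp only [St, coe_inter, coe_filter, mem_univ, true_and, Set.mem_inter_iff, Set.mem_ofPred_eq] at hA hA'
    have he : (A.erase v).erase w = (A'.erase v).erase w := he
    rw [← insert_erase hA.1.2, ← insert_erase hA'.1.2,
      ← insert_erase (mem_erase.mpr ⟨h.symm, hA.2.2⟩), ← insert_erase (mem_erase.mpr ⟨h.symm, hA'.2.2⟩), he]

lemma mem_Iso_iff {r b B : ℕ} {l : Finset V → Fin B} {v : V} :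
    v ∈ Iso r b l ↔ ∀ A ∈ St r v, ¬ ((l A : ℕ) < b) := by
  simp only [Iso, mem_filter, mem_univ, true_and, St, Gl]
  grind

lemma iso_empty {B b : ℕ} (hb : b < B) (s : ℕ) (hn : 0 < Fintype.card V) :
    pr (fun l : Finset V → Fin B => Iso (s+2) b l = ∅) ≤
      1 / (Fintype.card V * (1 - (b:ℝ)/B) ^ ((Fintype.card V - 1).choose (s+1))) +
      (((1 - (b:ℝ)/B) ^ ((Fintype.card V - 2).choose s))⁻¹ - 1) := by
  have hne : Nonempty (Fin B) := ⟨⟨0, by omega⟩⟩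
  have hB : (0:ℝ) < B := by exact_mod_cast (by omega : 0 < B)
  set t := 1 - (b:ℝ)/B with ht
  have ht0 : 0 < t := by
    have : (b:ℝ)/B < 1 := by rw [div_lt_one hB]; exact_mod_cast hb
    linarith
  have ht1 : t ≤ 1 := by have : 0 ≤ (b:ℝ)/B := by positivity
                         linarith
  set D := (Fintype.card V - 1).choose (s+1) with hD
  set D2 := (Fintype.card V - 2).choose s with hD2
  set n := Fintype.card V with hncard
  have hn' : (0:ℝ) < n := by exact_mod_cast hn
  set u := t ^ D with hu
  have hu0 : 0 < u := by positivity
  let I : V → (Finset V → Fin B) → ℝ := fun v l => if v ∈ Iso (s+2) b l then 1 else 0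
  let X : (Finset V → Fin B) → ℝ := fun l => ∑ v, I v l
  have hI : ∀ v, ex (I v) = u := by
    intro v
    simp only [I]
    rw [← pr_eq_ex]
    simp only [mem_Iso_iff]
    rw [none_prob (by omega) hb.le, card_St]
  have hII : ∀ v w, v ≠ w → ex (fun l => I v l * I w l) ≤ u ^ 2 * (t ^ D2)⁻¹ := by
    intro v w hvw
    have e : ex (fun l => I v l * I w l) = t ^ #(St (s+2) v ∪ St (s+2) w) := by
      rw [ht, ← none_prob (by omega) hb.le, pr_eq_ex]
      congr 1; funext l
      have : (∀ A ∈ St (s+2) v ∪ St (s+2) w, ¬ ((l A : ℕ) < b)) ↔ (v ∈ Iso (s+2) b l ∧ w ∈ Iso (s+2) b l) := by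
        rw [mem_Iso_iff, mem_Iso_iff, forall_mem_union]
      simp only [I, this]
      by_cases h1 : v ∈ Iso (s+2) b l <;> by_cases h2 : w ∈ Iso (s+2) b l <;> simp [h1, h2]
    rw [e, ← div_eq_mul_inv, le_div_iff₀ (by positivity), ← pow_add, hu, ← pow_mul]
    apply pow_le_pow_of_le_one ht0.le ht1
    have h1 := card_union_add_card_inter (St (s+2) v) (St (s+2) w)
    have h2 := card_St_inter s v w hvw
    rw [card_St (s+1), card_St (s+1)] at h1
    omega
  have hX : ex X = n * u := by
    simp only [X]
    rw [ex_sum]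
    simp only [hI]
    simp [hncard]
  have hX2 : ex (fun l => X l * X l) ≤ n * u + n ^ 2 * (u ^ 2 * (t ^ D2)⁻¹) := by
    have e : (fun l => X l * X l) = fun l => ∑ v, ∑ w, I v l * I w l := by
      funext l; simp only [X]; rw [sum_mul_sum]
    rw [e, ex_sum]
    simp only [ex_sum]
    calc _ ≤ ∑ v : V, ∑ w : V, ((if v = w then u else 0) + u ^ 2 * (t ^ D2)⁻¹) := by
          apply sum_le_sum; intro v _
          apply sum_le_sum; intro w _
          by_cases h : v = w
          · subst h
            have : (fun l => I v l * I v l) = I v := by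
              funext l; simp only [I]; split_ifs <;> norm_num
            rw [this, hI, if_pos rfl]
            have : 0 ≤ u ^ 2 * (t ^ D2)⁻¹ := by positivity
            linarith
          · rw [if_neg h, zero_add]; exact hII v w h
      _ = _ := by
          simp only [sum_add_distrib, sum_ite_eq, mem_univ, if_true, sum_const, card_univ, nsmul_eq_mul]
          rw [← hncard]; ring
  have hnu : 0 < n * u := by positivity
  calc _ ≤ ex (fun l => (n*u)⁻¹ ^ 2 * (X l * X l) + ((-2 * (n*u)⁻¹) * X l + 1)) := by
        apply pr_le_ex
        · intro l
          have : (n*u)⁻¹ ^ 2 * (X l * X l) + ((-2 * (n*u)⁻¹) * X l + 1) = ((n*u)⁻¹ * X l - 1)^2 := by ring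
          rw [this]; positivity
        · intro l hl
          have : X l = 0 := by simp only [X, I, hl]; simp
          rw [this]; norm_num
    _ = (n*u)⁻¹ ^ 2 * ex (fun l => X l * X l) + ((-2 * (n*u)⁻¹) * ex X + 1) := by
        rw [ex_add, ex_mul, ex_add, ex_mul, ex_const]
    _ ≤ (n*u)⁻¹ ^ 2 * (n * u + n ^ 2 * (u ^ 2 * (t ^ D2)⁻¹)) + ((-2 * (n*u)⁻¹) * (n * u) + 1) := by
        rw [hX]; gcongr
    _ = _ := by field_simp; ring

/-- all vertices covered -/
lemma iso_some {B b : ℕ} (hb : b < B) (s : ℕ) :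
    pr (fun l : Finset V → Fin B => Iso (s+1) b l ≠ ∅) ≤
      Fintype.card V * Real.exp (-((b:ℝ)/B * ((Fintype.card V - 1).choose s : ℕ))) := by
  calc _ ≤ pr (fun l : Finset V → Fin B => ∃ v ∈ (univ : Finset V), ∀ A ∈ St (s+1) v, ¬ ((l A : ℕ) < b)) := by
        apply pr_mono
        intro l h
        obtain ⟨v, hv⟩ := nonempty_iff_ne_empty.mpr h
        exact ⟨v, mem_univ _, mem_Iso_iff.mp hv⟩
    _ ≤ ∑ v : V, Real.exp (-((b:ℝ)/B * ((Fintype.card V - 1).choose s : ℕ))) := by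
        refine (pr_exists_le _ _).trans (sum_le_sum fun v _ => ?_)
        exact none_le (by omega) hb.le _ _ (card_St s v).ge
    _ = _ := by simp
end partF

section partH
open scoped Classical
variable {V : Type*} [Fintype V]

lemma good_of {s k j0 lm xb sb yb b0 b2 B a : ℕ} (hs : 2 ≤ s) (hk : 1 ≤ k) (hb : b0 ≤ b2)
    (V0 R1 R2 : Finset V) (h01 : Disjoint V0 R1) (h02 : Disjoint V0 R2) (h12 : Disjoint R1 R2)
    (l : Finset V → Fin B) (hcov : Iso (s+1) b2 l = ∅)
    (hE : Expd (Gl (s+1) b0 l) k (k*(s-1)+(s+1)) lm) (hlm : 1 ≤ lm)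
    (hS : ¬ ∃ f ∈ range 5, ∃ F ⊆ Gl (s+1) b2 l, #F = f ∧ #(vs F) ≤ f * s + 1 ∧
        2 ≤ #(vs F ∩ univ.filter (fun v => #(lk (Gl (s+1) b0 l) v V0) < k*(j0+2))))
    (hB2 : ¬ ∃ F ⊆ Gl (s+1) b2 l, #F = j0 ∧ #(vs F) ≤ j0 * s + 1 ∧
        j0 ≤ #(vs F ∩ univ.filter (fun v => #(lk (Gl (s+1) b0 l) v R2) < k*(j0+2))))
    (hBadc : #(univ.filter (fun v => #(lk (Gl (s+1) b0 l) v R2) < k*(j0+2))) ≤ lm)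
    (hSmc : #(univ.filter (fun v => #(lk (Gl (s+1) b0 l) v V0) < k*(j0+2))) ≤ sb)
    (hBulk : ∀ X ⊆ V0, xb ≤ #X → ∃ A ∈ Gl (s+1) b0 l, A ⊆ X)
    (hLev : ∀ L ⊆ V0, lm ≤ #L → ∀ Y ⊆ R1, #Y ≤ yb → ∃ A ∈ Gl (s+1) b0 l, #(A ∩ L) = 1 ∧ A \ L ⊆ R1 \ Y)
    (hyb : (s+1) * sb + (s+1) * xb ≤ yb) (ha : a + yb ≤ #R1) :
    Good (s+1) b0 V0 a l := by
  set G0 := Gl (s+1) b0 l with hG0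
  set G2 := Gl (s+1) b2 l with hG2
  set Sm := univ.filter (fun v => #(lk G0 v V0) < k*(j0+2)) with hSm
  set Bad := univ.filter (fun v => #(lk G0 v R2) < k*(j0+2)) with hBad
  have hsub : G0 ⊆ G2 := by
    intro A hA
    have := mem_Gl.mp hA
    exact mem_Gl.mpr ⟨this.1, by omega⟩
  have hexe : ∀ v, ∃ A, A ∈ G2 ∧ v ∈ A ∧ A ∈ Gs (s+1) b0 l := by
    intro v
    by_cases hv : v ∈ Iso (s+1) b0 l
    · have hv2 : v ∉ Iso (s+1) b2 l := by rw [hcov]; simp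
      rw [mem_Iso_iff] at hv2
      push Not at hv2
      obtain ⟨A1, hA1, hlA1⟩ := hv2
      obtain ⟨A, hA, hmin⟩ := exists_min_image (St (s+1) v) l ⟨A1, hA1⟩
      have hA' := (mem_filter.mp hA).2
      refine ⟨A, mem_Gl.mpr ⟨hA'.1, ?_⟩, hA'.2, ?_⟩
      · have : (l A : ℕ) ≤ l A1 := hmin A1 hA1
        omega
      · refine mem_filter.mpr ⟨mem_univ _, hA'.1, Or.inr ⟨v, hA'.2, hv, ?_⟩⟩
        intro A' h1 h2
        exact hmin A' (mem_filter.mpr ⟨mem_univ _, h1, h2⟩)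
    · rw [mem_Iso_iff] at hv
      push Not at hv
      obtain ⟨A, hA, hlA⟩ := hv
      have hA' := (mem_filter.mp hA).2
      exact ⟨A, mem_Gl.mpr ⟨hA'.1, by omega⟩, hA'.2, mem_filter.mpr ⟨mem_univ _, hA'.1, Or.inl hlA⟩⟩
  choose e he1 he2 he3 using hexe
  have hk0 : 0 < k * (j0 + 2) := by positivity
  obtain ⟨M, hM, hMs, hMc, hMr⟩ := construct (G0 := G0) (G2 := G2) (r := s+1) (k := k) (j0 := j0) (l := lm)
    (xb := xb) (sb := sb) (yb := yb) (by omega) hk (fun A hA => (mem_Gl.mp hA).1) hsub V0 R1 R2 h01 h02 h12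
    Sm (V0 ∩ Bad) (by
      intro v hv
      by_contra h
      exact hv (mem_filter.mpr ⟨mem_univ _, by omega⟩)) inter_subset_left (by
      intro v hv hvB
      by_contra h
      exact hvB (mem_inter.mpr ⟨hv, mem_filter.mpr ⟨mem_univ _, by omega⟩⟩))
    e (fun v _ => ⟨he1 v, he2 v⟩) (by simpa using hE) hlm (by
      intro F hF h4 hv
      by_contra h
      exact hS ⟨#F, mem_range.mpr (by omega), F, hF, rfl, by simpa using hv, by omega⟩) (by
      intro F hF hj hv
      by_contra h
      refine hB2 ⟨F, hF.trans hsub, hj, by rw [← hj]; simpa using hv, ?_⟩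
      push Not at h
      refine h.trans (card_le_card ?_)
      exact inter_subset_inter_left inter_subset_right)
    ((card_le_card inter_subset_right).trans hBadc) hSmc hBulk hLev hyb
  refine ⟨M, hM, ?_, ?_, by omega⟩
  · intro A hA
    rcases mem_union.mp (hMs hA) with h | h
    · have := mem_Gl.mp h
      exact mem_filter.mpr ⟨mem_univ _, this.1, Or.inl this.2⟩
    · obtain ⟨v, -, rfl⟩ := mem_image.mp h
      exact he3 v
  · refine union_subset (subset_union_left.trans hMc) (Subset.trans ?_ (subset_union_right.trans hMc))
    intro v hv
    refine mem_filter.mpr ⟨mem_univ _, ?_⟩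
    have : lk G0 v V0 = ∅ := by
      rw [eq_empty_iff_forall_notMem]
      intro A hA
      have hA := mem_lk.mp hA
      exact (mem_filter.mp hv).2 A hA.1 hA.2.1
    rw [this]; simpa using hk0
end partH

section partI1
open Filter Topology

lemma choose_low (a s : ℕ) (hs : s ≤ a) : ((a:ℝ) + 1 - s) ^ s ≤ (a.choose s : ℝ) * s.factorial := by
  have h := Nat.pow_sub_le_descFactorial a s
  rw [Nat.descFactorial_eq_factorial_mul_choose] at h
  have h2 : ((a + 1 - s : ℕ) : ℝ) = (a:ℝ) + 1 - s := by
    rw [Nat.cast_sub (by omega)]; push_cast; ring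
  rw [← h2, mul_comm]; exact_mod_cast h

lemma choose_up (n s : ℕ) : ((n-1).choose s : ℝ) * s.factorial ≤ (n:ℝ) ^ s := by
  have h := Nat.descFactorial_le_pow (n-1) s
  rw [Nat.descFactorial_eq_factorial_mul_choose] at h
  have h2 : (n-1)^s ≤ n^s := Nat.pow_le_pow_left (by omega) s
  rw [mul_comm]; exact_mod_cast h.trans h2

lemma D_low (n s : ℕ) (hn : 2 * s + 1 ≤ n) : (n:ℝ)^s ≤ (2^s * s.factorial) * ((n-1).choose s : ℝ) := by
  have h := choose_low (n-1) s (by omega)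
  have h2 : ((n - 1 : ℕ) : ℝ) = (n:ℝ) - 1 := by rw [Nat.cast_sub (by omega)]; push_cast; ring
  rw [h2] at h
  have hn' : (2:ℝ) * s + 1 ≤ n := by exact_mod_cast hn
  calc (n:ℝ)^s = 2^s * ((n:ℝ)/2)^s := by rw [← mul_pow]; congr 1; ring
    _ ≤ 2^s * ((n:ℝ) - 1 + 1 - s)^s := by gcongr; linarith
    _ ≤ 2^s * (((n-1).choose s : ℝ) * s.factorial) := by gcongr
    _ = _ := by ring

lemma p0_lower (n s a L : ℕ) (hn : 2 * s + 1 ≤ n) (α : ℝ) (hα : 0 ≤ α) (hs : s ≤ a)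
    (h : α * n ≤ (a:ℝ) + 1 - s) :
    3/4 * L * α ^ s ≤ 3 * L / (4 * ((n-1).choose s : ℝ)) * (a.choose s : ℝ) := by
  have hD : (0:ℝ) < ((n-1).choose s : ℝ) := by exact_mod_cast Nat.choose_pos (by omega)
  have hn0 : (0:ℝ) < n := by exact_mod_cast (by omega : 0 < n)
  have h1 := choose_low a s hs
  have h2 := choose_up n s
  have hf : (0:ℝ) < s.factorial := by exact_mod_cast Nat.factorial_pos s
  have h3 : α ^ s * ((n-1).choose s : ℝ) ≤ (a.choose s : ℝ) := by
    have : α ^ s * (((n-1).choose s : ℝ) * s.factorial) ≤ (a.choose s : ℝ) * s.factorial := by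
      calc _ ≤ α ^ s * (n:ℝ)^s := by gcongr
        _ = (α * n)^s := by rw [mul_pow]
        _ ≤ ((a:ℝ) + 1 - s)^s := by gcongr
        _ ≤ _ := h1
    rw [← mul_assoc] at this
    exact le_of_mul_le_mul_right this hf
  have : 3 * (L:ℝ) / (4 * ((n-1).choose s : ℝ)) * (a.choose s : ℝ) =
    3/4 * L * ((a.choose s : ℝ) / ((n-1).choose s : ℝ)) := by field_simp
  rw [this]
  gcongr
  rw [le_div_iff₀ hD]; exact h3

lemma p0_bulk (n s xb L : ℕ) (hn : 2 * s + 1 ≤ n) (y : ℝ) (hy : 0 ≤ y) (hs : s + 1 ≤ xb)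
    (h : y * n ≤ (xb:ℝ) - s) :
    3/4 * L * (n * y ^ (s+1)) / (s+1) ≤ 3 * L / (4 * ((n-1).choose s : ℝ)) * (xb.choose (s+1) : ℝ) := by
  have hD : (0:ℝ) < ((n-1).choose s : ℝ) := by exact_mod_cast Nat.choose_pos (by omega)
  have hn0 : (0:ℝ) < n := by exact_mod_cast (by omega : 0 < n)
  have h1 := choose_low xb (s+1) hs
  have h2 := choose_up n s
  have hf : (0:ℝ) < s.factorial := by exact_mod_cast Nat.factorial_pos s
  have h3 : (n * y ^ (s+1)) / (s+1) * ((n-1).choose s : ℝ) ≤ (xb.choose (s+1) : ℝ) := by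
    have e : ((s+1).factorial : ℝ) = (s+1) * s.factorial := by rw [Nat.factorial_succ]; push_cast; ring
    rw [e] at h1
    have : n * y ^ (s+1) * (((n-1).choose s : ℝ) * s.factorial) ≤ (xb.choose (s+1) : ℝ) * ((s+1) * s.factorial) := by
      calc _ ≤ n * y ^ (s+1) * (n:ℝ)^s := by gcongr
        _ = (y * n)^(s+1) := by rw [mul_pow]; ring
        _ ≤ ((xb:ℝ) + 1 - (s+1:ℕ))^(s+1) := by gcongr; push_cast; linarith
        _ ≤ _ := h1
    rw [div_mul_eq_mul_div, div_le_iff₀ (by positivity)]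
    rw [← mul_assoc, ← mul_assoc] at this
    exact le_of_mul_le_mul_right this hf
  have : 3 * (L:ℝ) / (4 * ((n-1).choose s : ℝ)) * (xb.choose (s+1) : ℝ) =
    3/4 * L * ((xb.choose (s+1) : ℝ) / ((n-1).choose s : ℝ)) := by field_simp
  rw [this, mul_div_assoc]
  apply mul_le_mul_of_nonneg_left _ (by positivity)
  rw [le_div_iff₀ hD]; exact h3

/-- upper bound for c L / D -/
lemma p_upper (n s : ℕ) (hn : 2 * s + 1 ≤ n) (t : ℝ) (ht : 0 ≤ t) :
    t / ((n-1).choose s : ℝ) ≤ t * (2^s * s.factorial) / (n:ℝ)^s := by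
  have hD : (0:ℝ) < ((n-1).choose s : ℝ) := by exact_mod_cast Nat.choose_pos (by omega)
  have hn0 : (0:ℝ) < n := by exact_mod_cast (by omega : 0 < n)
  rw [div_le_div_iff₀ hD (by positivity), mul_assoc]
  gcongr
  exact D_low n s hn

noncomputable def Lg (n : ℕ) : ℕ := ⌊Real.log n⌋₊

noncomputable def ug (s n : ℕ) : ℝ := ((Lg n : ℕ) : ℝ) ^ (((4 * (s+1) : ℕ) : ℝ)⁻¹)

lemma ug_pow (s n : ℕ) : ug s n ^ (4 * (s+1)) = Lg n := by
  unfold ug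
  exact Real.rpow_inv_natCast_pow (by positivity) (by omega)

lemma Lg_tendsto : Tendsto (fun n => (Lg n : ℝ)) atTop atTop := by
  unfold Lg
  exact tendsto_natCast_atTop_atTop.comp (tendsto_nat_floor_atTop.comp
    (Real.tendsto_log_atTop.comp tendsto_natCast_atTop_atTop))

lemma ug_tendsto (s : ℕ) : Tendsto (fun n => ug s n) atTop atTop := by
  unfold ug
  exact (tendsto_rpow_atTop (by positivity)).comp Lg_tendsto

lemma Lg_le (n : ℕ) (hn : 1 ≤ n) : Real.exp (Lg n) ≤ n := by
  have hn' : (1:ℝ) ≤ n := by exact_mod_cast hn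
  have : (Lg n : ℝ) ≤ Real.log n := Nat.floor_le (Real.log_nonneg hn')
  calc _ ≤ Real.exp (Real.log n) := Real.exp_le_exp.mpr this
    _ = n := Real.exp_log (by linarith)

lemma Lg_ge (n : ℕ) (hn : 1 ≤ n) : (n:ℝ) ≤ Real.exp 1 * Real.exp (Lg n) := by
  have hn' : (1:ℝ) ≤ n := by exact_mod_cast hn
  have : Real.log n ≤ (Lg n : ℝ) + 1 := (Nat.lt_floor_add_one _).le
  rw [← Real.exp_add, add_comm]
  calc (n:ℝ) = Real.exp (Real.log n) := (Real.exp_log (by linarith)).symm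
    _ ≤ _ := Real.exp_le_exp.mpr this

/-- polynomial times exponential decay -/
lemma poly_exp (c C : ℝ) (hc : 0 < c) (k : ℕ) (ε : ℝ) (hε : 0 < ε) :
    ∀ᶠ n : ℕ in atTop, C * (Lg n : ℝ) ^ k * Real.exp (-(c * Lg n)) ≤ ε := by
  have h1 : Tendsto (fun x : ℝ => x ^ k * Real.exp (-x)) atTop (𝓝 0) := Real.tendsto_pow_mul_exp_neg_atTop_nhds_zero k
  have h2 : Tendsto (fun n : ℕ => c * (Lg n : ℝ)) atTop atTop := Lg_tendsto.const_mul_atTop hc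
  have h3 := (h1.comp h2).const_mul (C / c ^ k)
  rw [mul_zero] at h3
  filter_upwards [h3.eventually (gt_mem_nhds hε)] with n hn
  refine le_of_eq_of_le ?_ hn.le
  simp only [Function.comp]
  rw [mul_pow]; field_simp

lemma log_ug (s : ℕ) (C ε : ℝ) (hε : 0 < ε) :
    ∀ᶠ n : ℕ in atTop, C * Real.log (ug s n) ≤ ε * ug s n := by
  have h1 : (fun x => C * Real.log x) =o[atTop] (fun x : ℝ => x) := Real.isLittleO_log_id_atTop.const_mul_left C
  filter_upwards [(ug_tendsto s).eventually (h1.bound hε), (ug_tendsto s).eventually_ge_atTop 0] with n hn h0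
  rw [Real.norm_eq_abs, Real.norm_eq_abs, abs_of_nonneg h0] at hn
  exact (le_abs_self _).trans hn

lemma n_over (s : ℕ) (C : ℝ) : ∀ᶠ n : ℕ in atTop, C * (ug s n ^ 2 * Lg n) ≤ n := by
  have := poly_exp 1 C one_pos 2 1 one_pos
  filter_upwards [this, (ug_tendsto s).eventually_ge_atTop 1, eventually_ge_atTop 1, poly_exp 1 |C| one_pos 2 1 one_pos] with n h1 h2 h3 h4
  have hL := ug_pow s n
  have h5 : ug s n ^ 2 ≤ (Lg n : ℝ) := by
    rw [← hL]; exact pow_le_pow_right₀ h2 (by omega)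
  have h6 := Lg_le n h3
  have hL0 : (0:ℝ) ≤ Lg n := by positivity
  rw [one_mul, Real.exp_neg, ← div_eq_mul_inv, div_le_one (Real.exp_pos _)] at h4
  calc C * (ug s n ^ 2 * Lg n) ≤ |C| * (Lg n * Lg n) := by
        apply mul_le_mul (le_abs_self C) _ (by positivity) (abs_nonneg _)
        gcongr
    _ = |C| * (Lg n : ℝ)^2 := by ring
    _ ≤ _ := h4.trans h6
end partI1

section partI2
open scoped Classical
variable {V : Type*} [Fintype V]

lemma few_bound {B b0 : ℕ} (hB : 0 < B) (h0 : b0 ≤ B) (s K a lm : ℕ) (hs : 1 ≤ s) (hlm : 1 ≤ lm)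
    (N0 : Finset V) (ha : a + 1 ≤ #N0) (θ : ℝ) (hθ : 0 < θ) (hθ1 : θ ≤ 1) :
    pr (fun l : Finset V → Fin B => ¬ #(univ.filter (fun v => #(lk (Gl (s+1) b0 l) v N0) < K)) ≤ lm) ≤
      (Fintype.card V * ((θ ^ K)⁻¹ * Real.exp (-((1 - θ) * ((b0:ℝ)/B) * (a.choose s : ℝ))))) / lm := by
  have hlm' : (0:ℝ) < lm := by exact_mod_cast hlm
  calc _ ≤ pr (fun l : Finset V → Fin B => (lm:ℝ) ≤ ∑ v : V, if #(lk (Gl (s+1) b0 l) v N0) < K then (1:ℝ) else 0) := by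
        apply pr_mono
        intro l h
        rw [← Finset.sum_filter, Finset.sum_const, nsmul_eq_mul, mul_one]
        exact_mod_cast (not_le.mp h).le
    _ ≤ ex (fun l : Finset V → Fin B => ∑ v : V, if #(lk (Gl (s+1) b0 l) v N0) < K then (1:ℝ) else 0) / lm := by
        apply pr_markov _ _ _ hlm'
        intro l; positivity
    _ ≤ _ := by
        gcongr
        rw [ex_sum]
        have : ∀ v : V, ex (fun l : Finset V → Fin B => if #(lk (Gl (s+1) b0 l) v N0) < K then (1:ℝ) else 0) ≤
            (θ ^ K)⁻¹ * Real.exp (-((1 - θ) * ((b0:ℝ)/B) * (a.choose s : ℝ))) := by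
          intro v
          rw [← pr_eq_ex]
          exact low_single hB h0 s K a hs v N0 ha θ hθ hθ1
        refine (Finset.sum_le_sum (fun v _ => this v)).trans ?_
        rw [Finset.sum_const, nsmul_eq_mul, card_univ]

lemma good_prob {s k j0 lm xb sb yb b0 b2 B a aV aR aL : ℕ} (hs : 2 ≤ s) (hk : 1 ≤ k) (hb0 : 0 < b0)
    (hb : b0 ≤ b2) (h2 : b2 < B)
    (V0 R1 R2 : Finset V) (h01 : Disjoint V0 R1) (h02 : Disjoint V0 R2) (h12 : Disjoint R1 R2)
    (hlm : 1 ≤ lm) (hsb : 1 ≤ sb) (hlmn : lm ≤ Fintype.card V)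
    (hyb : (s+1) * sb + (s+1) * xb ≤ yb) (ha : a + yb ≤ #R1)
    (haV : aV + (4 * s + 1) ≤ #V0) (haR : aR + (j0 * s + 1) ≤ #R2) (haL : aL + yb ≤ #R1)
    (hsm : (b0:ℝ)/B * (((k*(s-1)+(s+1)) * lm : ℕ) : ℝ) ^ s ≤ 1)
    (θ x y : ℝ) (hθ : 0 < θ) (hθ1 : θ ≤ 1) (hx : 0 < x) (hx1 : x ≤ 1) (hy : 0 < y) (hy1 : y ≤ 1) :
    pr (fun l : Finset V → Fin B => ¬ Good (s+1) b0 V0 a l) ≤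
      Fintype.card V * Real.exp (-((b2:ℝ)/B * ((Fintype.card V - 1).choose s : ℕ)))
      + (∑ j ∈ Icc 1 lm, (((Fintype.card V : ℝ) / j) ^ ((k*(s-1)+(s+1)) + 1) * Real.exp 3 *
        ((b0:ℝ)/B * (((k*(s-1)+(s+1)) * j : ℕ) : ℝ) ^ s) ^ k) ^ j)
      + (∑ f ∈ range 5, (Fintype.card V : ℝ) ^ (f*s+1) * 2 ^ (2 ^ (f*s+1)) * 2 ^ (f*s+1) * (((b2:ℝ)/B) ^ f *
        ((θ ^ (2 * (k*(j0+2))))⁻¹ * Real.exp (-((1 - θ) * ((b0:ℝ)/B) * (((2:ℕ) : ℝ) * (aV.choose s : ℝ)))))))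
      + ((Fintype.card V : ℝ) ^ (j0*s+1) * 2 ^ (2 ^ (j0*s+1)) * 2 ^ (j0*s+1) * (((b2:ℝ)/B) ^ j0 *
        ((θ ^ (j0 * (k*(j0+2))))⁻¹ * Real.exp (-((1 - θ) * ((b0:ℝ)/B) * ((j0 : ℝ) * (aR.choose s : ℝ)))))))
      + ((Fintype.card V * ((θ ^ (k*(j0+2)))⁻¹ * Real.exp (-((1 - θ) * ((b0:ℝ)/B) * (aR.choose s : ℝ))))) / lm)
      + ((Fintype.card V * ((θ ^ (k*(j0+2)))⁻¹ * Real.exp (-((1 - θ) * ((b0:ℝ)/B) * (aV.choose s : ℝ))))) / sb)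
      + (2 ^ (Fintype.card V) * Real.exp (-((b0:ℝ)/B * (xb.choose (s+1) : ℕ))))
      + (((x ^ lm)⁻¹ * Real.exp (x * Fintype.card V)) * ((y ^ yb)⁻¹ * Real.exp (y * Fintype.card V)) *
        Real.exp (-((b0:ℝ)/B * (lm * aL.choose s : ℕ)))) := by
  have hB : 0 < B := by omega
  have h0 : b0 ≤ B := by omega
  have T1 := iso_some (V := V) h2 s
  have T2 := exp_bound (V := V) hB h0 hb0 s k (k*(s-1)+(s+1)) lm (by omega) hlmn hsm
  have T3 : pr (fun l : Finset V → Fin B => ∃ f ∈ range 5, ∃ F ⊆ Gl (s+1) b2 l, #F = f ∧ #(vs F) ≤ f * s + 1 ∧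
        2 ≤ #(vs F ∩ univ.filter (fun v => #(lk (Gl (s+1) b0 l) v V0) < k*(j0+2)))) ≤ _ :=
    (pr_exists_le (range 5) _).trans (Finset.sum_le_sum (fun f hf =>
      cluster_bound (V := V) hB h0 h2.le s (k*(j0+2)) f 2 (f*s+1) aV (by omega) V0 (by
        have : f * s ≤ 4 * s := Nat.mul_le_mul_right s (by simp at hf; omega)
        omega) θ hθ hθ1))
  have T4 := cluster_bound (V := V) hB h0 h2.le s (k*(j0+2)) j0 j0 (j0*s+1) aR (by omega) R2 haR θ hθ hθ1
  have T5 := few_bound (V := V) hB h0 s (k*(j0+2)) aR lm (by omega) hlm R2 (by omega) θ hθ hθ1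
  have T6 := few_bound (V := V) hB h0 s (k*(j0+2)) aV sb (by omega) hsb V0 (by omega) θ hθ hθ1
  have T7 := bulk_bound (V := V) hB h0 (s+1) xb V0
  have T8 := lev_bound (V := V) hB h0 s lm yb aL (by omega) V0 R1 h01 haL x y hx hx1 hy hy1
  refine le_trans ?_ (add_le_add (add_le_add (add_le_add (add_le_add (add_le_add (add_le_add
    (add_le_add T1 T2) T3) T4) T5) T6) T7) T8)
  refine le_trans ?_ (add_le_add_left (add_le_add_left (add_le_add_left (add_le_add_left (add_le_add_left (add_le_add_left
    (pr_or_le _ _) _) _) _) _) _) _)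
  refine le_trans ?_ (add_le_add_left (add_le_add_left (add_le_add_left (add_le_add_left (add_le_add_left
    (pr_or_le _ _) _) _) _) _) _)
  refine le_trans ?_ (add_le_add_left (add_le_add_left (add_le_add_left (add_le_add_left
    (pr_or_le _ _) _) _) _) _)
  refine le_trans ?_ (add_le_add_left (add_le_add_left (add_le_add_left (pr_or_le _ _) _) _) _)
  refine le_trans ?_ (add_le_add_left (add_le_add_left (pr_or_le _ _) _) _)
  refine le_trans ?_ (add_le_add_left (pr_or_le _ _) _)
  refine le_trans ?_ (pr_or_le _ _)
  apply pr_mono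
  intro l h
  by_contra hc
  push Not at hc
  obtain ⟨⟨⟨⟨⟨⟨⟨c1, c2⟩, c3⟩, c4⟩, c5⟩, c6⟩, c7⟩, c8⟩ := hc
  refine h (good_of hs hk hb V0 R1 R2 h01 h02 h12 l c1 c2 hlm ?_ ?_ c5 c6 c7 c8 hyb ha)
  · rintro ⟨f, hf, F, hF, h1, h2, h3⟩
    have := c3 f hf F hF h1 h2
    omega
  · rintro ⟨F, hF, h1, h2, h3⟩
    have := c4 F hF h1 h2
    omega
end partI2

section partI3
open Filter Topology

noncomputable def P0 (s n : ℕ) : ℝ := 3 * Lg n / (4 * ((n-1).choose s : ℝ))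
noncomputable def P2 (s n : ℕ) : ℝ := 2 * Lg n / ((n-1).choose s : ℝ)
noncomputable def LM (s n : ℕ) : ℕ := ⌊(n:ℝ) / (ug s n * Lg n)⌋₊
noncomputable def XB (s n : ℕ) : ℕ := ⌈(n:ℝ) / (ug s n ^ 2)⌉₊
noncomputable def YB (s n : ℕ) : ℕ := (s+1) * LM s n + (s+1) * XB s n

lemma basic_ev (s : ℕ) : ∀ᶠ n : ℕ in atTop, 2 * s + 1 ≤ n ∧ (1:ℝ) ≤ Lg n ∧ 1 ≤ ug s n ∧ ug s n ≤ Lg n ∧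
    ((n:ℝ) / (2 * (ug s n * Lg n)) ≤ LM s n) ∧ ((LM s n : ℝ) ≤ n / (ug s n * Lg n)) ∧ 1 ≤ LM s n ∧
    LM s n ≤ n := by
  filter_upwards [eventually_ge_atTop (2*s+1), Lg_tendsto.eventually_ge_atTop 1,
    (ug_tendsto s).eventually_ge_atTop 1, n_over s 2] with n h1 h2 h3 h4
  have h5 : ug s n ≤ Lg n := by
    rw [← ug_pow s n]; exact le_self_pow₀ h3 (by omega)
  have hpos : 0 < ug s n * Lg n := by positivity
  have h6 : 2 * (ug s n * Lg n) ≤ n := by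
    refine le_trans ?_ h4
    have : ug s n ≤ ug s n ^ 2 := le_self_pow₀ h3 (by omega)
    gcongr
  have h7 : 2 ≤ (n:ℝ) / (ug s n * Lg n) := by rw [le_div_iff₀ hpos]; exact h6
  have h8 := Nat.lt_floor_add_one ((n:ℝ) / (ug s n * Lg n))
  have h9 := Nat.floor_le (a := (n:ℝ) / (ug s n * Lg n)) (by positivity)
  refine ⟨h1, h2, h3, h5, ?_, h9, ?_, ?_⟩
  · have : (n:ℝ) / (2 * (ug s n * Lg n)) = (n / (ug s n * Lg n)) / 2 := by field_simp
    rw [this]; unfold LM; linarith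
  · unfold LM; apply Nat.le_floor; push_cast; linarith
  · unfold LM; apply Nat.floor_le_of_le
    apply div_le_self (by positivity)
    nlinarith

lemma ev_T1 (s : ℕ) (ε : ℝ) (hε : 0 < ε) : ∀ᶠ n : ℕ in atTop,
    (n:ℝ) * Real.exp (-(P2 s n * ((n-1).choose s : ℕ))) ≤ ε := by
  filter_upwards [basic_ev s, poly_exp 1 (Real.exp 1) one_pos 0 ε hε] with n ⟨h1, _⟩ h2
  have hD : (0:ℝ) < ((n-1).choose s : ℝ) := by exact_mod_cast Nat.choose_pos (by omega)
  have : P2 s n * ((n-1).choose s : ℕ) = 2 * Lg n := by unfold P2; field_simp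
  rw [this]
  calc _ ≤ (Real.exp 1 * Real.exp (Lg n)) * Real.exp (-(2 * Lg n)) := by
        gcongr; exact Lg_ge n (by omega)
    _ = Real.exp 1 * Real.exp (-(1 * Lg n)) := by rw [mul_assoc, ← Real.exp_add]; ring_nf
    _ ≤ ε := by simpa using h2

lemma P0_up (s n : ℕ) (hn : 2 * s + 1 ≤ n) : P0 s n ≤ (2^s * s.factorial) * Lg n / (n:ℝ)^s := by
  have hD : (0:ℝ) < ((n-1).choose s : ℝ) := by exact_mod_cast Nat.choose_pos (by omega)
  have := p_upper n s hn (Lg n) (by positivity)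
  unfold P0
  calc _ ≤ (Lg n : ℝ) / ((n-1).choose s : ℝ) := by
        rw [div_le_div_iff₀ (by positivity) hD]
        have : (0:ℝ) ≤ Lg n * ((n-1).choose s : ℝ) := by positivity
        nlinarith
    _ ≤ _ := this
    _ = _ := by ring

lemma ev_hsm (s m : ℕ) (hs : 1 ≤ s) : ∀ᶠ n : ℕ in atTop, P0 s n * ((m * LM s n : ℕ) : ℝ) ^ s ≤ 1 := by
  filter_upwards [basic_ev s, (ug_tendsto s).eventually_ge_atTop ((2^s * s.factorial) * (m:ℝ)^s)] with n ⟨h1, h2, h3, h4, h5, h6, h7, h8⟩ h9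
  have hn : (0:ℝ) < n := by exact_mod_cast (by omega : 0 < n)
  calc P0 s n * ((m * LM s n : ℕ) : ℝ) ^ s ≤ ((2^s * s.factorial) * Lg n / (n:ℝ)^s) * (m * (n / (ug s n * Lg n)))^s := by
        push_cast
        gcongr
        exact P0_up s n h1
    _ = ((2^s * s.factorial) * (m:ℝ)^s) * (Lg n / (ug s n * Lg n)^s) := by
        rw [mul_pow, div_pow]; field_simp
    _ ≤ ((2^s * s.factorial) * (m:ℝ)^s) * (Lg n / (ug s n * Lg n)^1) := by
        gcongr
        nlinarith
    _ = ((2^s * s.factorial) * (m:ℝ)^s) / ug s n := by field_simp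
    _ ≤ 1 := by rw [div_le_one (by positivity)]; exact h9

lemma geo_le (w : ℝ) (h0 : 0 ≤ w) (h1 : w ≤ 1/2) (N : ℕ) : ∑ j ∈ Icc 1 N, w ^ j ≤ 2 * w := by
  have h : ∀ N, ∑ j ∈ Icc 1 N, w ^ j ≤ 2 * w - 2 * (w * w ^ N) ∧ 0 ≤ w^N := by
    intro N
    induction N with
    | zero => simp
    | succ N ih =>
      rw [Finset.sum_Icc_succ_top (by omega)]
      refine ⟨?_, by positivity⟩
      have h1' : w ^ (N+1) = w * w^N := by ring
      rw [h1']
      have : 0 ≤ w * w^N := by positivity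
      nlinarith [ih.1]
  have := h N
  have : 0 ≤ w * w^N := by positivity
  linarith [(h N).1]

lemma ev_T2 (s k : ℕ) (hs : 2 ≤ s) (hk : k = 4*(s+1)*(s+2)+s+3) (ε : ℝ) (hε : 0 < ε) : ∀ᶠ n : ℕ in atTop,
    (∑ j ∈ Icc 1 (LM s n), (((n : ℝ) / j) ^ ((k*(s-1)+(s+1)) + 1) * Real.exp 3 *
        (P0 s n * (((k*(s-1)+(s+1)) * j : ℕ) : ℝ) ^ s) ^ k) ^ j) ≤ ε := by
  set m := k*(s-1)+(s+1) with hm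
  set C : ℝ := Real.exp 3 * ((2^s * s.factorial) * (m:ℝ)^s) ^ k with hC
  have hC0 : 0 ≤ C := by positivity
  filter_upwards [basic_ev s, (ug_tendsto s).eventually_ge_atTop (2*C), (ug_tendsto s).eventually_ge_atTop (2*C/ε)] with n ⟨h1, h2, h3, h4, h5, h6, h7, h8⟩ h9 h10
  have hn : (0:ℝ) < n := by exact_mod_cast (by omega : 0 < n)
  have hu : 0 < ug s n := by linarith
  have key : ∀ j ∈ Icc 1 (LM s n), ((n : ℝ) / j) ^ (m + 1) * Real.exp 3 *
        (P0 s n * ((m * j : ℕ) : ℝ) ^ s) ^ k ≤ C / ug s n := by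
    intro j hj
    rw [mem_Icc] at hj
    have hj0 : (0:ℝ) < j := by exact_mod_cast hj.1
    have hjn : (j:ℝ) / n ≤ 1 / (ug s n * Lg n) := by
      rw [div_le_iff₀ hn, one_div_mul_eq_div]
      refine le_trans ?_ h6
      exact_mod_cast hj.2
    have hexp : s * k = (m + 1) + (k - s - 2) := by
      obtain ⟨t, rfl⟩ : ∃ t, s = t + 1 := ⟨s - 1, by omega⟩
      simp only [hm, Nat.add_sub_cancel]
      have : (t+1) + 2 ≤ k := by rw [hk]; nlinarith
      have e : (t+1)*k = k * t + k := by ring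
      omega
    have hk2 : k - s - 2 = 4*(s+1)*(s+2)+1 := by omega
    have hkk : k = (s + 2) + (k - s - 2) := by rw [hk2]; omega
    calc ((n : ℝ) / j) ^ (m + 1) * Real.exp 3 * (P0 s n * ((m * j : ℕ) : ℝ) ^ s) ^ k
        ≤ ((n : ℝ) / j) ^ (m + 1) * Real.exp 3 * (((2^s * s.factorial) * Lg n / (n:ℝ)^s) * ((m * j : ℕ) : ℝ) ^ s) ^ k := by
          gcongr
          · unfold P0; positivity
          · exact P0_up s n h1
      _ = C * (Lg n : ℝ)^k * (((n : ℝ) / j) ^ (m + 1) * ((j:ℝ)/n)^(s*k)) := by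
          rw [hC]; push_cast
          rw [pow_mul ((j:ℝ)/n)]
          simp only [mul_pow, div_pow]
          ring
      _ = C * (Lg n : ℝ)^k * ((j:ℝ)/n)^(k - s - 2) := by
          rw [hexp, pow_add ((j:ℝ)/n), ← mul_assoc (((n : ℝ) / j) ^ (m + 1)), ← mul_pow]
          rw [show (n:ℝ)/j * (j/n) = 1 by field_simp]; simp
      _ ≤ C * (Lg n : ℝ)^k * (1 / (ug s n * Lg n))^(k - s - 2) := by gcongr
      _ = C / ug s n := by
          have e1 : (Lg n : ℝ)^k = (Lg n : ℝ)^(s+2) * (Lg n : ℝ)^(k-s-2) := by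
            rw [← pow_add]; congr 1
          have e2 : (Lg n : ℝ)^(s+2) = ug s n ^ (4*(s+1)*(s+2)) := by rw [pow_mul, ug_pow]
          have e3 : (ug s n)^(k-s-2) = ug s n ^ (4*(s+1)*(s+2)) * ug s n := by rw [hk2, pow_succ]
          rw [e1, e2, one_div, inv_pow, mul_pow, e3]
          field_simp
  have hw : C / ug s n ≤ 1/2 := by rw [div_le_iff₀ hu]; linarith
  calc _ ≤ ∑ j ∈ Icc 1 (LM s n), (C / ug s n)^j := by
        apply Finset.sum_le_sum
        intro j hj
        apply pow_le_pow_left₀ _ (key j hj)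
        unfold P0; positivity
    _ ≤ 2 * (C / ug s n) := geo_le _ (by positivity) hw _
    _ ≤ ε := by
        rw [← mul_div_assoc, div_le_iff₀ hu]
        rw [div_le_iff₀ hε] at h10
        linarith

lemma ev_cluster (s f t : ℕ) (A1 A2 A3 κ θ ε : ℝ) (hε : 0 < ε) (hA1 : 0 ≤ A1) (hA2 : 0 ≤ A2) (hA3 : 0 ≤ A3)
    (hθ : θ ≤ 1) (hκ : 1.1 ≤ (1 - θ) * (t * κ)) (a : ℕ → ℕ)
    (ha : ∀ᶠ n : ℕ in atTop, κ * Lg n ≤ P0 s n * ((a n).choose s : ℝ)) :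
    ∀ᶠ n : ℕ in atTop, (n:ℝ)^(f*s+1) * A1 * A2 * (P2 s n ^ f * (A3 *
      Real.exp (-((1 - θ) * P0 s n * ((t:ℝ) * ((a n).choose s : ℝ)))))) ≤ ε := by
  set C : ℝ := A1 * A2 * A3 * (2 * (2^s * s.factorial))^f * Real.exp 1 with hC
  filter_upwards [basic_ev s, ha, poly_exp 0.1 C (by norm_num) f ε hε] with n ⟨h1, h2, _⟩ h3 h4
  have hn : (0:ℝ) < n := by exact_mod_cast (by omega : 0 < n)
  have hP2 : P2 s n ≤ (2 * (2^s * s.factorial)) * Lg n / (n:ℝ)^s := by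
    refine (p_upper n s h1 (2 * Lg n) (by positivity)).trans (le_of_eq ?_)
    ring
  have hP20 : 0 ≤ P2 s n := by unfold P2; positivity
  have hex : Real.exp (-((1 - θ) * P0 s n * ((t:ℝ) * ((a n).choose s : ℝ)))) ≤ Real.exp (-(1.1 * Lg n)) := by
    apply Real.exp_le_exp.mpr
    have : (1 - θ) * t * (κ * Lg n) ≤ (1 - θ) * t * (P0 s n * ((a n).choose s : ℝ)) := by
      apply mul_le_mul_of_nonneg_left h3
      apply mul_nonneg (by linarith) (by positivity)
    have h5 : 1.1 * (Lg n : ℝ) ≤ (1 - θ) * (t * κ) * Lg n := by gcongr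
    nlinarith
  calc _ ≤ (n:ℝ)^(f*s+1) * A1 * A2 * (((2 * (2^s * s.factorial)) * Lg n / (n:ℝ)^s) ^ f * (A3 *
        Real.exp (-(1.1 * Lg n)))) := by gcongr
    _ = A1 * A2 * A3 * (2 * (2^s * s.factorial))^f * (Lg n : ℝ)^f * ((n:ℝ) * Real.exp (-(1.1 * Lg n))) := by
        rw [div_pow, ← pow_mul, mul_comm s f, pow_succ, mul_pow]; field_simp
    _ ≤ A1 * A2 * A3 * (2 * (2^s * s.factorial))^f * (Lg n : ℝ)^f * ((Real.exp 1 * Real.exp (Lg n)) * Real.exp (-(1.1 * Lg n))) := by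
        gcongr; exact Lg_ge n (by omega)
    _ = C * (Lg n : ℝ)^f * Real.exp (-(0.1 * Lg n)) := by
        rw [mul_assoc (Real.exp 1), ← Real.exp_add, hC, show (Lg n : ℝ) + -(1.1 * Lg n) = -(0.1 * Lg n) by ring]
        ring
    _ ≤ ε := h4

lemma ev_few (s : ℕ) (A κ θ ε : ℝ) (hε : 0 < ε) (hA : 0 ≤ A)
    (hθ : θ ≤ 1) (hκ : 0 < (1 - θ) * κ) (a : ℕ → ℕ)
    (ha : ∀ᶠ n : ℕ in atTop, κ * Lg n ≤ P0 s n * ((a n).choose s : ℝ)) :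
    ∀ᶠ n : ℕ in atTop, ((n:ℝ) * (A * Real.exp (-((1 - θ) * P0 s n * ((a n).choose s : ℝ))))) / LM s n ≤ ε := by
  filter_upwards [basic_ev s, ha, poly_exp ((1-θ)*κ) (2*A) hκ 2 ε hε] with n ⟨h1, h2, h3, h4, h5, h6, h7, h8⟩ h9 h10
  have hn : (0:ℝ) < n := by exact_mod_cast (by omega : 0 < n)
  have hex : Real.exp (-((1 - θ) * P0 s n * ((a n).choose s : ℝ))) ≤ Real.exp (-((1-θ)*κ * Lg n)) := by
    apply Real.exp_le_exp.mpr
    have : (1 - θ) * (κ * Lg n) ≤ (1 - θ) * (P0 s n * ((a n).choose s : ℝ)) :=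
      mul_le_mul_of_nonneg_left h9 (by linarith)
    linarith
  have hl : (0:ℝ) < LM s n := by exact_mod_cast h7
  rw [div_le_iff₀ hl]
  have hu : 0 < ug s n := by linarith
  calc _ ≤ (n:ℝ) * (A * Real.exp (-((1-θ)*κ * Lg n))) := by gcongr
    _ = (2 * A * (ug s n * Lg n) * Real.exp (-((1-θ)*κ * Lg n))) * ((n:ℝ) / (2 * (ug s n * Lg n))) := by
        field_simp
    _ ≤ (2 * A * (Lg n)^2 * Real.exp (-((1-θ)*κ * Lg n))) * LM s n := by
        gcongr
        nlinarith
    _ ≤ ε * LM s n := by gcongr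

lemma exp_neg_ev (ε : ℝ) (hε : 0 < ε) : ∀ᶠ n : ℕ in atTop, Real.exp (-(Lg n:ℝ)) ≤ ε := by
  simpa using poly_exp 1 1 one_pos 0 ε hε

lemma ev_T7 (s : ℕ) (ε : ℝ) (hε : 0 < ε) : ∀ᶠ n : ℕ in atTop,
    (2:ℝ) ^ n * Real.exp (-(P0 s n * ((XB s n).choose (s+1) : ℕ))) ≤ ε := by
  set c : ℝ := 3/4 / (2^(s+1) * (s+1)) with hc
  have hc0 : 0 < c := by positivity
  filter_upwards [basic_ev s, (ug_tendsto s).eventually_ge_atTop (2/c), n_over s (2*(s+1)), exp_neg_ev ε hε] with n ⟨h1, h2, h3, h4, _⟩ h5 h6 h7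
  have hn : (0:ℝ) < n := by exact_mod_cast (by omega : 0 < n)
  have hu : 0 < ug s n := by linarith
  have hX : (n:ℝ) / ug s n ^ 2 ≤ XB s n := Nat.le_ceil _
  have h8 : 2 * ((s:ℝ)+1) ≤ n / ug s n ^ 2 := by
    rw [le_div_iff₀ (by positivity)]
    refine le_trans ?_ h6
    have : ug s n ^ 2 ≤ ug s n ^ 2 * Lg n := by nlinarith [sq_nonneg (ug s n)]
    gcongr
  have hxs : s + 1 ≤ XB s n := by
    have : ((s+1:ℕ):ℝ) ≤ XB s n := by push_cast; nlinarith
    exact_mod_cast this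
  have hb := p0_bulk n s (XB s n) (Lg n) h1 (1/(2*ug s n^2)) (by positivity) hxs (by
    have : 1/(2*ug s n^2) * (n:ℝ) = (n / ug s n ^ 2)/2 := by field_simp
    rw [this]; linarith)
  have h9 : 2 * (n:ℝ) ≤ P0 s n * ((XB s n).choose (s+1) : ℕ) := by
    refine le_trans ?_ hb
    have e : 3/4 * (Lg n:ℝ) * (n * (1/(2*ug s n^2))^(s+1)) / (s+1) = c * ug s n^(2*(s+1)) * n := by
      rw [← ug_pow s n, hc, div_pow, mul_pow, ← pow_mul, show 4*(s+1) = 2*(s+1) + 2*(s+1) by ring, pow_add, one_pow]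
      field_simp
    rw [e]
    have h10 : ug s n ≤ ug s n^(2*(s+1)) := le_self_pow₀ h3 (by omega)
    have h11 : 2 ≤ c * ug s n := by rw [div_le_iff₀ hc0] at h5; linarith
    gcongr
    nlinarith
  have h12 : (Lg n:ℝ) ≤ n := by
    have := Lg_le n (by omega)
    linarith [Real.add_one_le_exp (Lg n:ℝ)]
  calc _ ≤ (Real.exp 1)^n * Real.exp (-(2 * (n:ℝ))) := by
        gcongr
        linarith [Real.add_one_le_exp 1]
    _ = Real.exp (-n) := by rw [← Real.exp_nat_mul, ← Real.exp_add]; ring_nf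
    _ ≤ Real.exp (-(Lg n:ℝ)) := Real.exp_le_exp.mpr (by linarith)
    _ ≤ ε := h7

lemma YB_up (s : ℕ) : ∀ᶠ n : ℕ in atTop, (YB s n : ℝ) ≤ 3*(s+1) * (n / ug s n^2) := by
  filter_upwards [basic_ev s, n_over s 1] with n ⟨h1, h2, h3, h4, h5, h6, h7, h8⟩ h9
  have hn : (0:ℝ) < n := by exact_mod_cast (by omega : 0 < n)
  have hu : 0 < ug s n := by linarith
  have hX : (XB s n : ℝ) ≤ n / ug s n ^ 2 + 1 := (Nat.ceil_lt_add_one (by positivity)).le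
  have h10 : 1 ≤ (n:ℝ) / ug s n ^ 2 := by
    rw [le_div_iff₀ (by positivity)]
    nlinarith [sq_nonneg (ug s n)]
  have h11 : (n:ℝ) / (ug s n * Lg n) ≤ n / ug s n ^ 2 := by
    gcongr; rw [sq]; gcongr
  unfold YB; push_cast
  have hs : (0:ℝ) ≤ s := by positivity
  have : (LM s n : ℝ) + XB s n ≤ 3 * (n / ug s n ^ 2) := by linarith
  nlinarith

lemma ev_T8 (s : ℕ) (κ ε : ℝ) (hε : 0 < ε) (hκ : 0 < κ) (a : ℕ → ℕ)
    (ha : ∀ᶠ n : ℕ in atTop, κ * Lg n ≤ P0 s n * ((a n).choose s : ℝ)) :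
    ∀ᶠ n : ℕ in atTop, (((1/ug s n^2) ^ (LM s n))⁻¹ * Real.exp ((1/ug s n^2) * n)) *
      (((1/ug s n^2) ^ (YB s n))⁻¹ * Real.exp ((1/ug s n^2) * n)) *
        Real.exp (-(P0 s n * (LM s n * (a n).choose s : ℕ))) ≤ ε := by
  filter_upwards [basic_ev s, ha, YB_up s, log_ug s (2 + 6*(s+1)) (κ/4) (by positivity),
    (ug_tendsto s).eventually_ge_atTop (12/κ), n_over s 1, exp_neg_ev ε hε] with n ⟨h1, h2, h3, h4, h5, h6, h7, h8⟩ h9 h10 h11 h12 h13 h14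
  have hn : (0:ℝ) < n := by exact_mod_cast (by omega : 0 < n)
  have hu : 0 < ug s n := by linarith
  have hlog : 0 ≤ Real.log (ug s n) := Real.log_nonneg h3
  set w := (n:ℝ) / ug s n ^ 2 with hw
  have hw0 : 0 ≤ w := by positivity
  have hinv : ∀ N : ℕ, ((1/ug s n^2) ^ N)⁻¹ = Real.exp (N * (2 * Real.log (ug s n))) := by
    intro N
    rw [Real.exp_nat_mul, ← inv_pow, one_div, inv_inv]
    congr 1
    rw [show 2 * Real.log (ug s n) = Real.log (ug s n) + Real.log (ug s n) by ring, Real.exp_add, Real.exp_log hu, sq]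
  rw [hinv, hinv, ← Real.exp_add, ← Real.exp_add, ← Real.exp_add, ← Real.exp_add]
  refine le_trans (Real.exp_le_exp.mpr ?_) h14
  have e1 : (1/ug s n^2) * (n:ℝ) = w := by rw [hw]; ring
  rw [e1]
  have h15 : (LM s n : ℝ) ≤ w := by
    refine h6.trans ?_
    rw [hw]; gcongr; rw [sq]; gcongr
  have h16 : κ * w * ug s n / 2 ≤ P0 s n * (LM s n * (a n).choose s : ℕ) := by
    push_cast
    calc κ * w * ug s n / 2 = (κ * Lg n) * ((n:ℝ) / (2 * (ug s n * Lg n))) := by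
          rw [hw]; field_simp
      _ ≤ (P0 s n * ((a n).choose s : ℝ)) * LM s n := by
          apply mul_le_mul h9 h5 (by positivity)
          exact le_trans (by positivity) h9
      _ = _ := by ring
  have h17 : (LM s n : ℝ) * (2 * Real.log (ug s n)) ≤ w * (2 * Real.log (ug s n)) := by gcongr
  have h18 : (YB s n : ℝ) * (2 * Real.log (ug s n)) ≤ (3*(s+1) * w) * (2 * Real.log (ug s n)) := by gcongr
  have h19 : w * ((2 + 6*(s+1)) * Real.log (ug s n)) ≤ w * (κ/4 * ug s n) := by gcongr
  have h20 : 3 ≤ κ * ug s n / 4 := by rw [div_le_iff₀ hκ] at h12; linarith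
  have h21 : w * 3 ≤ w * (κ * ug s n / 4) := by gcongr
  have h22 : (Lg n : ℝ) ≤ w := by rw [hw, le_div_iff₀ (by positivity)]; linarith
  nlinarith
end partI3

section partI4
open Filter Topology
open scoped Classical

lemma lin_ev (c C : ℝ) (hc : 0 < c) : ∀ᶠ n : ℕ in atTop, C ≤ c * n :=
  (tendsto_natCast_atTop_atTop.const_mul_atTop hc).eventually_ge_atTop C

lemma floor_low (s : ℕ) (α : ℝ) (hα : 0 ≤ α) : ∀ᶠ n : ℕ in atTop,
    (3/4 * α^s) * Lg n ≤ P0 s n * (((⌊α * n⌋₊ + s : ℕ)).choose s : ℝ) := by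
  filter_upwards [basic_ev s] with n ⟨h1, _⟩
  have := p0_lower n s (⌊α * n⌋₊ + s) (Lg n) h1 α hα (by omega) (by
    push_cast
    have := (Nat.lt_floor_add_one (α * n)).le
    linarith)
  unfold P0
  refine le_trans (le_of_eq ?_) this
  ring

set_option maxHeartbeats 4000000 in
lemma good_ev (s q : ℕ) (hs : 2 ≤ s) (hq : 1 ≤ q) (ε : ℝ) (hε : 0 < ε) : ∀ᶠ n : ℕ in atTop,
    ∀ (V : Type) [Fintype V], Fintype.card V = n → ∀ (B b0 b2 a : ℕ), 0 < b0 → b0 ≤ b2 → b2 < B →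
    (b0:ℝ)/B = P0 s n → (b2:ℝ)/B = P2 s n → ∀ (V0 R1 R2 : Finset V), Disjoint V0 R1 → Disjoint V0 R2 →
    Disjoint R1 R2 → (1 - 1/(20*(s:ℝ))) * n ≤ #V0 → (n:ℝ)/(2*q) ≤ #R1 → (n:ℝ)/(2*q) ≤ #R2 →
    (a:ℝ) ≤ n/(4*q) →
    pr (fun l : Finset V → Fin B => ¬ Good (s+1) b0 V0 a l) ≤ ε := by
  have hs' : (2:ℝ) ≤ s := by exact_mod_cast hs
  have hq' : (1:ℝ) ≤ q := by exact_mod_cast hq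
  obtain ⟨k, hk⟩ : ∃ k, k = 4*(s+1)*(s+2)+s+3 := ⟨_, rfl⟩
  set κR : ℝ := 3/4 * (1/(4*q))^s with hκR
  have hκR0 : 0 < κR := by positivity
  obtain ⟨j0, hj0⟩ := exists_nat_ge (2 / κR)
  rw [div_le_iff₀ hκR0] at hj0
  set αV : ℝ := 1 - 2 * (1/(20*(s:ℝ))) with hαV
  have hβ : 1/(20*(s:ℝ)) ≤ 1/40 := by
    apply one_div_le_one_div_of_le <;> linarith
  have hβ0 : 0 < 1/(20*(s:ℝ)) := by positivity
  have hαV0 : 0 ≤ αV := by linarith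
  have hαVs : 0.9 ≤ αV ^ s := by
    have := one_add_mul_le_pow (a := -(2 * (1/(20*(s:ℝ))))) (by linarith) s
    rw [← sub_eq_add_neg, ← hαV] at this
    have e : (1:ℝ) + s * -(2 * (1/(20*(s:ℝ)))) = 0.9 := by field_simp; norm_num
    linarith
  set κV : ℝ := 3/4 * αV^s with hκV
  have hκV0 : 0.675 ≤ κV := by rw [hκV]; linarith
  have fV := floor_low s αV hαV0
  have fR := floor_low s (1/(4*q)) (by positivity)
  have E1 := ev_T1 s (ε/12) (by positivity)
  have E2 := ev_T2 s k hs hk (ε/12) (by positivity)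
  have E3 : ∀ᶠ n : ℕ in atTop, ∀ f ∈ range 5, (n:ℝ)^(f*s+1) * 2 ^ (2 ^ (f*s+1)) * 2 ^ (f*s+1) * (P2 s n ^ f * ((((1/10:ℝ)) ^ (2 * (k*(j0+2))))⁻¹ *
      Real.exp (-((1 - (1/10:ℝ)) * P0 s n * (((2:ℕ):ℝ) * ((⌊αV * n⌋₊ + s).choose s : ℝ)))))) ≤ ε/12 := by
    rw [Filter.eventually_all_finset]
    intro f _
    exact ev_cluster s f 2 _ _ _ κV (1/10) (ε/12) (by positivity) (by positivity) (by positivity) (by positivity)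
      (by norm_num) (by push_cast; linarith) (fun n => ⌊αV * n⌋₊ + s) fV
  have E4 := ev_cluster s j0 j0 (2 ^ (2 ^ (j0*s+1))) (2 ^ (j0*s+1)) ((((1/10:ℝ)) ^ (j0 * (k*(j0+2))))⁻¹) κR (1/10) (ε/12) (by positivity) (by positivity) (by positivity) (by positivity)
      (by norm_num) (by linarith) (fun n => ⌊1/(4*(q:ℝ)) * n⌋₊ + s) fR
  have E5 := ev_few s (((1/10:ℝ) ^ (k*(j0+2)))⁻¹) κR (1/10) (ε/12) (by positivity) (by positivity) (by norm_num)
    (by linarith) (fun n => ⌊1/(4*(q:ℝ)) * n⌋₊ + s) fR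
  have E6 := ev_few s (((1/10:ℝ) ^ (k*(j0+2)))⁻¹) κV (1/10) (ε/12) (by positivity) (by positivity) (by norm_num)
    (by linarith) (fun n => ⌊αV * n⌋₊ + s) fV
  have E7 := ev_T7 s (ε/12) (by positivity)
  have E8 := ev_T8 s κR (ε/12) (by positivity) hκR0 (fun n => ⌊1/(4*(q:ℝ)) * n⌋₊ + s) fR
  have hq4 : 0 < 1/(4*(q:ℝ)) := by positivity
  filter_upwards [E1, E2, E3, E4, E5, E6, E7, E8, basic_ev s, ev_hsm s (k*(s-1)+(s+1)) (by omega), YB_up s,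
    lin_ev (1/(20*(s:ℝ))) (5*s+1) hβ0, lin_ev (1/(4*(q:ℝ))) (s + j0*s+1) hq4,
    lin_ev (1/(8*(q:ℝ))) s (by positivity), (ug_tendsto s).eventually_ge_atTop (24*(s+1)*q)]
    with n e1 e2 e3 e4 e5 e6 e7 e8 ⟨h1, h2, h3, h4, h5, h6, h7, h8⟩ hsm hYB l1 l2 l3 hu24
  intro V _ hcard B b0 b2 a hb0 hb hb2 hp0 hp2 V0 R1 R2 h01 h02 h12 hV0 hR1 hR2 ha
  have hn : (0:ℝ) < n := by exact_mod_cast (by omega : 0 < n)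
  have hu : 0 < ug s n := by linarith
  have hY8 : (YB s n : ℝ) ≤ 1/(8*(q:ℝ)) * n := by
    refine hYB.trans ?_
    have : 24*((s:ℝ)+1)*q ≤ ug s n ^ 2 := hu24.trans (le_self_pow₀ h3 (by omega))
    rw [← mul_div_assoc, div_le_iff₀ (by positivity), one_div_mul_eq_div, div_mul_eq_mul_div, le_div_iff₀ (by positivity)]
    nlinarith
  have eq1 : (n:ℝ)/(2*q) = 2 * (1/(4*(q:ℝ)) * n) := by field_simp; norm_num
  have eq2 : (n:ℝ)/(4*q) = 1/(4*(q:ℝ)) * n := by field_simp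
  have eq3 : 1/(8*(q:ℝ)) * n = (1/(4*(q:ℝ)) * n)/2 := by field_simp; norm_num
  have hfR := Nat.floor_le (a := 1/(4*(q:ℝ)) * n) (by positivity)
  have hfV := Nat.floor_le (a := αV * n) (by positivity)
  have G := good_prob (V := V) (s := s) (k := k) (j0 := j0) (lm := LM s n) (xb := XB s n) (sb := LM s n)
    (yb := YB s n) (b0 := b0) (b2 := b2) (B := B) (a := a) (aV := ⌊αV * n⌋₊ + s) (aR := ⌊1/(4*(q:ℝ)) * n⌋₊ + s)
    (aL := ⌊1/(4*(q:ℝ)) * n⌋₊ + s) hs (by omega) hb0 hb hb2 V0 R1 R2 h01 h02 h12 h7 h7 (by rw [hcard]; exact h8)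
    le_rfl
    (by
      have : (a:ℝ) + YB s n ≤ #R1 := by linarith
      exact_mod_cast this)
    (by
      have : (⌊αV * n⌋₊:ℝ) + s + (4 * s + 1) ≤ #V0 := by
        have : αV * n = (1 - 1/(20*(s:ℝ))) * n - 1/(20*(s:ℝ)) * n := by rw [hαV]; ring
        linarith
      exact_mod_cast this)
    (by
      have : (⌊1/(4*(q:ℝ)) * n⌋₊:ℝ) + s + (j0 * s + 1) ≤ #R2 := by linarith
      exact_mod_cast this)
    (by
      have : (⌊1/(4*(q:ℝ)) * n⌋₊:ℝ) + s + YB s n ≤ #R1 := by linarith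
      exact_mod_cast this)
    (by rw [hp0]; exact hsm) (1/10) (1/ug s n^2) (1/ug s n^2) (by norm_num) (by norm_num) (by positivity)
    (by rw [div_le_one (by positivity)]; exact one_le_pow₀ h3) (by positivity)
    (by rw [div_le_one (by positivity)]; exact one_le_pow₀ h3)
  rw [hcard, hp0, hp2] at G
  refine G.trans ?_
  have e3' := Finset.sum_le_sum e3
  rw [Finset.sum_const, card_range, nsmul_eq_mul] at e3'
  push_cast at e3' e1 e2 e4 e5 e6 e7 e8 ⊢
  linarith
end partI4

section partJ1
open Filter Topology
open scoped Classical

lemma pr_equiv {Ω Ω' : Type*} [Fintype Ω] [Fintype Ω'] (e : Ω ≃ Ω') (P : Ω' → Prop) :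
    pr (fun w => P (e w)) = pr P := by
  rw [pr_eq_ex, pr_eq_ex, ← ex_equiv e]

lemma col_disj {V : Type*} [Fintype V] (q : ℕ) (hq : 3 ≤ q) (Q : Finset V) :
    pr (fun c : V → Fin q => Disjoint Q (univ.filter (fun v => 2 ≤ (c v : ℕ)))) ≤ (2/(q:ℝ))^#Q := by
  have := low_tail (α := V) (B := q) (b0 := 1) (b2 := 2) (by omega) (by omega) (by omega) Q ∅ (by simp) 1 one_pos le_rfl 0
  simp only [card_empty, filter_empty, le_refl, and_true, pow_zero, sub_self, zero_mul, neg_zero, Real.exp_zero, inv_one, mul_one] at this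
  refine le_trans (pr_mono ?_) (this.trans (by simp))
  intro c h A hA
  by_contra h2
  exact Finset.disjoint_left.mp h hA (by simp; omega)

lemma col_low {V : Type*} [Fintype V] (q : ℕ) (hq : 3 ≤ q) :
    pr (fun c : V → Fin q => ¬ ((Fintype.card V:ℝ)/(2*q) ≤ #(univ.filter (fun v => (c v : ℕ) = 0)))) ≤
      Real.exp (-(1/8 * (Fintype.card V / q))) := by
  set n := Fintype.card V with hn
  have hq' : (0:ℝ) < q := by exact_mod_cast (by omega : 0 < q)
  have := low_tail (α := V) (B := q) (b0 := 1) (b2 := 1) (by omega) (by omega) (by omega) ∅ univ (by simp) (1/2) (by norm_num) (by norm_num) ⌊(n:ℝ)/(2*q)⌋₊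
  simp only [card_empty, pow_zero, one_mul, notMem_empty, IsEmpty.forall_iff, implies_true, true_and, card_univ, Nat.lt_one_iff] at this
  refine le_trans (pr_mono ?_) (this.trans ?_)
  · intro c h
    exact Nat.le_floor (not_le.mp h).le
  · have h1 : (((1/2:ℝ))^⌊(n:ℝ)/(2*q)⌋₊)⁻¹ ≤ Real.exp (0.7 * ((n:ℝ)/(2*q))) := by
      rw [← inv_pow, one_div, inv_inv]
      have h2 : (2:ℝ) ≤ Real.exp 0.7 := by
        have : Real.exp (Real.log 2) ≤ Real.exp 0.7 := Real.exp_le_exp.mpr (by linarith [Real.log_two_lt_d9])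
        rwa [Real.exp_log (by norm_num)] at this
      calc _ ≤ (Real.exp 0.7)^⌊(n:ℝ)/(2*q)⌋₊ := by gcongr
        _ = Real.exp (⌊(n:ℝ)/(2*q)⌋₊ * 0.7) := by rw [Real.exp_nat_mul]
        _ ≤ _ := by
          apply Real.exp_le_exp.mpr
          have := Nat.floor_le (a := (n:ℝ)/(2*q)) (by positivity)
          linarith
    calc _ ≤ Real.exp (0.7 * ((n:ℝ)/(2*q))) * Real.exp (-((1 - 1/2) * (((1:ℕ):ℝ)/q) * n)) := by gcongr
      _ ≤ _ := by
        rw [← Real.exp_add]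
        apply Real.exp_le_exp.mpr
        have e1 : (n:ℝ)/(2*q) = (n/q)/2 := by field_simp
        have e2 : (1 - 1/2) * (((1:ℕ):ℝ)/q) * n = (n/q)/2 := by push_cast; field_simp; norm_num
        have : 0 ≤ (n:ℝ)/q := by positivity
        rw [e1, e2]; linarith

lemma col_low1 {V : Type*} [Fintype V] (q : ℕ) (hq : 3 ≤ q) :
    pr (fun c : V → Fin q => ¬ ((Fintype.card V:ℝ)/(2*q) ≤ #(univ.filter (fun v => (c v : ℕ) = 1)))) ≤
      Real.exp (-(1/8 * (Fintype.card V / q))) := by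
  refine le_trans (le_of_eq ?_) (col_low q hq)
  let e : (V → Fin q) ≃ (V → Fin q) := Equiv.arrowCongr (Equiv.refl V) (Equiv.swap ⟨0, by omega⟩ ⟨1, by omega⟩)
  rw [← pr_equiv e]
  congr 1
  funext c
  congr 3
  congr 1
  ext v
  simp only [mem_filter, mem_univ, true_and, e, Equiv.arrowCongr_apply, Equiv.refl_symm, Equiv.coe_refl, Function.comp, id]
  rw [Equiv.swap_apply_def]
  split_ifs with h1 h2
  · rw [h1]; simp
  · rw [h2]; simp
  · constructor
    · intro h; exact absurd (Fin.ext h) h2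
    · intro h; exact absurd (Fin.ext h) h1

lemma col_up {V : Type*} [Fintype V] (hV : 0 < Fintype.card V) (q : ℕ) (hq : 3 ≤ q) (β : ℝ) (hβ : 0 < β) :
    pr (fun c : V → Fin q => ¬ ((1 - β) * Fintype.card V ≤ #(univ.filter (fun v => 2 ≤ (c v : ℕ))))) ≤ 2/(q*β) := by
  set n := Fintype.card V with hn
  have hn0 : (0:ℝ) < n := by exact_mod_cast hV
  have hq' : (0:ℝ) < q := by exact_mod_cast (by omega : 0 < q)
  calc _ ≤ pr (fun c : V → Fin q => β * n ≤ ∑ v : V, if (c v : ℕ) < 2 then (1:ℝ) else 0) := by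
        apply pr_mono
        intro c h
        rw [← Finset.sum_filter, Finset.sum_const, nsmul_eq_mul, mul_one]
        have := Finset.card_filter_add_card_filter_not (s := (univ : Finset V)) (fun v => 2 ≤ (c v : ℕ))
        simp only [not_le, card_univ] at this h
        have h2 : (#(univ.filter (fun v => 2 ≤ (c v : ℕ))) : ℝ) + #(univ.filter (fun v => (c v : ℕ) < 2)) = n := by
          exact_mod_cast this
        linarith
    _ ≤ ex (fun c : V → Fin q => ∑ v : V, if (c v : ℕ) < 2 then (1:ℝ) else 0) / (β * n) := by
        apply pr_markov _ _ _ (by positivity)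
        intro c; positivity
    _ ≤ (n * (2/q)) / (β * n) := by
        gcongr
        rw [ex_sum]
        have : ∀ v : V, ex (fun c : V → Fin q => if (c v : ℕ) < 2 then (1:ℝ) else 0) ≤ 2/q := by
          intro v
          have := low_tail (α := V) (B := q) (b0 := 1) (b2 := 2) (by omega) (by omega) (by omega) {v} ∅ (by simp) 1 one_pos le_rfl 0
          simp only [card_empty, filter_empty, le_refl, and_true, pow_zero, sub_self, zero_mul, neg_zero, Real.exp_zero, inv_one, mul_one, mem_singleton, forall_eq, card_singleton, pow_one] at this
          rw [← pr_eq_ex]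
          exact_mod_cast this
        refine (Finset.sum_le_sum (fun v _ => this v)).trans ?_
        rw [Finset.sum_const, nsmul_eq_mul, card_univ]
    _ = _ := by field_simp

/-- average over colourings of the failure probability of Good -/
lemma col_good (s q : ℕ) (hs : 2 ≤ s) (hq : 3 ≤ q) (ε : ℝ) (hε : 0 < ε) : ∀ᶠ n : ℕ in atTop,
    ∀ (V : Type) [Fintype V], Fintype.card V = n → ∀ (B b0 b2 a : ℕ), 0 < b0 → b0 ≤ b2 → b2 < B →
    (b0:ℝ)/B = P0 s n → (b2:ℝ)/B = P2 s n → (a:ℝ) ≤ n/(4*q) →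
    ex (fun c : V → Fin q => pr (fun l : Finset V → Fin B =>
      ¬ Good (s+1) b0 (univ.filter (fun v => 2 ≤ (c v : ℕ))) a l)) ≤ ε + 40 * s / q := by
  have hq' : (0:ℝ) < q := by exact_mod_cast (by omega : 0 < q)
  have hs' : (0:ℝ) < s := by exact_mod_cast (by omega : 0 < s)
  have hexp : ∀ᶠ n : ℕ in atTop, Real.exp (-(1/8 * ((n:ℝ)/q))) ≤ ε/4 := by
    have h1 : Tendsto (fun n : ℕ => (1/8 * ((n:ℝ)/q))) atTop atTop :=
      (tendsto_natCast_atTop_atTop.atTop_div_const hq').const_mul_atTop (by norm_num)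
    have h2 := Real.tendsto_exp_neg_atTop_nhds_zero.comp h1
    filter_upwards [h2.eventually (gt_mem_nhds (show (0:ℝ) < ε/4 by positivity))] with n hn
    exact hn.le
  filter_upwards [good_ev s q hs (by omega) (ε/4) (by positivity), hexp, eventually_gt_atTop 0] with n h1 h2 h3
  intro V _ hcard B b0 b2 a hb0 hb hb2 hp0 hp2 ha
  let bal : (V → Fin q) → Prop := fun c =>
    ((1 - 1/(20*(s:ℝ))) * n ≤ #(univ.filter (fun v => 2 ≤ (c v : ℕ)))) ∧
    ((n:ℝ)/(2*q) ≤ #(univ.filter (fun v => (c v : ℕ) = 0))) ∧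
    ((n:ℝ)/(2*q) ≤ #(univ.filter (fun v => (c v : ℕ) = 1)))
  have hne : Nonempty (Fin q) := ⟨⟨0, by omega⟩⟩
  have hunb : pr (fun c => ¬ bal c) ≤ 40*s/q + (ε/4 + ε/4) := by
    have a1 := col_up (V := V) (by omega) q hq (1/(20*(s:ℝ))) (by positivity)
    have a2 := col_low (V := V) q hq
    have a3 := col_low1 (V := V) q hq
    rw [hcard] at a1 a2 a3
    have e : 2/((q:ℝ)*(1/(20*(s:ℝ)))) = 40*s/q := by field_simp; norm_num
    rw [e] at a1
    refine le_trans ?_ (add_le_add a1 (add_le_add (a2.trans h2) (a3.trans h2)))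
    refine le_trans ?_ (add_le_add_right (pr_or_le _ _) _)
    refine le_trans ?_ (pr_or_le _ _)
    apply pr_mono
    intro c hc
    simp only [bal] at hc
    tauto
  calc _ ≤ ex (fun c : V → Fin q => (if ¬ bal c then (1:ℝ) else 0) + ε/4) := by
        apply ex_mono
        intro c
        by_cases hc : bal c
        · simp only [hc, not_true, if_false, zero_add]
          refine h1 V hcard B b0 b2 a hb0 hb hb2 hp0 hp2 _ (univ.filter (fun v => (c v : ℕ) = 0)) (univ.filter (fun v => (c v : ℕ) = 1))
            ?_ ?_ ?_ hc.1 hc.2.1 hc.2.2 ha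
          all_goals
            rw [Finset.disjoint_left]; intro v; simp only [mem_filter, mem_univ, true_and]; omega
        · simp only [hc, not_false_iff, if_true]
          have := pr_le_one (fun l : Finset V → Fin B =>
            ¬ Good (s+1) b0 (univ.filter (fun v => 2 ≤ (c v : ℕ))) a l)
          linarith
    _ = pr (fun c => ¬ bal c) + ε/4 := by
        rw [ex_add, ex_const, pr_eq_ex]
    _ ≤ _ := by linarith
end partJ1

section partJ2
open Filter Topology
open scoped Classical

lemma D_big (s : ℕ) (hs : 1 ≤ s) (C : ℝ) : ∀ᶠ n : ℕ in atTop, C * (Lg n:ℝ) ≤ ((n-1).choose s : ℝ) := by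
  set c : ℝ := 2^s * s.factorial with hc
  have hc0 : 0 < c := by positivity
  filter_upwards [basic_ev s, n_over s (|C| * c)] with n ⟨h1, h2, h3, _⟩ h4
  have h5 := D_low n s h1
  have hn : (1:ℝ) ≤ n := by exact_mod_cast (by omega : 1 ≤ n)
  have h6 : (n:ℝ) ≤ (n:ℝ)^s := le_self_pow₀ hn (by omega)
  have h7 : (Lg n : ℝ) ≤ ug s n ^ 2 * Lg n := by
    have : 1 ≤ ug s n ^ 2 := one_le_pow₀ h3
    nlinarith
  have h8 : c * (|C| * Lg n) ≤ c * ((n-1).choose s : ℝ) := by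
    calc c * (|C| * Lg n) = (|C| * c) * Lg n := by ring
      _ ≤ (|C| * c) * (ug s n ^ 2 * Lg n) := by gcongr
      _ ≤ n := h4
      _ ≤ _ := h6.trans h5
  have h9 := le_of_mul_le_mul_left h8 hc0
  refine le_trans ?_ h9
  gcongr
  exact le_abs_self C

lemma sum_pow_two (y : ℝ) (h0 : 0 ≤ y) (h1 : y ≤ 1/2) (J : ℕ) : ∑ j ∈ range J, y ^ (2^j) ≤ 2 * y := by
  calc _ ≤ ∑ j ∈ range J, y^(j+1) := by
        apply Finset.sum_le_sum
        intro j _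
        apply pow_le_pow_of_le_one h0 (by linarith)
        exact Nat.lt_two_pow_self
    _ ≤ 2 * y := by
        have h : ∀ N, ∑ j ∈ range N, y ^ (j+1) ≤ 2 * y - 2 * (y * y ^ N) := by
          intro N
          induction N with
          | zero => simp
          | succ N ih =>
            rw [Finset.sum_range_succ, pow_succ]
            have : 0 ≤ y * y^N := by positivity
            nlinarith
        have := h J
        have : 0 ≤ y * y^J := by positivity
        linarith

set_option maxHeartbeats 4000000 in
/-- the no-perfect-matching probability -/
lemma noPM_ev (s : ℕ) (hs : 2 ≤ s) (η : ℝ) (hη : 0 < η) : ∀ᶠ n : ℕ in atTop, s + 1 ∣ n →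
    ∀ (V : Type) [Fintype V], Fintype.card V = n → ∀ (Q : ℕ), 0 < Q →
    pr (fun l : Finset V → Fin (8 * ((n-1).choose s) * Q) =>
      ¬ HasPM (Gs (s+1) (6 * Lg n * Q) l ∪ Gl (s+1) (7 * Lg n * Q) l)) ≤ η := by
  set C : ℝ := 2^(s+1) * (Real.exp 1 * (8 * (s+1)))^s * 32 with hC
  have hC0 : 0 < C := by positivity
  obtain ⟨q, hq⟩ := exists_nat_ge (3 + 8 * C + (40 * s + 8 * C) / (η/2))
  have hs0 : (0:ℝ) ≤ s := by positivity
  have hpos1 : 0 ≤ (40 * s + 8 * C) / (η/2) := by positivity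
  have hq3 : 3 ≤ q := by
    have : (3:ℝ) ≤ q := by linarith
    exact_mod_cast this
  have hq0 : (0:ℝ) < q := by linarith
  have hqη : 40 * s / q + 8 * C / q ≤ η / 2 := by
    rw [← add_div, div_le_iff₀ hq0]
    have : (40 * s + 8 * C) / (η/2) ≤ q := by linarith
    rw [div_le_iff₀ (by positivity)] at this
    linarith
  have hqC : 4 * (C / q) ≤ 1/2 := by
    rw [← mul_div_assoc, div_le_iff₀ hq0]; linarith
  filter_upwards [col_good s q hs hq3 (η/2) (by positivity), basic_ev s, D_big s (by omega) 3,
    lin_ev (1/(8*q*(s+1))) 1 (by positivity)] with n hgood ⟨h1, h2, _⟩ hD3 hlin hdvd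
  intro V _ hcard Q hQ
  set D := (n-1).choose s with hD
  set L := Lg n with hL
  have hLD : 3 * L ≤ D := by exact_mod_cast hD3
  have hL1 : 1 ≤ L := by exact_mod_cast h2
  have hD1 : 1 ≤ D := by omega
  have hn : (0:ℝ) < n := by exact_mod_cast (by omega : 0 < n)
  have hQ' : (0:ℝ) < Q := by exact_mod_cast hQ
  have hD' : (0:ℝ) < D := by exact_mod_cast hD1
  have hL' : (0:ℝ) < L := by linarith
  set kmin := ⌊(n:ℝ)/(4*q*(s+1))⌋₊ with hkmin
  have hk1 := Nat.floor_le (a := (n:ℝ)/(4*q*(s+1))) (by positivity)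
  have hk2 := Nat.lt_floor_add_one ((n:ℝ)/(4*q*(s+1)))
  rw [← hkmin] at hk1 hk2
  have e1 : (n:ℝ)/(4*q*(s+1)) = 2 * (1/(8*q*(s+1)) * n) := by field_simp; norm_num
  have hklow : 1/(8*q*(s+1)) * n ≤ (kmin:ℝ) := by linarith
  have hkpos' : (0:ℝ) < kmin := by linarith
  have hkpos : 0 < kmin := by exact_mod_cast hkpos'
  have hacc : (((s+1) * kmin : ℕ) : ℝ) ≤ n/(4*q) := by
    push_cast
    calc ((s:ℝ)+1) * kmin ≤ (s+1) * ((n:ℝ)/(4*q*(s+1))) := by gcongr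
      _ = _ := by field_simp
  have hB2 : 16 * L * Q < 8 * D * Q := Nat.mul_lt_mul_of_pos_right (by omega) hQ
  have hb01 : 6 * L * Q ≤ 7 * L * Q := Nat.mul_le_mul_right _ (by omega)
  have hb12 : 7 * L * Q ≤ 16 * L * Q := Nat.mul_le_mul_right _ (by omega)
  have hg := hgood V hcard (8 * D * Q) (6 * L * Q) (16 * L * Q) ((s+1) * kmin) (by positivity) (by omega) hB2
    (by unfold P0; push_cast; rw [← hD, ← hL]; field_simp; norm_num)
    (by unfold P2; push_cast; rw [← hD, ← hL]; field_simp; norm_num) hacc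
  -- sprinkling parameters
  set P : ℝ := ((7 * L * Q - 6 * L * Q : ℕ) : ℝ) / ((8 * D * Q - 6 * L * Q : ℕ) : ℝ) with hP
  have hPe : P = L / (8 * D - 6 * L) := by
    rw [hP, Nat.cast_sub hb01, Nat.cast_sub (by omega)]
    push_cast
    rw [show (7:ℝ) * L * Q - 6 * L * Q = L * Q by ring, show (8:ℝ) * D * Q - 6 * L * Q = (8 * D - 6 * L) * Q by ring]
    exact mul_div_mul_right _ _ hQ'.ne'
  have hden : (0:ℝ) < 8 * D - 6 * L := by linarith
  have hPlow : L / (8 * (D:ℝ)) ≤ P := by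
    rw [hPe]; gcongr; linarith
  have hP0 : 0 < P := lt_of_lt_of_le (by positivity) hPlow
  have hP1 : P ≤ 1 := by rw [hPe, div_le_one hden]; linarith
  set J := 2 * L + 2 with hJ
  set t : ℝ := (1 - P) ^ ((J:ℝ)⁻¹) with ht
  have ht0 : 0 ≤ t := Real.rpow_nonneg (by linarith) _
  have htJ : t ^ J = 1 - P := Real.rpow_inv_natCast_pow (by linarith) (by omega)
  have hbern : 1 - J * (1 - t) ≤ 1 - P := by
    have := one_add_mul_le_pow (a := t - 1) (by linarith) J
    rw [show 1 + (t - 1) = t by ring, htJ] at this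
    linarith
  have hJ0 : (0:ℝ) < J := by rw [hJ]; positivity
  have hJ4 : (J:ℝ) ≤ 4 * L := by rw [hJ]; push_cast; linarith
  have hplow : 1 / (32 * (D:ℝ)) ≤ 1 - t := by
    have h3 : P ≤ J * (1 - t) := by linarith
    have h4 : 0 ≤ 1 - t := by
      by_contra hc
      push Not at hc
      nlinarith
    have h5 : L / (8 * (D:ℝ)) ≤ 4 * L * (1 - t) := hPlow.trans (h3.trans (by gcongr))
    have h6 : L / (8 * (D:ℝ)) = 4 * L * (1 / (32 * (D:ℝ))) := by field_simp; norm_num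
    rw [h6] at h5
    exact le_of_mul_le_mul_left h5 (by positivity)
  have hp0 : 0 < 1 - t := lt_of_lt_of_le (by positivity) hplow
  have hnJ : n < 2 ^ J := by
    have h3 := Lg_ge n (by omega)
    rw [← hL, ← Real.exp_add] at h3
    have h4 : Real.exp (1 + L) < (2:ℝ)^J := by
      rw [hJ, show 2 * L + 2 = 2 * (L + 1) by ring, pow_mul]
      rw [show (1:ℝ) + L = ((L+1:ℕ):ℝ) * 1 by push_cast; ring, Real.exp_nat_mul]
      apply pow_lt_pow_left₀ _ (Real.exp_pos _).le (by omega)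
      have := Real.exp_one_lt_d9
      norm_num; linarith
    exact_mod_cast lt_of_le_of_lt h3 h4
  set X : ℝ := (2/(q:ℝ))^(s+1) * (Real.exp 1 / kmin)^s with hX
  have hX0 : 0 ≤ X := by positivity
  have hDup : (D:ℝ) ≤ n^s := by
    have h3 := choose_up n s
    rw [← hD] at h3
    have h4 : (1:ℝ) ≤ s.factorial := by exact_mod_cast Nat.factorial_pos s
    nlinarith
  have hx : X / (1 - t) ≤ C / q := by
    calc X / (1 - t) ≤ X / (1 / (32 * (D:ℝ))) := by gcongr
      _ = X * (32 * D) := by field_simp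
      _ ≤ ((2/(q:ℝ))^(s+1) * (Real.exp 1 / (1/(8*q*(s+1)) * n))^s) * (32 * n^s) := by
          rw [hX]; gcongr
      _ = C / q := by
          rw [hC]
          have : Real.exp 1 / (1/(8*q*((s:ℝ)+1)) * n) = (Real.exp 1 * (8 * (s+1))) * q / n := by field_simp
          rw [this, div_pow, div_pow, mul_pow _ (q:ℝ), pow_succ (q:ℝ)]
          field_simp
  have hne : Nonempty (Fin q) := ⟨⟨0, by omega⟩⟩
  have hsp := sprinkle (V := V) (C := V → Fin q) (fun c => univ.filter (fun v => 2 ≤ (c v : ℕ))) (2/(q:ℝ)) (by positivity)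
    (fun A => col_disj q hq3 A) s kmin hkpos (by rw [hcard]; exact hdvd) (B := 8 * D * Q) (b0 := 6 * L * Q) (b1 := 7 * L * Q)
    (by omega) hb01 (by omega) (1 - t) (X / (1 - t)) J hp0 (by linarith) (by linarith) (by rw [hcard]; exact hnJ)
    (by rw [← hP]; rw [show 1 - (1 - t) = t by ring, htJ]; ring)
    (by rw [← hX]; field_simp)
  have hsum := sum_pow_two (4 * (X / (1 - t))) (by positivity) (by linarith) J
  refine hsp.trans ?_
  have : 8 * C / q = 8 * (C / q) := by ring
  linarith

set_option maxHeartbeats 4000000 in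
/-- at level b1 there is an isolated vertex -/
lemma iso_ev (s : ℕ) (hs : 1 ≤ s) (η : ℝ) (hη : 0 < η) : ∀ᶠ n : ℕ in atTop,
    ∀ (V : Type) [Fintype V], Fintype.card V = n → ∀ (Q : ℕ), 0 < Q →
    pr (fun l : Finset V → Fin (8 * ((n-1).choose s) * Q) => Iso (s+1) (7 * Lg n * Q) l = ∅) ≤ η := by
  obtain ⟨m, rfl⟩ : ∃ m, s = m + 1 := ⟨s - 1, by omega⟩
  filter_upwards [basic_ev (m+1), D_big (m+1) (by omega) 64, poly_exp (1/9) 1 (by norm_num) 0 (η/2) (by positivity),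
    n_over (m+1) (4*(m+1)), n_over (m+1) (4*(m+1)/(η/2)), eventually_ge_atTop 2] with n ⟨h1, h2, h3, _⟩ h4 h5 h6 h7 hn2
  intro V _ hcard Q hQ
  set D := (n-1).choose (m+1) with hD
  set L := Lg n with hL
  have hLD : 64 * L ≤ D := by exact_mod_cast h4
  have hL1 : 1 ≤ L := by exact_mod_cast h2
  have hD1 : 1 ≤ D := by omega
  have hn : (0:ℝ) < n := by exact_mod_cast (by omega : 0 < n)
  have hQ' : (0:ℝ) < Q := by exact_mod_cast hQ
  have hD' : (0:ℝ) < D := by exact_mod_cast hD1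
  have hL' : (0:ℝ) < L := by linarith
  have hi := iso_empty (V := V) (B := 8 * D * Q) (b := 7 * L * Q) (Nat.mul_lt_mul_of_pos_right (by omega) hQ) m (by omega)
  rw [hcard, ← hD] at hi
  have hpe : ((7 * L * Q : ℕ):ℝ) / ((8 * D * Q : ℕ) : ℝ) = 7 * L / (8 * D) := by
    push_cast; exact mul_div_mul_right _ _ hQ'.ne'
  rw [hpe] at hi
  set p : ℝ := 7 * L / (8 * D) with hp
  have hp0 : 0 < p := by positivity
  have hp1 : p ≤ 1/64 := by
    rw [hp, div_le_iff₀ (by positivity)]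
    have : (64:ℝ) * L ≤ D := h4
    linarith
  have t1 : 1 / ((n:ℝ) * (1 - p)^D) ≤ η/2 := by
    have a1 : Real.exp (-(64/63 * p)) ≤ 1 - p := by
      rw [Real.exp_neg]
      apply inv_le_of_inv_le₀ (by linarith)
      have : (1 - p)⁻¹ ≤ 64/63 * p + 1 := by
        rw [inv_le_iff_one_le_mul₀ (by linarith)]
        nlinarith
      exact this.trans (Real.add_one_le_exp _)
    have a2 : Real.exp (-(8/9 * L)) ≤ (1 - p)^D := by
      calc Real.exp (-(8/9 * L)) = (Real.exp (-(64/63 * p)))^D := by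
            rw [← Real.exp_nat_mul]; congr 1; rw [hp]; field_simp; norm_num
        _ ≤ _ := by gcongr
    have a3 : Real.exp (1/9 * L) ≤ n * (1 - p)^D := by
      calc Real.exp (1/9 * L) = Real.exp L * Real.exp (-(8/9 * L)) := by rw [← Real.exp_add]; ring_nf
        _ ≤ _ := by gcongr; exact Lg_le n (by omega)
    calc _ ≤ 1 / Real.exp (1/9 * L) := one_div_le_one_div_of_le (Real.exp_pos _) a3
      _ ≤ η/2 := by rw [one_div, ← Real.exp_neg]; simpa using h5
  have t2 : ((1 - p)^((n-2).choose m))⁻¹ - 1 ≤ η/2 := by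
    have hch : ((n-1:ℕ)) * ((n-2).choose m) = D * (m+1) := by
      have := Nat.add_one_mul_choose_eq (n-2) m
      rw [show n - 2 + 1 = n - 1 by omega] at this
      rw [hD]; exact this
    set M := (n-2).choose m with hM
    have hch' : ((n:ℝ) - 1) * M = D * (m+1) := by
      have e : ((n-1:ℕ):ℝ) = (n:ℝ) - 1 := by rw [Nat.cast_sub (by omega)]; simp
      rw [← e]; exact_mod_cast hch
    have hMp : M * p ≤ 2 * (m+1) * L / n := by
      have hM2 : (n:ℝ) * M ≤ 2 * (D * (m+1)) := by
        have : (2:ℝ) ≤ n := by exact_mod_cast hn2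
        have : (0:ℝ) ≤ M := by positivity
        nlinarith
      rw [hp, le_div_iff₀ hn]
      calc (M:ℝ) * (7 * L / (8 * D)) * n = (n * M) * (7 * L / (8 * D)) := by ring
        _ ≤ (2 * (D * (m+1))) * (7 * L / (8 * D)) := by gcongr
        _ = 2 * (m+1) * L * (7/8) := by field_simp
        _ ≤ 2 * (m+1) * L := by
          have : (0:ℝ) ≤ 2 * (m+1) * L := by positivity
          linarith
    have hLu : (L:ℝ) ≤ ug (m+1) n ^ 2 * L := by
      have : 1 ≤ ug (m+1) n ^ 2 := one_le_pow₀ h3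
      nlinarith
    have b1 : M * p ≤ 1/2 := by
      refine hMp.trans ?_
      rw [div_le_iff₀ hn]
      have : 4 * ((m:ℝ)+1) * L ≤ 4*((m:ℝ)+1) * (ug (m+1) n ^ 2 * L) := by gcongr
      linarith
    have b2 : 2 * (M * p) ≤ η/2 := by
      have : 2 * (2 * ((m:ℝ)+1) * L / n) ≤ η/2 := by
        rw [← mul_div_assoc, div_le_iff₀ hn]
        have h8 : 4*((m:ℝ)+1)/(η/2) * L ≤ n := by
          refine le_trans ?_ h7
          gcongr
        rw [div_mul_eq_mul_div, div_le_iff₀ (by positivity)] at h8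
        linarith
      linarith
    have b3 : 1 - M * p ≤ (1 - p)^M := by
      have := one_add_mul_le_pow (a := -p) (by linarith) M
      rw [← sub_eq_add_neg] at this
      linarith
    have b4 : ((1 - p)^M)⁻¹ ≤ 1 + 2 * (M * p) := by
      calc _ ≤ (1 - M * p)⁻¹ := by gcongr; linarith
        _ ≤ _ := by
          rw [inv_le_iff_one_le_mul₀ (by linarith)]
          have : 0 ≤ M * p := by positivity
          nlinarith
    linarith
  exact hi.trans (by linarith)
end partJ2

section partK1
open scoped Classical

def FailL {V : Type*} [Fintype V] (r : ℕ) {B : ℕ} (l : Finset V → Fin B) : Prop :=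
  ∃ β : ℕ, vs (Gl r β l) = univ ∧ ¬ HasPM (Gl r β l)

lemma not_fail {V : Type*} [Fintype V] {r b0 b1 B : ℕ} (hb : b0 ≤ b1) (l : Finset V → Fin B) (h1 : Iso r b1 l ≠ ∅)
    (h2 : HasPM (Gs r b0 l ∪ Gl r b1 l)) : ¬ FailL r l := by
  rintro ⟨β, hc, hn⟩
  obtain ⟨v, hv⟩ := nonempty_iff_ne_empty.mpr h1
  have hcov : ∀ w : V, ∃ A ∈ Gl r β l, w ∈ A := by
    intro w
    have : w ∈ vs (Gl r β l) := by rw [hc]; exact mem_univ _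
    exact mem_vs.mp this
  have hβ : b1 ≤ β := by
    by_contra hlt
    obtain ⟨A, hA, hvA⟩ := hcov v
    rw [mem_Gl] at hA
    simp only [Iso, mem_filter, mem_univ, true_and] at hv
    exact hv A (mem_Gl.mpr ⟨hA.1, by omega⟩) hvA
  apply hn
  obtain ⟨M, hM, hM2, hM3⟩ := h2
  refine ⟨M, ?_, hM2, hM3⟩
  intro A hA
  rcases mem_union.mp (hM hA) with h | h
  · simp only [Gs, mem_filter, mem_univ, true_and] at h
    rw [mem_Gl]
    refine ⟨h.1, ?_⟩
    rcases h.2 with h' | ⟨w, hw, hwi, hmin⟩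
    · omega
    · obtain ⟨A', hA', hwA'⟩ := hcov w
      rw [mem_Gl] at hA'
      have := hmin A' hA'.1 hwA'
      have h3 : (l A : ℕ) ≤ l A' := this
      omega
  · rw [mem_Gl] at h ⊢
    exact ⟨h.1, by omega⟩

lemma inj_low (N B : ℕ) (hB : 0 < B) : (1:ℝ) - (N:ℝ)^2/B ≤ (B.descFactorial N : ℝ) / (B:ℝ)^N := by
  have hB' : (0:ℝ) < B := by exact_mod_cast hB
  by_cases h : N ≤ B
  · have h1 := Nat.pow_sub_le_descFactorial B N
    have h2 : (((B + 1 - N : ℕ) : ℝ)/B)^N ≤ (B.descFactorial N : ℝ) / (B:ℝ)^N := by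
      rw [div_pow]; gcongr; exact_mod_cast h1
    refine le_trans ?_ h2
    have e : ((B + 1 - N : ℕ) : ℝ) = B + 1 - N := by rw [Nat.cast_sub (by omega)]; push_cast; ring
    have h3 : (1:ℝ) + (-(N/B)) ≤ ((B + 1 - N : ℕ) : ℝ)/B := by
      rw [e, le_div_iff₀ hB']; field_simp; linarith
    have h4 : (N:ℝ)/B ≤ 1 := by rw [div_le_one hB']; exact_mod_cast h
    have h5 := one_add_mul_le_pow (a := -((N:ℝ)/B)) (by linarith) N
    calc (1:ℝ) - (N:ℝ)^2/B = 1 + N * -((N:ℝ)/B) := by ring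
      _ ≤ _ := h5
      _ ≤ _ := by gcongr; linarith
  · have h1 : (1:ℝ) ≤ (N:ℝ)^2/B := by
      rw [le_div_iff₀ hB']
      have : (B:ℝ) ≤ N := by exact_mod_cast (by omega : B ≤ N)
      have h1N : (1:ℝ) ≤ N := by exact_mod_cast (by omega : 1 ≤ N)
      nlinarith
    have : (0:ℝ) ≤ (B.descFactorial N : ℝ) / (B:ℝ)^N := by positivity
    linarith

lemma transfer {E : Type*} [Fintype E] {N B : ℕ} (hB : 0 < B) (hN : Fintype.card E = N)
    (Bad : (Fin N ≃ E) → Prop) (Fl : (E → Fin B) → Prop)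
    (h : ∀ σ l, StrictMono (fun i => l (σ i)) → Bad σ → Fl l) :
    pr Bad ≤ pr Fl + (N:ℝ)^2/B := by
  let SM : (Fin N ≃ E) → Finset (E → Fin B) := fun σ => univ.filter (fun l => StrictMono (fun i => l (σ i)))
  set S := #(univ.filter (fun g : Fin N → Fin B => StrictMono g)) with hS
  have e0 : Fin N ≃ E := (finCongr hN.symm).trans (Fintype.equivFin E).symm
  have hSM : ∀ σ, #(SM σ) = S := by
    intro σ
    apply Finset.card_bij (fun l _ => fun i => l (σ i))
    · intro l hl
      simp only [SM, mem_filter, mem_univ, true_and] at hl ⊢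
      exact hl
    · intro l _ l' _ hll
      funext A
      have := congrFun hll (σ.symm A)
      simpa using this
    · intro g hg
      simp only [SM, mem_filter, mem_univ, true_and] at hg ⊢
      refine ⟨fun A => g (σ.symm A), ?_, ?_⟩
      · have : (fun i => g (σ.symm (σ i))) = g := funext fun i => congrArg g (σ.symm_apply_apply i)
        rw [this]; exact hg
      · exact funext fun i => congrArg g (σ.symm_apply_apply i)
  have huniq : ∀ σ σ' l, l ∈ SM σ → l ∈ SM σ' → σ = σ' := by
    intro σ σ' l h1 h2
    simp only [SM, mem_filter, mem_univ, true_and] at h1 h2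
    have hr : Set.range (fun i => l (σ i)) = Set.range (fun i => l (σ' i)) := by
      ext x
      constructor
      · rintro ⟨i, rfl⟩; exact ⟨σ'.symm (σ i), by simp⟩
      · rintro ⟨i, rfl⟩; exact ⟨σ.symm (σ' i), by simp⟩
    have heq := (StrictMono.range_inj h1 h2).mp hr
    ext i
    have h3 := congrFun heq i
    have h4 : l (σ i) = l (σ (σ.symm (σ' i))) := by simpa using h3
    have h5 := h1.injective h4
    exact (Equiv.eq_symm_apply σ).mp h5
  have hbad : #(univ.filter Bad) * S ≤ #(univ.filter Fl) := by
    have : #((univ.filter Bad).biUnion SM) = #(univ.filter Bad) * S := by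
      rw [Finset.card_biUnion]
      · simp [hSM]
      · intro σ _ σ' _ hne
        rw [Function.onFun, Finset.disjoint_left]
        intro l h1 h2
        exact hne (huniq σ σ' l h1 h2)
    rw [← this]
    apply Finset.card_le_card
    intro l hl
    rw [mem_biUnion] at hl
    obtain ⟨σ, hσ, hl⟩ := hl
    simp only [SM, mem_filter, mem_univ, true_and] at hσ hl ⊢
    exact h σ l hl hσ
  have hinj : B.descFactorial N ≤ Fintype.card (Fin N ≃ E) * S := by
    have h1 : Fintype.card (E ↪ Fin B) = B.descFactorial N := by
      rw [Fintype.card_embedding_eq, hN, Fintype.card_fin]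
    have h2 : Fintype.card (E ↪ Fin B) = #(univ.filter (fun l : E → Fin B => Function.Injective l)) := by
      rw [← Fintype.card_subtype]
      exact Fintype.card_congr (Equiv.subtypeInjectiveEquivEmbedding E (Fin B)).symm
    rw [← h1, h2]
    calc _ ≤ #((univ : Finset (Fin N ≃ E)).biUnion SM) := by
          apply Finset.card_le_card
          intro l hl
          simp only [mem_filter, mem_univ, true_and] at hl
          rw [mem_biUnion]
          refine ⟨(Tuple.sort (fun i => l (e0 i))).trans e0, mem_univ _, ?_⟩
          simp only [SM, mem_filter, mem_univ, true_and]
          have hm := Tuple.monotone_sort (fun i => l (e0 i))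
          refine Monotone.strictMono_of_injective (f := fun i => l (((Tuple.sort (fun i => l (e0 i))).trans e0) i)) hm ?_
          exact hl.comp (Equiv.injective _)
      _ ≤ ∑ σ : Fin N ≃ E, #(SM σ) := Finset.card_biUnion_le
      _ = _ := by simp [hSM]
  have hlow := inj_low N B hB
  have hc0 : (0:ℝ) < Fintype.card (Fin N ≃ E) := by
    have : Nonempty (Fin N ≃ E) := ⟨e0⟩
    exact_mod_cast Fintype.card_pos
  have hB' : (0:ℝ) < B := by exact_mod_cast hB
  have hkey : pr Bad * ((B.descFactorial N : ℝ) / (B:ℝ)^N) ≤ pr Fl := by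
    rw [pr_def, pr_def]
    have hcE : (Fintype.card (E → Fin B) : ℝ) = (B:ℝ)^N := by
      rw [Fintype.card_fun, hN, Fintype.card_fin]; push_cast; rfl
    rw [hcE, div_mul_div_comm, div_le_div_iff₀ (by positivity) (by positivity)]
    have h1 : (#(univ.filter Bad) : ℝ) * S ≤ #(univ.filter Fl) := by exact_mod_cast hbad
    have h2 : (B.descFactorial N : ℝ) ≤ Fintype.card (Fin N ≃ E) * S := by exact_mod_cast hinj
    calc (#(univ.filter Bad) : ℝ) * (B.descFactorial N : ℝ) * (B:ℝ)^N
        ≤ (#(univ.filter Bad) : ℝ) * (Fintype.card (Fin N ≃ E) * S) * (B:ℝ)^N := by gcongr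
      _ = ((#(univ.filter Bad) : ℝ) * S) * (Fintype.card (Fin N ≃ E) * (B:ℝ)^N) := by ring
      _ ≤ _ := by gcongr
  have hp1 := pr_le_one Bad
  have hp0 := pr_nonneg Bad
  have hN2 : (0:ℝ) ≤ (N:ℝ)^2/B := by positivity
  nlinarith

lemma marginal {α E β : Type*} [Fintype α] [Fintype E] [Fintype β] [Nonempty β] (ι : E → α) (hι : Function.Injective ι)
    (P : (E → β) → Prop) : pr (fun l : α → β => P (fun e => l (ι e))) = pr P := by
  let e1 := Equiv.piEquivPiSubtypeProd (fun x => x ∈ Set.range ι) (fun _ : α => β)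
  let e2 : E ≃ {x // x ∈ Set.range ι} := Equiv.ofInjective ι hι
  let e3 : ({x // x ∈ Set.range ι} → β) ≃ (E → β) := Equiv.arrowCongr e2.symm (Equiv.refl β)
  have h1 : pr (fun l : α → β => P (fun e => l (ι e))) =
      pr (fun w : ({x // x ∈ Set.range ι} → β) × ({x // ¬ x ∈ Set.range ι} → β) => P (e3 w.1)) := by
    rw [pr_eq_ex, pr_eq_ex, ← ex_equiv e1]
    rfl
  rw [h1, pr_eq_ex, ex_prodtype]
  have h2 : ∀ w : {x // x ∈ Set.range ι} → β,
      ex (fun _ : ({x // ¬ x ∈ Set.range ι} → β) => if P (e3 w) then (1:ℝ) else 0) =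
        if P (e3 w) then (1:ℝ) else 0 := fun w => ex_const _
  rw [pr_eq_ex, ← ex_equiv e3]
  exact congrArg ex (funext h2)
end partK1

section partK2
open scoped Classical
open Filter Topology

lemma fail_ev (s : ℕ) (hs : 2 ≤ s) (η : ℝ) (hη : 0 < η) :
    ∀ᶠ n in atTop, s+1 ∣ n → ∀ (V : Type) [Fintype V], Fintype.card V = n → ∀ Q, 0 < Q →
      pr (fun l : Finset V → Fin (8*((n-1).choose s)*Q) => FailL (s+1) l) ≤ η := by
  filter_upwards [noPM_ev s hs (η/2) (by linarith), iso_ev s (by omega) (η/2) (by linarith)] with n h1 h2 hd V _ hV Q hQ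
  have a1 := h1 hd V hV Q hQ
  have a2 := h2 V hV Q hQ
  refine le_trans (pr_mono (Q := fun l : Finset V → Fin (8*((n-1).choose s)*Q) =>
    (¬HasPM (Gs (s+1) (6*Lg n*Q) l ∪ Gl (s+1) (7*Lg n*Q) l)) ∨ Iso (s+1) (7*Lg n*Q) l = ∅) ?_) ?_
  · intro l hl
    by_contra hcon
    push Not at hcon
    exact not_fail (b0 := 6*Lg n*Q) (b1 := 7*Lg n*Q) (by gcongr; norm_num) l
      (by simpa [nonempty_iff_ne_empty] using hcon.2) hcon.1 hl
  · refine le_trans (pr_or_le _ _) ?_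
    linarith

noncomputable def iotaE (n r : ℕ) (A : {A // A ∈ Kn n r}) : Finset (Fin n) :=
  univ.filter (fun i : Fin n => (i:ℕ) ∈ A.1)

lemma iotaE_map (n r : ℕ) (A : {A // A ∈ Kn n r}) : (iotaE n r A).map Fin.valEmbedding = A.1 := by
  have h := (mem_powersetCard.mp A.2).1
  ext x
  simp only [iotaE, Finset.mem_map, mem_filter, mem_univ, true_and, Fin.valEmbedding_apply]
  constructor
  · rintro ⟨i, hi, rfl⟩; exact hi
  · intro hx
    exact ⟨⟨x, mem_range.mp (h hx)⟩, hx, rfl⟩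

lemma iotaE_inj (n r : ℕ) : Function.Injective (iotaE n r) := by
  intro A B h
  apply Subtype.ext
  rw [← iotaE_map, ← iotaE_map, h]

lemma iotaE_card (n r : ℕ) (A : {A // A ∈ Kn n r}) : #(iotaE n r A) = r := by
  rw [← card_map Fin.valEmbedding, iotaE_map]
  exact (mem_powersetCard.mp A.2).2

lemma iotaE_surj (n r : ℕ) (X : Finset (Fin n)) (hX : #X = r) : ∃ A, iotaE n r A = X := by
  refine ⟨⟨X.map Fin.valEmbedding, ?_⟩, ?_⟩
  · rw [Kn, mem_powersetCard]
    refine ⟨?_, by rw [card_map, hX]⟩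
    intro x hx
    simp only [Finset.mem_map, Fin.valEmbedding_apply] at hx
    obtain ⟨i, _, rfl⟩ := hx
    simp
  · apply Finset.map_injective Fin.valEmbedding
    rw [iotaE_map]

lemma hit_mem (n r : ℕ) (h1 : 1 ≤ r) (hn : r ≤ n) (σ : Fin (Kn n r).card ≃ {A // A ∈ Kn n r}) :
    (Ht n r (hitTime n r σ) σ).biUnion id = range n := by
  have : (hitTime n r σ) ∈ {t : ℕ | (Ht n r t σ).biUnion id = Finset.range n} := by
    apply Nat.sInf_mem
    refine ⟨(Kn n r).card, ?_⟩
    show (Ht n r (Kn n r).card σ).biUnion id = range n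
    ext x
    simp only [mem_biUnion, id, Ht, mem_image, mem_filter, mem_univ, true_and]
    constructor
    · rintro ⟨A, ⟨i, _, rfl⟩, hx⟩
      exact (mem_powersetCard.mp (σ i).2).1 hx
    · intro hx
      obtain ⟨A, hxA, hA, hc⟩ := Finset.exists_subsuperset_card_eq (s := {x}) (t := range n) (n := r)
        (by simpa using hx) (by simpa using h1) (by simpa using hn)
      have hK : A ∈ Kn n r := mem_powersetCard.mpr ⟨hA, hc⟩
      refine ⟨A, ⟨σ.symm ⟨A, hK⟩, Fin.is_lt _, by simp⟩, hxA (by simp)⟩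
  exact this

lemma bad_fail (n r B : ℕ) (h1 : 1 ≤ r) (hn : r ≤ n) (σ : Fin (Kn n r).card ≃ {A // A ∈ Kn n r})
    (l : Finset (Fin n) → Fin B) (hm : StrictMono (fun i => l (iotaE n r (σ i))))
    (hbad : ¬ 0 < pmCount (range n) (Ht n r (hitTime n r σ) σ)) : FailL r l := by
  have hT := hit_mem n r h1 hn σ
  set T := hitTime n r σ with hTdef
  obtain ⟨β, hβ⟩ : ∃ β : ℕ, ∀ i : Fin (Kn n r).card, (l (iotaE n r (σ i)) : ℕ) < β ↔ (i:ℕ) < T := by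
    by_cases hlt : T < (Kn n r).card
    · refine ⟨l (iotaE n r (σ ⟨T, hlt⟩)), fun i => ?_⟩
      have := hm.lt_iff_lt (a := i) (b := ⟨T, hlt⟩)
      rw [Fin.lt_def, Fin.lt_def] at this
      exact this
    · exact ⟨B, fun i => ⟨fun _ => by have := i.2; omega, fun _ => Fin.is_lt _⟩⟩
  have hG : ∀ X, X ∈ Gl r β l ↔ X.map Fin.valEmbedding ∈ Ht n r T σ := by
    intro X
    rw [mem_Gl]
    simp only [Ht, mem_image, mem_filter, mem_univ, true_and]
    constructor
    · rintro ⟨hX, hl⟩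
      obtain ⟨A, rfl⟩ := iotaE_surj n r X hX
      refine ⟨σ.symm A, (hβ _).mp (by simpa using hl), ?_⟩
      rw [iotaE_map]; simp
    · rintro ⟨i, hi, hX⟩
      rw [← iotaE_map] at hX
      have := Finset.map_injective Fin.valEmbedding hX
      subst this
      exact ⟨iotaE_card _ _ _, (hβ i).mpr hi⟩
  refine ⟨β, ?_, ?_⟩
  · rw [eq_univ_iff_forall]
    intro v
    have hv : (v:ℕ) ∈ (Ht n r T σ).biUnion id := by rw [hT]; simp
    rw [mem_biUnion] at hv
    obtain ⟨A, hA, hvA⟩ := hv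
    have hA' := hA
    simp only [Ht, mem_image, mem_filter, mem_univ, true_and] at hA'
    obtain ⟨i, hi, rfl⟩ := hA'
    rw [mem_vs]
    refine ⟨iotaE n r (σ i), (hG _).mpr (by rw [iotaE_map]; exact hA), ?_⟩
    simp only [iotaE, mem_filter, mem_univ, true_and]
    exact hvA
  · rintro ⟨M, hM, hM2, hM3⟩
    apply hbad
    rw [pmCount, card_pos]
    refine ⟨M.image (fun X => X.map Fin.valEmbedding), ?_⟩
    rw [pmSet, mem_filter, mem_powerset]
    refine ⟨?_, ?_, ?_⟩
    · intro A hA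
      obtain ⟨X, hX, rfl⟩ := mem_image.mp hA
      exact (hG X).mp (hM hX)
    · intro A hA A' hA' hne
      obtain ⟨X, hX, rfl⟩ := mem_image.mp hA
      obtain ⟨X', hX', rfl⟩ := mem_image.mp hA'
      have hd := hM2 X hX X' hX' (fun h => hne (by rw [h]))
      rw [← Finset.map_inter, disjoint_iff_inter_eq_empty.mp hd, map_empty]
    · ext x
      simp only [mem_biUnion, mem_image, id]
      constructor
      · rintro ⟨A, ⟨X, hX, rfl⟩, hx⟩
        simp only [Finset.mem_map, Fin.valEmbedding_apply] at hx
        obtain ⟨i, _, rfl⟩ := hx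
        simp
      · intro hx
        have hv : (⟨x, mem_range.mp hx⟩ : Fin n) ∈ vs M := by rw [hM3]; exact mem_univ _
        obtain ⟨X, hX, hxX⟩ := mem_vs.mp hv
        refine ⟨_, ⟨X, hX, rfl⟩, ?_⟩
        rw [Finset.mem_map]
        exact ⟨_, hxX, rfl⟩

lemma shamir_aux (r : ℕ) (hr : 3 ≤ r) (ρ : ℝ) (hρ : 0 < ρ) :
    ∃ n₀ : ℕ, ∀ n : ℕ, n₀ ≤ n → r ∣ n →
      pr (fun σ : Fin (Kn n r).card ≃ {A // A ∈ Kn n r} =>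
              ¬ 0 < pmCount (Finset.range n) (Ht n r (hitTime n r σ) σ)) ≤ ρ := by
  obtain ⟨s, rfl⟩ : ∃ s, r = s+1 := ⟨r-1, by omega⟩
  obtain ⟨n₁, h1⟩ := eventually_atTop.mp (fail_ev s (by omega) (ρ/2) (by linarith))
  refine ⟨max n₁ (s+1), fun n hn hd => ?_⟩
  have hn1 : n₁ ≤ n := le_trans (le_max_left _ _) hn
  have hn2 : s+1 ≤ n := le_trans (le_max_right _ _) hn
  set N := (Kn n (s+1)).card with hN
  set Q := ⌈2*(N:ℝ)^2/ρ⌉₊ + 1 with hQ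
  have hQ0 : 0 < Q := by omega
  have hD : 0 < (n-1).choose s := Nat.choose_pos (by omega)
  have hB : 0 < 8*((n-1).choose s)*Q := by positivity
  have hf := h1 n hn1 hd (Fin n) (Fintype.card_fin n) Q hQ0
  have : Nonempty (Fin (8*((n-1).choose s)*Q)) := ⟨⟨0, hB⟩⟩
  let Fl : ({A // A ∈ Kn n (s+1)} → Fin (8*((n-1).choose s)*Q)) → Prop := fun lam =>
    ∀ l : Finset (Fin n) → Fin (8*((n-1).choose s)*Q), (∀ e, l (iotaE n (s+1) e) = lam e) → FailL (s+1) l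
  have ht := transfer (E := {A // A ∈ Kn n (s+1)}) (N := N) hB (by simp [hN])
    (fun σ => ¬ 0 < pmCount (Finset.range n) (Ht n (s+1) (hitTime n (s+1) σ) σ)) Fl (by
      intro σ lam hm hb l hl
      apply bad_fail n (s+1) _ (by omega) hn2 σ l _ hb
      simpa only [hl] using hm)
  have hmg := marginal (β := Fin (8*((n-1).choose s)*Q)) (iotaE n (s+1)) (iotaE_inj n (s+1)) Fl
  have hle : pr Fl ≤ ρ/2 := by
    rw [← hmg]
    refine le_trans (pr_mono ?_) hf
    intro l hl
    exact hl l (fun _ => rfl)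
  have hlast : (N:ℝ)^2/((8*((n-1).choose s)*Q : ℕ):ℝ) ≤ ρ/2 := by
    have hQ1 : 2*(N:ℝ)^2/ρ ≤ Q := by
      rw [hQ]; push_cast
      have := Nat.le_ceil (2*(N:ℝ)^2/ρ)
      linarith
    have hQB : (Q:ℝ) ≤ ((8*((n-1).choose s)*Q : ℕ):ℝ) := by
      have : Q ≤ 8*((n-1).choose s)*Q := Nat.le_mul_of_pos_left _ (by positivity)
      exact_mod_cast this
    have hBp : (0:ℝ) < ((8*((n-1).choose s)*Q : ℕ):ℝ) := by exact_mod_cast hB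
    rw [div_le_iff₀ hBp]
    rw [div_le_iff₀ hρ] at hQ1
    nlinarith
  linarith

end partK2

open scoped Classical in
/-- **Hitting time theorem (Theorem 2).** For a uniformly random ordering of all
`r`-subsets of `[n]`, w.h.p. `H_T` contains a perfect matching, where `T` is the
first time all vertices are covered. -/
theorem shamir_hitting_time (r : ℕ) (hr : 3 ≤ r) (ρ : ℝ) (hρ : 0 < ρ) :
    ∃ n₀ : ℕ, ∀ n : ℕ, n₀ ≤ n → r ∣ n →
      1 - ρ ≤
        ((Finset.univ.filter
            (fun σ : Fin (Kn n r).card ≃ {A // A ∈ Kn n r} =>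
              0 < pmCount (Finset.range n) (Ht n r (hitTime n r σ) σ))).card : ℝ) /
          (Fintype.card (Fin (Kn n r).card ≃ {A // A ∈ Kn n r}) : ℝ) := by
  obtain ⟨n₀, h⟩ := shamir_aux r hr ρ hρ
  refine ⟨n₀, fun n hn hd => ?_⟩
  have h1 := h n hn hd
  have hne : Nonempty (Fin (Kn n r).card ≃ {A // A ∈ Kn n r}) := ⟨(Kn n r).equivFin.symm⟩
  rw [pr_not, pr_def] at h1
  have h2 : ∀ x : ℝ, 1 - x ≤ ρ → 1 - ρ ≤ x := fun x hx => by linarith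
  have h3 := h2 _ h1
  convert h3
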